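/- arXiv:1601.00717 — 2 statements merged into one kernel-verified Lean document; each statement's English description precedes it below -/
import Mathlib

section
/- For any γ > 0 and any two probability measures μ, ν ∈ M_{γ/8}, lim_{t→∞} t^{2−γ} ‖μP^t − νP^t‖_TV = 0. -/
open MeasureTheory Set Filter

noncomputable section

/-- The open set `U ⊂ ℝ^m` with which the open simplex `Δ` is identified
(via `y = Ē - ∑ i, x i`). -/
def simU (m : ℕ) (E : ℝ) : Set (Fin m → ℝ) := {x | (∀ i, 0 < x i) ∧ ∑ i, x i < E}

/-- The state space `Δ`. -/
abbrev Delta (m : ℕ) (E : ℝ) : Type := ↥(simU m E)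

/-- The tank energy `y = Ē - ∑ i, x i`. -/
def tank (m : ℕ) (E : ℝ) (x : Delta m E) : ℝ := E - ∑ i, x.1 i

/-- The energy exchange map on the ambient space: particle `i` gets energy
`y + (1-u²) x^i`, and the new tank energy is `u² x^i`. -/
def T0 (m : ℕ) (E : ℝ) (i : Fin m) (u : ℝ) (x : Fin m → ℝ) : Fin m → ℝ :=
  Function.update x i ((E - ∑ j, x j) + (1 - u ^ 2) * x i)

lemma T0_mem {m : ℕ} {E : ℝ} {i : Fin m} {u : ℝ} {x : Fin m → ℝ}
    (hx : x ∈ simU m E) (hu : u ∈ Ioo (0:ℝ) 1) : T0 m E i u x ∈ simU m E := by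
  obtain ⟨hpos, hsum⟩ := hx
  obtain ⟨hu0, hu1⟩ := hu
  have hy : 0 < E - ∑ j, x j := sub_pos.mpr hsum
  have hu2 : 0 < 1 - u ^ 2 := by nlinarith
  have hxi := hpos i
  constructor
  · intro j
    rcases eq_or_ne j i with rfl | hj
    · simp only [T0, Function.update_self]
      nlinarith
    · simpa [T0, Function.update_of_ne hj] using hpos j
  · have h1 : ∑ j, T0 m E i u x j
        = ((E - ∑ j, x j) + (1 - u ^ 2) * x i) + ∑ j ∈ Finset.univ \ {i}, x j := by
      simp only [T0]
      rw [Finset.sum_update_of_mem (Finset.mem_univ i)]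
    have h2 : ∑ j ∈ Finset.univ \ {i}, x j = (∑ j, x j) - x i := by
      rw [← Finset.erase_eq]
      exact Finset.sum_erase_eq_sub (Finset.mem_univ i)
    rw [h1, h2]
    nlinarith [mul_pos (mul_pos hu0 hu0) hxi]

/-- The energy exchange map `T_{i,u} : Δ → Δ` (defined to be the identity for
`u ∉ (0,1)`, which is a probability-zero event). -/
def Texch (m : ℕ) (E : ℝ) (i : Fin m) (u : ℝ) (x : Delta m E) : Delta m E :=
  if hu : u ∈ Ioo (0:ℝ) 1 then ⟨T0 m E i u x.1, T0_mem x.2 hu⟩ else x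

/-- The uniform distribution on `(0,1)`. -/
def unif01 : Measure ℝ := volume.restrict (Ioo (0:ℝ) 1)

/-- The uniformization constant `Λ = √(m Ē)`, an upper bound for the total jump rate. -/
def Lam (m : ℕ) (E : ℝ) : ℝ := Real.sqrt (m * E)

/-- The total jump rate `∑ i, √(x^i)`. -/
def jumpRate (m : ℕ) (E : ℝ) (x : Delta m E) : ℝ := ∑ i, Real.sqrt (x.1 i)

/-- One step of the uniformized embedded chain: with probability `1 - r(x)/Λ` stay put,
and with probability `√(x^i)/Λ` particle `i` exchanges energy with the tank, with
`u` drawn uniformly from `(0,1)`. -/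
def ustep (m : ℕ) (E : ℝ) (x : Delta m E) : Measure (Delta m E) :=
  ENNReal.ofReal (1 - jumpRate m E x / Lam m E) • Measure.dirac x
  + (ENNReal.ofReal (Lam m E))⁻¹ •
      Measure.sum (fun i : Fin m =>
        ENNReal.ofReal (Real.sqrt (x.1 i)) • Measure.map (fun u => Texch m E i u x) unif01)

/-- `n`-fold iterate of the uniformized chain. -/
def ustepIter (m : ℕ) (E : ℝ) : ℕ → Delta m E → Measure (Delta m E)
  | 0 => fun x => Measure.dirac x
  | (n+1) => fun x => (ustep m E x).bind (ustepIter m E n)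

/-- The transition probabilities `P^t(x, ·)` of the energy-exchange jump process,
constructed by uniformization: `P^t = ∑ₙ e^{-Λt} (Λt)ⁿ/n! Kⁿ`. -/
def Pt (m : ℕ) (E : ℝ) (t : ℝ) (x : Delta m E) : Measure (Delta m E) :=
  Measure.sum (fun n : ℕ =>
    ENNReal.ofReal (Real.exp (-(Lam m E) * t) * ((Lam m E) * t) ^ n / n.factorial) •
      ustepIter m E n x)

/-- Lebesgue measure on `Δ ≅ U`. -/
def lebU (m : ℕ) (E : ℝ) : Measure (Delta m E) := Measure.comap Subtype.val volume

/-- The (unnormalized) measure with density `y^{-1/2}` w.r.t. Lebesgue measure on `U`. -/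
def piPre (m : ℕ) (E : ℝ) : Measure (Delta m E) :=
  (lebU m E).withDensity (fun x => ENNReal.ofReal ((tank m E x) ^ (-(1/2) : ℝ)))

/-- The invariant probability measure `π`, with density `Z⁻¹ y^{-1/2}`. -/
def piMeasure (m : ℕ) (E : ℝ) : Measure (Delta m E) :=
  (piPre m E Set.univ)⁻¹ • piPre m E

/-- Total variation distance between two (finite) measures:
`sup_A |μ(A) - ν(A)|`. -/
def tvDist {X : Type*} [MeasurableSpace X] (μ ν : Measure X) : ℝ :=
  ⨆ A : {A : Set X // MeasurableSet A}, |(μ A.1).toReal - (ν A.1).toReal|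

end

/-- Membership in the class `M_δ` of Borel probability measures `μ` on `Δ` with
`∫ (∑_k (x^k)^{2δ-1} + y^{δ-1/2}) dμ < ∞`. -/
def memM (m : ℕ) (E : ℝ) (δ : ℝ) (μ : Measure (Delta m E)) : Prop :=
  IsProbabilityMeasure μ ∧
  ∫⁻ x, ENNReal.ofReal (∑ k, (x.1 k) ^ (2*δ - 1) + (tank m E x) ^ (δ - 1/2)) ∂μ ≠ ⊤

lemma pc_step {X : Type*} [MeasurableSpace X] (κ : X → Measure X)
    (hκ : ∀ x, IsProbabilityMeasure (κ x)) (V : X → ℝ) (hV1 : ∀ x, 1 ≤ V x)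
    (hint : ∀ x, Integrable V (κ x)) (θ A η : ℝ) (hθ : 0 < θ) (hA : 0 < A)
    (g : X → ℝ) (hg : Measurable g) (hg1 : ∀ x, g x ∈ Icc (0:ℝ) 1)
    (hosc : ∀ x x', g x - g x' ≤ θ * (A + V x + V x')) (x x' : X)
    (hov : ∀ f : X → ℝ, Measurable f → (∀ z, f z ∈ Icc (0:ℝ) 1) →
      ∫ z, f z ∂κ x - ∫ z, f z ∂κ x' ≤ 1 - η) :
    ∫ z, g z ∂κ x - ∫ z, g z ∂κ x' ≤
      θ * ((1 - η) * A + ∫ z, V z ∂κ x + ∫ z, V z ∂κ x') := by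
  obtain ⟨c0, hc0⟩ : ∃ c0, ∀ z, |g z - c0| ≤ θ * (A / 2 + V z) := by
    have hbdd : BddAbove (range fun z => g z - θ * (A / 2 + V z)) := by
      refine ⟨1, ?_⟩
      rintro _ ⟨z, rfl⟩
      have := (hg1 z).2
      have h2 : 0 ≤ θ * (A / 2 + V z) := by have := hV1 z; positivity
      simp only; linarith
    refine ⟨⨆ z, (g z - θ * (A / 2 + V z)), fun z => ?_⟩
    have h1 := le_ciSup hbdd z
    have : Nonempty X := ⟨z⟩
    have h2 : ⨆ z, (g z - θ * (A / 2 + V z)) ≤ g z + θ * (A / 2 + V z) := by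
      apply ciSup_le
      intro w
      have := hosc w z
      linarith
    rw [abs_le]; constructor <;> linarith
  set L := θ * A / 2 with hL
  have hLpos : 0 < L := by positivity
  set p : X → ℝ := fun z => max (-L) (min L (g z - c0)) with hp
  have hpm : Measurable p := by fun_prop
  have hp1 : ∀ z, -L ≤ p z := fun z => le_max_left _ _
  have hp2 : ∀ z, p z ≤ L := fun z => max_le (by linarith) (min_le_left _ _)
  have hr : ∀ z, |g z - c0 - p z| ≤ θ * V z := by
    intro z
    have h := hc0 z
    have hv : 0 ≤ θ * V z := by have := hV1 z; positivity
    have hLe : θ * (A / 2 + V z) = L + θ * V z := by rw [hL]; ring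
    rw [hLe] at h
    rw [abs_le] at h ⊢
    simp only [hp]
    rcases max_cases (-L) (min L (g z - c0)) with ⟨h1, h2⟩ | ⟨h1, h2⟩ <;>
    rcases min_cases L (g z - c0) with ⟨h3, h4⟩ | ⟨h3, h4⟩ <;> constructor <;> linarith
  have hgi : ∀ y, Integrable g (κ y) := fun y => by
    have := hκ y
    exact Integrable.of_bound hg.aestronglyMeasurable 1 (ae_of_all _ fun z => by
      rw [Real.norm_eq_abs, abs_of_nonneg (hg1 z).1]; exact (hg1 z).2)
  have hpi : ∀ y, Integrable p (κ y) := fun y => by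
    have := hκ y
    exact Integrable.of_bound hpm.aestronglyMeasurable L (ae_of_all _ fun z => by
      rw [Real.norm_eq_abs, abs_le]; exact ⟨hp1 z, hp2 z⟩)
  have hgp : ∀ y, |∫ z, g z ∂κ y - c0 - ∫ z, p z ∂κ y| ≤ θ * ∫ z, V z ∂κ y := by
    intro y
    have := hκ y
    have e : ∫ z, g z ∂κ y - c0 - ∫ z, p z ∂κ y = ∫ z, (g z - c0 - p z) ∂κ y := by
      rw [integral_sub (f := fun z => g z - c0) ((hgi y).sub (integrable_const _)) (hpi y),
        integral_sub (hgi y) (integrable_const _)]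
      simp
    rw [e, ← integral_const_mul]
    refine (abs_integral_le_integral_abs).trans (integral_mono_of_nonneg
      (ae_of_all _ fun z => abs_nonneg _) ((hint y).const_mul θ) (ae_of_all _ hr))
  have hpd : ∫ z, p z ∂κ x - ∫ z, p z ∂κ x' ≤ (1 - η) * (2 * L) := by
    have h := hov (fun z => (p z + L) / (2 * L)) (by fun_prop) (fun z => by
      constructor
      · have := hp1 z; apply div_nonneg <;> linarith
      · rw [div_le_one (by linarith)]; have := hp2 z; linarith)
    have e : ∀ y, ∫ z, (p z + L) / (2 * L) ∂κ y = (∫ z, p z ∂κ y + L) / (2 * L) := by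
      intro y
      have := hκ y
      rw [integral_div, integral_add (hpi y) (integrable_const _)]
      simp
    rw [e, e, ← sub_div, div_le_iff₀ (by linarith)] at h
    linarith
  have h1 := abs_le.1 (hgp x)
  have h2 := abs_le.1 (hgp x')
  have : θ * ((1 - η) * A + ∫ z, V z ∂κ x + ∫ z, V z ∂κ x')
    = (1 - η) * (2 * L) + θ * ∫ z, V z ∂κ x + θ * ∫ z, V z ∂κ x' := by rw [hL]; ring
  rw [this]; linarith

lemma pc_theta (L β : ℝ) (hL : 1 ≤ L) (hβ : 1 ≤ β) :
    L ^ (-β) * (1 - β / (L + 1)) ≤ (L + 1) ^ (-β) := by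
  have hL0 : 0 < L := by linarith
  have h := one_add_mul_self_le_rpow_one_add (s := -(1 / (L + 1))) (p := β) (by
    have : 1 / (L+1) ≤ 1 := by rw [div_le_one (by linarith)]; linarith
    linarith) hβ
  have e : 1 + -(1 / (L + 1)) = L / (L + 1) := by field_simp; ring
  rw [e, Real.div_rpow hL0.le (by linarith)] at h
  rw [Real.rpow_neg hL0.le, Real.rpow_neg (by linarith : 0 ≤ L + 1)]
  have hp : 0 < L ^ β := by positivity
  have hq : 0 < (L+1) ^ β := by positivity
  rw [inv_mul_le_iff₀ hp, ← div_eq_mul_inv]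
  refine le_trans (le_of_eq ?_) h
  ring

theorem pc_contraction {X : Type*} [MeasurableSpace X] (κ : X → Measure X)
    (hκ : ∀ x, IsProbabilityMeasure (κ x)) (V : X → ℝ) (hV1 : ∀ x, 1 ≤ V x)
    (hint : ∀ x, Integrable V (κ x)) (α c b : ℝ) (hα : 0 < α) (hα1 : α < 1) (hc : 0 < c)
    (hb : 0 ≤ b) (hdrift : ∀ x, ∫ z, V z ∂κ x ≤ V x - c * V x ^ α + b)
    (hov : ∀ R : ℝ, ∃ η > 0, ∀ x x', V x ≤ R → V x' ≤ R → 
      ∀ f : X → ℝ, Measurable f → (∀ z, f z ∈ Icc (0:ℝ) 1) →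
      ∫ z, f z ∂κ x - ∫ z, f z ∂κ x' ≤ 1 - η) :
    ∃ C, 0 ≤ C ∧ ∀ g : ℕ → X → ℝ, (∀ n, Measurable (g n)) → (∀ n x, g n x ∈ Icc (0:ℝ) 1) →
      (∀ n x, g (n+1) x = ∫ z, g n z ∂κ x) → ∀ n x x',
      g n x - g n x' ≤ C * ((n:ℝ) + 1) ^ (-(1 / (1 - α))) * (V x + V x') := by
  set β := 1 / (1 - α) with hβd
  have h1α : 0 < 1 - α := by linarith
  have hβ1 : 1 ≤ β := by rw [hβd, le_div_iff₀ h1α]; linarith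
  -- R
  obtain ⟨R, hR1, hR⟩ : ∃ R : ℝ, 1 ≤ R ∧ ∀ S, R < S → 4 * b ≤ c * S ^ α := by
    refine ⟨max 1 ((4 * b / c) ^ (1 / α)), le_max_left _ _, fun S hS => ?_⟩
    have h0 : 0 ≤ 4 * b / c := by positivity
    have : (4 * b / c) ^ (1 / α) ≤ S := (le_max_right _ _).trans hS.le
    have h := Real.rpow_le_rpow (by positivity) this hα.le
    rw [← Real.rpow_mul h0, one_div_mul_cancel hα.ne', Real.rpow_one, div_le_iff₀ hc] at h
    linarith
  obtain ⟨η, hη, hov⟩ := hov R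
  set A := 4 * (b + 1) / η with hA
  have hA0 : 0 < A := by positivity
  have hAη : η * A = 4 * (b + 1) := by rw [hA]; field_simp
  set n0 := 1 + β * (A + R) / 2 with hn0
  have hn01 : 1 ≤ n0 := by rw [hn0]; have : 0 ≤ β * (A + R) / 2 := by positivity
                           linarith
  set K := 2 * β * (A + 1) / c with hK
  have hK0 : 0 < K := by positivity
  set c' := max (K ^ β) (n0 ^ β) with hc'
  have hc'0 : 0 < c' := lt_of_lt_of_le (by positivity) (le_max_left _ _)
  have hc'K : K ≤ c' ^ (1 - α) := by
    have h := Real.rpow_le_rpow (by positivity) (le_max_left (K ^ β) (n0 ^ β)) h1α.le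
    rwa [← Real.rpow_mul hK0.le, hβd, one_div_mul_cancel h1α.ne', Real.rpow_one] at h
  have main : ∀ g : ℕ → X → ℝ, (∀ n, Measurable (g n)) → (∀ n x, g n x ∈ Icc (0:ℝ) 1) →
      (∀ n x, g (n+1) x = ∫ z, g n z ∂κ x) → ∀ (n : ℕ) x x',
      g n x - g n x' ≤ (c' * ((n:ℝ) + n0) ^ (-β)) * (A + V x + V x') := by
    intro g hgm hg1 hgr n
    induction n with
    | zero =>
      intro x x'
      have h1 := (hg1 0 x).2
      have h2 := (hg1 0 x').1
      have h3 : 1 ≤ c' * (((0:ℕ):ℝ) + n0) ^ (-β) := by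
        rw [Nat.cast_zero, zero_add, Real.rpow_neg (by linarith), ← div_eq_mul_inv,
          one_le_div (by positivity)]
        exact le_max_right _ _
      have h4 := hV1 x
      have h5 := hV1 x'
      nlinarith
    | succ n ih =>
      intro x x'
      set L := (n:ℝ) + n0 with hL
      have hL1 : 1 ≤ L := by have : (0:ℝ) ≤ n := n.cast_nonneg
                             linarith
      have hLn : n0 ≤ L := by have : (0:ℝ) ≤ n := n.cast_nonneg
                              linarith
      have eL : ((n+1:ℕ):ℝ) + n0 = L + 1 := by rw [hL]; push_cast; ring
      rw [eL]
      set S := V x + V x' with hS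
      have hx := hV1 x
      have hx' := hV1 x'
      have hS1 : 2 ≤ S := by linarith
      rw [add_assoc A, ← hS]
      set θ := c' * L ^ (-β) with hθ
      have hθ0 : 0 < θ := by positivity
      have hth : θ * (1 - β / (L + 1)) ≤ c' * (L + 1) ^ (-β) := by
        rw [hθ, mul_assoc]
        exact mul_le_mul_of_nonneg_left (pc_theta L β hL1 hβ1) hc'0.le
      by_cases htriv : 1 ≤ c' * (L + 1) ^ (-β) * (A + S)
      · have h1 := (hg1 (n+1) x).2
        have h2 := (hg1 (n+1) x').1
        linarith
      push Not at htriv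
      -- suffices
      suffices hs : ∃ D, β * (A + S) ≤ D * (L + 1) ∧
          g (n+1) x - g (n+1) x' ≤ θ * (A + S - D) by
        obtain ⟨D, hD, hs⟩ := hs
        refine hs.trans (le_trans ?_ (mul_le_mul_of_nonneg_right hth (by linarith)))
        rw [mul_assoc θ (1 - β / (L + 1))]
        refine mul_le_mul_of_nonneg_left ?_ hθ0.le
        have : β * (A + S) / (L + 1) ≤ D := by rwa [div_le_iff₀ (by linarith)]
        have e : (1 - β / (L + 1)) * (A + S) = A + S - β * (A + S) / (L + 1) := by ring
        rw [e]; linarith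
      have hVα : ∀ z, 0 ≤ c * V z ^ α := fun z => by have := hV1 z; positivity
      by_cases hSR : S ≤ R
      · refine ⟨2, ?_, ?_⟩
        · have : β * (A + S) ≤ β * (A + R) := by gcongr
          linarith
        · have h := pc_step κ hκ V hV1 hint θ A η hθ0 hA0 (g n) (hgm n) (hg1 n) ih x x'
            (hov x x' (by linarith) (by linarith))
          rw [hgr, hgr]
          refine h.trans (mul_le_mul_of_nonneg_left ?_ hθ0.le)
          have d1 := hdrift x
          have d2 := hdrift x'
          have e1 := hVα x
          have e2 := hVα x'
          nlinarith
      · push Not at hSR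
        refine ⟨c / 2 * S ^ α, ?_, ?_⟩
        · have hS0 : 0 < S := by linarith
          have hlt : c' * (A + S) < (L + 1) ^ β := by
            rw [Real.rpow_neg (by linarith)] at htriv
            have : 0 < (L+1) ^ β := by positivity
            field_simp at htriv
            linarith
          have h1 : c' ^ (1 - α) * (A + S) ^ (1 - α) ≤ L + 1 := by
            rw [← Real.mul_rpow hc'0.le (by linarith)]
            have h := Real.rpow_le_rpow (by positivity) hlt.le h1α.le
            rwa [← Real.rpow_mul (by linarith), hβd, one_div_mul_cancel h1α.ne',
              Real.rpow_one] at h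
          have h2 : (A + S) ^ α ≤ (A + 1) * S ^ α := by
            calc (A + S) ^ α ≤ ((A + 1) * S) ^ α := by
                  apply Real.rpow_le_rpow (by linarith) _ hα.le
                  nlinarith
              _ = (A + 1) ^ α * S ^ α := Real.mul_rpow (by linarith) hS0.le
              _ ≤ (A + 1) * S ^ α := by
                  gcongr
                  calc (A + 1) ^ α ≤ (A + 1) ^ (1:ℝ) :=
                        Real.rpow_le_rpow_of_exponent_le (by linarith) hα1.le
                    _ = A + 1 := Real.rpow_one _
          have h3 : A + S = (A + S) ^ (1 - α) * (A + S) ^ α := by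
            rw [← Real.rpow_add (by linarith)]; simp
          have h4 : K * (A + S) ^ (1 - α) ≤ L + 1 := by
            refine le_trans ?_ h1
            gcongr
          have h5 : K * c = 2 * β * (A + 1) := by rw [hK]; field_simp
          calc β * (A + S) = β * ((A + S) ^ (1 - α) * (A + S) ^ α) := by rw [← h3]
            _ ≤ β * ((A + S) ^ (1 - α) * ((A + 1) * S ^ α)) := by gcongr
            _ = (2 * β * (A + 1)) / 2 * S ^ α * (A + S) ^ (1 - α) := by ring
            _ = c / 2 * S ^ α * (K * (A + S) ^ (1 - α)) := by rw [← h5]; ring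
            _ ≤ _ := by gcongr
        · have h := pc_step κ hκ V hV1 hint θ A 0 hθ0 hA0 (g n) (hgm n) (hg1 n) ih x x'
            (fun f hf hf1 => by
              have := hκ x
              have := hκ x'
              have i1 : ∫ z, f z ∂κ x ≤ 1 := by
                have := integral_mono (μ := κ x) (Integrable.of_bound hf.aestronglyMeasurable 1
                  (ae_of_all _ fun z => by
                    rw [Real.norm_eq_abs, abs_of_nonneg (hf1 z).1]; exact (hf1 z).2))
                  (integrable_const (1:ℝ)) (fun z => (hf1 z).2)
                simpa using this
              have i2 : 0 ≤ ∫ z, f z ∂κ x' := integral_nonneg fun z => (hf1 z).1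
              linarith)
          rw [hgr, hgr]
          refine h.trans (mul_le_mul_of_nonneg_left ?_ hθ0.le)
          have d1 := hdrift x
          have d2 := hdrift x'
          have hsub : S ^ α ≤ V x ^ α + V x' ^ α :=
            Real.rpow_add_le_add_rpow (by linarith) (by linarith) hα.le hα1.le
          have := hR S hSR
          have := mul_le_mul_of_nonneg_left hsub hc.le
          linarith
  refine ⟨c' * (A + 1), by positivity, fun g h1 h2 h3 n x x' => (main g h1 h2 h3 n x x').trans ?_⟩
  have hx := hV1 x
  have hx' := hV1 x'
  have hn : (0:ℝ) ≤ n := n.cast_nonneg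
  calc c' * ((n:ℝ) + n0) ^ (-β) * (A + V x + V x')
      ≤ c' * ((n:ℝ) + 1) ^ (-β) * ((A + 1) * (V x + V x')) := by
        gcongr ?_ * ?_
        · gcongr c' * ?_
          exact Real.rpow_le_rpow_of_nonpos (by linarith) (by linarith) (by linarith)
        · nlinarith
    _ = _ := by ring

lemma pc_mc (m : ℕ) (E : ℝ) (i : Fin m) : Measurable (fun x : Delta m E => x.1 i) :=
  (measurable_pi_apply i).comp measurable_subtype_coe

lemma pc_measurable_tank (m : ℕ) (E : ℝ) : Measurable (tank m E) :=
  measurable_const.sub (Finset.measurable_sum _ fun i _ => pc_mc m E i)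

lemma pc_measurable_Texch (m : ℕ) (E : ℝ) (i : Fin m) :
    Measurable (fun p : Delta m E × ℝ => Texch m E i p.2 p.1) := by
  have h : Measurable (fun p : Delta m E × ℝ => ((Texch m E i p.2 p.1 : Delta m E) : Fin m → ℝ)) := by
    have e : (fun p : Delta m E × ℝ => ((Texch m E i p.2 p.1 : Delta m E) : Fin m → ℝ)) =
        fun p => if p.2 ∈ Ioo (0:ℝ) 1 then T0 m E i p.2 p.1.1 else p.1.1 := by
      funext p
      unfold Texch
      split_ifs <;> rfl
    rw [e]
    refine Measurable.ite (measurableSet_Ioo.preimage measurable_snd) ?_ (by fun_prop)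
    rw [measurable_pi_iff]
    intro j
    by_cases hj : j = i
    · subst hj
      simp only [T0, Function.update_self]
      exact ((pc_measurable_tank m E).comp measurable_fst).add
        ((measurable_const.sub (measurable_snd.pow_const 2)).mul
          ((pc_mc m E j).comp measurable_fst))
    · simp only [T0, Function.update_of_ne hj]
      exact (pc_mc m E j).comp measurable_fst
  exact h.subtype_mk

lemma pc_measurable_Texch_left (m : ℕ) (E : ℝ) (i : Fin m) (x : Delta m E) :
    Measurable (fun u : ℝ => Texch m E i u x) :=
  (pc_measurable_Texch m E i).comp measurable_prodMk_left

instance pc_unif_prob : IsProbabilityMeasure unif01 := ⟨by simp [unif01]⟩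

lemma pc_measurable_jumpRate (m : ℕ) (E : ℝ) : Measurable (jumpRate m E) :=
  Finset.measurable_sum _ fun i _ => (pc_mc m E i).sqrt

lemma pc_lintegral_ustep (m : ℕ) (E : ℝ) (x : Delta m E) (F : Delta m E → ENNReal)
    (hF : Measurable F) : ∫⁻ z, F z ∂(ustep m E x) =
      ENNReal.ofReal (1 - jumpRate m E x / Lam m E) * F x
      + (ENNReal.ofReal (Lam m E))⁻¹ * ∑ i, ENNReal.ofReal (Real.sqrt (x.1 i)) *
        ∫⁻ u, F (Texch m E i u x) ∂unif01 := by
  unfold ustep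
  rw [lintegral_add_measure, lintegral_smul_measure, lintegral_smul_measure,
    lintegral_dirac' _ hF, lintegral_sum_measure, tsum_fintype]
  simp only [smul_eq_mul, lintegral_smul_measure]
  congr 3
  funext i
  rw [lintegral_map hF (pc_measurable_Texch_left m E i x)]

lemma pc_measurable_ustep (m : ℕ) (E : ℝ) : Measurable (ustep m E) := by
  refine Measure.measurable_of_measurable_coe _ fun s hs => ?_
  have e : (fun x => ustep m E x s) = fun x =>
      ENNReal.ofReal (1 - jumpRate m E x / Lam m E) * s.indicator 1 x
      + (ENNReal.ofReal (Lam m E))⁻¹ * ∑ i, ENNReal.ofReal (Real.sqrt (x.1 i)) *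
        ∫⁻ u, s.indicator 1 (Texch m E i u x) ∂unif01 := by
    funext x
    rw [← pc_lintegral_ustep m E x _ (measurable_one.indicator hs), lintegral_indicator_one hs]
  rw [e]
  have h1 := pc_measurable_jumpRate m E
  have h2 : Measurable (s.indicator (1 : Delta m E → ENNReal)) := measurable_one.indicator hs
  refine Measurable.add (by fun_prop) (Measurable.const_mul (Finset.measurable_sum _ fun i _ => ?_) _)
  refine Measurable.mul (pc_mc m E i).sqrt.ennreal_ofReal ?_
  exact Measurable.lintegral_prod_right' (f := fun p : Delta m E × ℝ =>
    s.indicator (1 : Delta m E → ENNReal) (Texch m E i p.2 p.1)) (h2.comp (pc_measurable_Texch m E i))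

lemma pc_Lam_pos {m : ℕ} {E : ℝ} (hm : 1 ≤ m) (hE : 0 < E) : 0 < Lam m E := by
  unfold Lam
  have : (0:ℝ) < m := by exact_mod_cast hm
  positivity

lemma pc_rate_le {m : ℕ} {E : ℝ} (x : Delta m E) : jumpRate m E x ≤ Lam m E := by
  unfold jumpRate Lam
  apply Real.le_sqrt_of_sq_le
  have h := sq_sum_le_card_mul_sum_sq (s := Finset.univ) (f := fun i => Real.sqrt (x.1 i))
  refine h.trans ?_
  have e : ∑ i, Real.sqrt (x.1 i) ^ 2 = ∑ i, x.1 i :=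
    Finset.sum_congr rfl fun i _ => Real.sq_sqrt (x.2.1 i).le
  rw [e]
  simp only [Finset.card_univ, Fintype.card_fin]
  exact mul_le_mul_of_nonneg_left x.2.2.le (by positivity)

lemma pc_prob_ustep {m : ℕ} {E : ℝ} (hm : 1 ≤ m) (hE : 0 < E) (x : Delta m E) :
    IsProbabilityMeasure (ustep m E x) := by
  constructor
  have hL := pc_Lam_pos hm hE
  have h := pc_lintegral_ustep m E x (fun _ => 1) measurable_const
  simp only [lintegral_const, one_mul, measure_univ, mul_one] at h
  rw [h, ← ENNReal.ofReal_sum_of_nonneg (fun i _ => Real.sqrt_nonneg _)]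
  change _ + _ * ENNReal.ofReal (jumpRate m E x) = 1
  have hr : 0 ≤ jumpRate m E x := Finset.sum_nonneg fun i _ => Real.sqrt_nonneg _
  have hr1 : jumpRate m E x / Lam m E ≤ 1 := by rw [div_le_one hL]; exact pc_rate_le x
  rw [← ENNReal.ofReal_inv_of_pos hL, ← ENNReal.ofReal_mul (by positivity),
    ← ENNReal.ofReal_add (by linarith) (by positivity)]
  rw [← ENNReal.ofReal_one]
  congr 1
  field_simp; ring

lemma pc_measurable_iter (m : ℕ) (E : ℝ) (n : ℕ) : Measurable (ustepIter m E n) := by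
  induction n with
  | zero => exact Measure.measurable_dirac
  | succ n ih => exact (Measure.measurable_bind' ih).comp (pc_measurable_ustep m E)

lemma pc_prob_iter {m : ℕ} {E : ℝ} (hm : 1 ≤ m) (hE : 0 < E) (n : ℕ) (x : Delta m E) :
    IsProbabilityMeasure (ustepIter m E n x) := by
  induction n generalizing x with
  | zero => exact Measure.dirac.isProbabilityMeasure
  | succ n ih =>
    have := pc_prob_ustep hm hE x
    constructor
    change ((ustep m E x).bind (ustepIter m E n)) univ = 1
    rw [Measure.bind_apply MeasurableSet.univ (pc_measurable_iter m E n).aemeasurable]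
    simp

lemma pc_lintegral_iter_succ (m : ℕ) (E : ℝ) (n : ℕ) (x : Delta m E) (F : Delta m E → ENNReal)
    (hF : Measurable F) : ∫⁻ z, F z ∂(ustepIter m E (n+1) x) =
      ∫⁻ w, ∫⁻ z, F z ∂(ustepIter m E n w) ∂(ustep m E x) :=
  Measure.lintegral_bind (pc_measurable_iter m E n).aemeasurable hF.aemeasurable

lemma pc_measurable_lint (m : ℕ) (E : ℝ) (n : ℕ) (F : Delta m E → ENNReal)
    (hF : Measurable F) : Measurable fun x => ∫⁻ z, F z ∂(ustepIter m E n x) :=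
  (Measure.measurable_lintegral hF).comp (pc_measurable_iter m E n)

lemma pc_lintegral_iter_add (m : ℕ) (E : ℝ) (n k : ℕ) (x : Delta m E) (F : Delta m E → ENNReal)
    (hF : Measurable F) : ∫⁻ z, F z ∂(ustepIter m E (n+k) x) =
      ∫⁻ w, ∫⁻ z, F z ∂(ustepIter m E k w) ∂(ustepIter m E n x) := by
  induction n generalizing x with
  | zero =>
    rw [zero_add]
    change _ = ∫⁻ w, _ ∂(Measure.dirac x)
    rw [lintegral_dirac' _ (pc_measurable_lint m E k F hF)]
  | succ n ih =>
    rw [show n + 1 + k = (n + k) + 1 by ring, pc_lintegral_iter_succ m E _ x F hF,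
      pc_lintegral_iter_succ m E _ x _ (pc_measurable_lint m E k F hF)]
    simp only [ih]

lemma pc_cov1 (r : ℝ) (hr : 0 < r) (H : ℝ → ENNReal) :
    ∫⁻ v in Ioo 0 r, H v ≤ ENNReal.ofReal (2 * r) * ∫⁻ u, H (u ^ 2 * r) ∂unif01 := by
  have himg : Ioo 0 r ⊆ (fun u : ℝ => u ^ 2 * r) '' Ioo 0 1 := by
    intro v hv
    refine ⟨Real.sqrt (v / r), ⟨Real.sqrt_pos.2 (div_pos hv.1 hr), ?_⟩, ?_⟩
    · rw [Real.sqrt_lt' one_pos]; rw [one_pow, div_lt_one hr]; exact hv.2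
    · simp only; rw [Real.sq_sqrt (div_pos hv.1 hr).le]; field_simp
  have hcv := lintegral_image_eq_lintegral_abs_deriv_mul (s := Ioo (0:ℝ) 1)
    (f := fun u : ℝ => u ^ 2 * r) (f' := fun u => 2 * u * r) measurableSet_Ioo
    (fun u _ => by
      have := ((hasDerivAt_pow 2 u).mul_const r).hasDerivWithinAt (s := Ioo (0:ℝ) 1)
      simpa using this)
    (fun u hu w hw h => by
      have h2 : u ^ 2 = w ^ 2 := mul_right_cancel₀ hr.ne' h
      exact (pow_left_inj₀ hu.1.le hw.1.le (by norm_num)).1 h2) H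
  calc ∫⁻ v in Ioo 0 r, H v ≤ ∫⁻ v in (fun u : ℝ => u ^ 2 * r) '' Ioo 0 1, H v :=
        lintegral_mono_set himg
    _ = _ := hcv
    _ ≤ ∫⁻ u in Ioo (0:ℝ) 1, ENNReal.ofReal (2 * r) * H (u ^ 2 * r) := by
        refine setLIntegral_mono' measurableSet_Ioo fun u hu => ?_
        gcongr
        rw [abs_of_nonneg (by have := hu.1; positivity)]
        nlinarith [hu.1, hu.2]
    _ = _ := by rw [lintegral_const_mul' _ _ ENNReal.ofReal_ne_top]; rfl

lemma pc_cov2 (r : ℝ) (hr : 0 < r) (H : ℝ → ENNReal) :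
    ∫⁻ v in Ioo 0 r, H v ≤ ENNReal.ofReal (2 * r) * ∫⁻ u, H ((1 - u ^ 2) * r) ∂unif01 := by
  have himg : Ioo 0 r ⊆ (fun u : ℝ => (1 - u ^ 2) * r) '' Ioo 0 1 := by
    intro v hv
    have h1 : v / r < 1 := by rw [div_lt_one hr]; exact hv.2
    have h0 : 0 < v / r := div_pos hv.1 hr
    refine ⟨Real.sqrt (1 - v / r), ⟨Real.sqrt_pos.2 (by linarith), ?_⟩, ?_⟩
    · rw [Real.sqrt_lt' one_pos]; linarith
    · simp only; rw [Real.sq_sqrt (by linarith)]; field_simp; ring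
  have hcv := lintegral_image_eq_lintegral_abs_deriv_mul (s := Ioo (0:ℝ) 1)
    (f := fun u : ℝ => (1 - u ^ 2) * r) (f' := fun u => -(2 * u) * r) measurableSet_Ioo
    (fun u _ => by
      have := (((hasDerivAt_pow 2 u).const_sub 1).mul_const r).hasDerivWithinAt (s := Ioo (0:ℝ) 1)
      simpa using this)
    (fun u hu w hw h => by
      have h2 : 1 - u ^ 2 = 1 - w ^ 2 := mul_right_cancel₀ hr.ne' h
      exact (pow_left_inj₀ hu.1.le hw.1.le two_ne_zero).1 (by linarith)) H
  calc ∫⁻ v in Ioo 0 r, H v ≤ ∫⁻ v in (fun u : ℝ => (1 - u ^ 2) * r) '' Ioo 0 1, H v :=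
        lintegral_mono_set himg
    _ = _ := hcv
    _ ≤ ∫⁻ u in Ioo (0:ℝ) 1, ENNReal.ofReal (2 * r) * H ((1 - u ^ 2) * r) := by
        refine setLIntegral_mono' measurableSet_Ioo fun u hu => ?_
        gcongr
        rw [neg_mul, abs_neg, abs_of_nonneg (by have := hu.1; positivity)]
        nlinarith [hu.1, hu.2]
    _ = _ := by rw [lintegral_const_mul' _ _ ENNReal.ofReal_ne_top]; rfl

lemma pc_coord_lt {m : ℕ} {E : ℝ} (x : Delta m E) (i : Fin m) : x.1 i < E :=
  lt_of_le_of_lt (Finset.single_le_sum (f := x.1) (fun j _ => (x.2.1 j).le) (Finset.mem_univ i)) x.2.2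

lemma pc_ring_lower {m : ℕ} {E : ℝ} (hm : 1 ≤ m) (hE : 0 < E) (s q : ℝ → ℝ → ℝ)
    (hcov : ∀ r > 0, ∀ H : ℝ → ENNReal,
      ∫⁻ v in Ioo 0 r, H v ≤ ENNReal.ofReal (2 * r) * ∫⁻ u, H (q r u) ∂unif01)
    (hsq : ∀ r > 0, ∀ u ∈ Ioo (0:ℝ) 1, s r (q r u) = u)
    (x : Delta m E) (i : Fin m) (ε ε0 : ℝ) (hε0 : ε0 ≤ ε) (hε : 0 < ε) (hx : ε ≤ x.1 i)
    (F : Delta m E → ENNReal) (hF : Measurable F) :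
    ENNReal.ofReal ((Lam m E)⁻¹ * Real.sqrt ε * (2 * E)⁻¹) *
      ∫⁻ v in Ioo 0 ε0, F (Texch m E i (s (x.1 i) v) x) ≤ ∫⁻ z, F z ∂(ustep m E x) := by
  have hL := pc_Lam_pos hm hE
  have hxi := x.2.1 i
  set I := ∫⁻ u, F (Texch m E i u x) ∂unif01 with hI
  have h1 : ∫⁻ v in Ioo 0 ε0, F (Texch m E i (s (x.1 i) v) x) ≤ ENNReal.ofReal (2 * E) * I := by
    calc _ ≤ ∫⁻ v in Ioo 0 (x.1 i), F (Texch m E i (s (x.1 i) v) x) :=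
          lintegral_mono_set (Ioo_subset_Ioo_right (hε0.trans hx))
      _ ≤ _ := hcov _ hxi _
      _ = ENNReal.ofReal (2 * x.1 i) * I := by
          congr 1
          refine setLIntegral_congr_fun measurableSet_Ioo fun u hu => ?_
          rw [hsq _ hxi u hu]
      _ ≤ _ := by
          gcongr
          exact (pc_coord_lt x i).le
  rw [pc_lintegral_ustep m E x F hF]
  refine le_trans ?_ le_add_self
  calc _ ≤ ENNReal.ofReal ((Lam m E)⁻¹ * Real.sqrt ε * (2 * E)⁻¹) * (ENNReal.ofReal (2 * E) * I) := by
        gcongr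
    _ = ENNReal.ofReal ((Lam m E)⁻¹) * (ENNReal.ofReal (Real.sqrt ε) * I) := by
        rw [← mul_assoc, ← mul_assoc, ← ENNReal.ofReal_mul (by positivity),
          ← ENNReal.ofReal_mul (by positivity)]
        congr 2
        field_simp
    _ ≤ ENNReal.ofReal ((Lam m E)⁻¹) * (ENNReal.ofReal (Real.sqrt (x.1 i)) * I) := by gcongr
    _ ≤ _ := by
        rw [ENNReal.ofReal_inv_of_pos hL]
        gcongr
        exact Finset.single_le_sum (f := fun i => ENNReal.ofReal (Real.sqrt (x.1 i)) *
          ∫⁻ u, F (Texch m E i u x) ∂unif01) (fun _ _ => bot_le) (Finset.mem_univ i)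

lemma pc_couple {m : ℕ} {E : ℝ} (hm : 1 ≤ m) (hE : 0 < E) (s q : ℝ → ℝ → ℝ)
    (hcov : ∀ r > 0, ∀ H : ℝ → ENNReal,
      ∫⁻ v in Ioo 0 r, H v ≤ ENNReal.ofReal (2 * r) * ∫⁻ u, H (q r u) ∂unif01)
    (hsq : ∀ r > 0, ∀ u ∈ Ioo (0:ℝ) 1, s r (q r u) = u) (hsm : ∀ r, Measurable (s r))
    (x x' : Delta m E) (i : Fin m) (ε ε0 : ℝ) (hε00 : 0 < ε0) (hε0 : ε0 ≤ ε) (hx : ε ≤ x.1 i)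
    (hx' : ε ≤ x'.1 i)
    (F G : Delta m E → ENNReal) (hF : Measurable F) (hG : Measurable G) (η : ℝ)
    (h : ∀ v ∈ Ioo 0 ε0, ENNReal.ofReal η ≤
      F (Texch m E i (s (x.1 i) v) x) + G (Texch m E i (s (x'.1 i) v) x')) :
    ENNReal.ofReal ((Lam m E)⁻¹ * Real.sqrt ε * (2 * E)⁻¹ * (ε0 * η)) ≤
      ∫⁻ z, F z ∂(ustep m E x) + ∫⁻ z, G z ∂(ustep m E x') := by
  have hε : 0 < ε := lt_of_lt_of_le hε00 hε0
  have hL := pc_Lam_pos hm hE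
  refine le_trans ?_ (add_le_add
    (pc_ring_lower hm hE s q hcov hsq x i ε ε0 hε0 hε hx F hF)
    (pc_ring_lower hm hE s q hcov hsq x' i ε ε0 hε0 hε hx' G hG))
  rw [← mul_add, ← lintegral_add_left (f := fun v => F (Texch m E i (s (x.1 i) v) x))
    (hF.comp ((pc_measurable_Texch_left m E i x).comp (hsm (x.1 i)))),
    ENNReal.ofReal_mul (by positivity)]
  gcongr
  calc ENNReal.ofReal (ε0 * η) = ∫⁻ v in Ioo 0 ε0, ENNReal.ofReal η := by
        rw [setLIntegral_const, Real.volume_Ioo, sub_zero, ENNReal.ofReal_mul hε00.le, mul_comm]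
    _ ≤ _ := setLIntegral_mono' measurableSet_Ioo h

lemma pc_T_self {m : ℕ} {E : ℝ} (x : Delta m E) (i : Fin m) {u : ℝ} (hu : u ∈ Ioo (0:ℝ) 1) :
    (Texch m E i u x).1 i = tank m E x + (1 - u ^ 2) * x.1 i := by
  simp only [Texch, hu, dite_true, T0, Function.update_self, tank]

lemma pc_T_ne {m : ℕ} {E : ℝ} (x : Delta m E) (i j : Fin m) (hj : j ≠ i) (u : ℝ) :
    (Texch m E i u x).1 j = x.1 j := by
  unfold Texch
  split_ifs
  · simp only [T0, Function.update_of_ne hj]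
  · rfl

lemma pc_T_tank {m : ℕ} {E : ℝ} (x : Delta m E) (i : Fin m) {u : ℝ} (hu : u ∈ Ioo (0:ℝ) 1) :
    tank m E (Texch m E i u x) = u ^ 2 * x.1 i := by
  have h1 : ∑ j, (Texch m E i u x).1 j = (Texch m E i u x).1 i + ∑ j ∈ Finset.univ.erase i, x.1 j := by
    rw [← Finset.add_sum_erase _ _ (Finset.mem_univ i)]
    congr 1
    exact Finset.sum_congr rfl fun j hj => pc_T_ne x i j (Finset.ne_of_mem_erase hj) u
  have h2 := Finset.add_sum_erase Finset.univ x.1 (Finset.mem_univ i)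
  unfold tank
  rw [h1, pc_T_self x i hu]
  unfold tank
  rw [← h2]; ring

lemma pc_tank_pos {m : ℕ} {E : ℝ} (x : Delta m E) : 0 < tank m E x := sub_pos.2 x.2.2

/-- relation used for coupling the coordinates one after the other -/
def pcRel {m : ℕ} {E : ℝ} (i0 : Fin m) (S : Finset (Fin m)) (ε : ℝ) (x x' : Delta m E) : Prop :=
  ε ≤ x.1 i0 ∧ ε ≤ x'.1 i0 ∧ (∀ j ∈ S, ε ≤ x.1 j ∧ ε ≤ x'.1 j) ∧
    ∀ j, j ∉ S → j ≠ i0 → x.1 j = x'.1 j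

lemma pc_couple1 {m : ℕ} {E : ℝ} (hm : 1 ≤ m) (hE : 0 < E) (i0 : Fin m) (S : Finset (Fin m))
    (hS : i0 ∉ S) (ε : ℝ) (hε : 0 < ε) (x x' : Delta m E) (h : pcRel i0 S ε x x')
    (F G : Delta m E → ENNReal) (hF : Measurable F) (hG : Measurable G) (η : ℝ)
    (hFG : ∀ z z' : Delta m E, pcRel i0 S (ε/2) z z' → tank m E z = tank m E z' →
      ENNReal.ofReal η ≤ F z + G z') :
    ENNReal.ofReal ((Lam m E)⁻¹ * Real.sqrt ε * (2 * E)⁻¹ * (ε / 2 * η)) ≤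
      ∫⁻ z, F z ∂(ustep m E x) + ∫⁻ z, G z ∂(ustep m E x') := by
  obtain ⟨h1, h2, h3, h4⟩ := h
  refine pc_couple hm hE (fun r v => Real.sqrt (v / r)) (fun r u => u ^ 2 * r) pc_cov1 ?_ ?_ x x' i0
    ε (ε/2) (by linarith) (by linarith) h1 h2 F G hF hG η ?_
  · intro r hr u hu
    rw [mul_div_cancel_right₀ _ hr.ne', Real.sqrt_sq hu.1.le]
  · intro r; fun_prop
  · intro v hv
    have key : ∀ w : Delta m E, ε ≤ w.1 i0 → Real.sqrt (v / w.1 i0) ∈ Ioo (0:ℝ) 1 ∧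
        Real.sqrt (v / w.1 i0) ^ 2 * w.1 i0 = v := by
      intro w hw
      have hw0 := w.2.1 i0
      have hp : 0 < v / w.1 i0 := div_pos hv.1 hw0
      refine ⟨⟨Real.sqrt_pos.2 hp, ?_⟩, ?_⟩
      · rw [Real.sqrt_lt' one_pos, one_pow, div_lt_one hw0]; linarith [hv.2]
      · rw [Real.sq_sqrt hp.le]; field_simp
    have key2 : ∀ w : Delta m E, ε ≤ w.1 i0 →
        ε / 2 ≤ (Texch m E i0 (Real.sqrt (v / w.1 i0)) w).1 i0 := by
      intro w hw
      rw [pc_T_self w i0 (key w hw).1]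
      have := (key w hw).2
      have := pc_tank_pos w
      nlinarith [hv.2]
    refine hFG _ _ ⟨key2 x h1, key2 x' h2, ?_, ?_⟩ ?_
    · intro j hj
      have hji : j ≠ i0 := fun h => hS (h ▸ hj)
      rw [pc_T_ne _ _ _ hji, pc_T_ne _ _ _ hji]
      have := h3 j hj
      constructor <;> linarith
    · intro j hj hji
      rw [pc_T_ne _ _ _ hji, pc_T_ne _ _ _ hji]
      exact h4 j hj hji
    · rw [pc_T_tank _ _ (key x h1).1, pc_T_tank _ _ (key x' h2).1, (key x h1).2, (key x' h2).2]

lemma pc_couple2 {m : ℕ} {E : ℝ} (hm : 1 ≤ m) (hE : 0 < E) (i0 : Fin m) (S : Finset (Fin m))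
    (j : Fin m) (hj : j ∉ S) (hj0 : j ≠ i0) (ε : ℝ) (hε : 0 < ε) (x x' : Delta m E)
    (h : pcRel i0 (insert j S) ε x x') (ht : tank m E x = tank m E x')
    (F G : Delta m E → ENNReal) (hF : Measurable F) (hG : Measurable G) (η : ℝ)
    (hFG : ∀ z z' : Delta m E, pcRel i0 S ε z z' → ENNReal.ofReal η ≤ F z + G z') :
    ENNReal.ofReal ((Lam m E)⁻¹ * Real.sqrt ε * (2 * E)⁻¹ * (ε * η)) ≤
      ∫⁻ z, F z ∂(ustep m E x) + ∫⁻ z, G z ∂(ustep m E x') := by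
  obtain ⟨h1, h2, h3, h4⟩ := h
  have hx := h3 j (Finset.mem_insert_self _ _)
  refine pc_couple hm hE (fun r v => Real.sqrt (1 - v / r)) (fun r u => (1 - u ^ 2) * r) pc_cov2
    ?_ ?_ x x' j ε ε hε le_rfl hx.1 hx.2 F G hF hG η ?_
  · intro r hr u hu
    rw [mul_div_cancel_right₀ _ hr.ne', sub_sub_cancel, Real.sqrt_sq hu.1.le]
  · intro r; fun_prop
  · intro v hv
    have key : ∀ w : Delta m E, ε ≤ w.1 j → Real.sqrt (1 - v / w.1 j) ∈ Ioo (0:ℝ) 1 ∧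
        (1 - Real.sqrt (1 - v / w.1 j) ^ 2) * w.1 j = v := by
      intro w hw
      have hw0 := w.2.1 j
      have hp : 0 < v / w.1 j := div_pos hv.1 hw0
      have hp1 : v / w.1 j < 1 := by rw [div_lt_one hw0]; linarith [hv.2]
      refine ⟨⟨Real.sqrt_pos.2 (by linarith), ?_⟩, ?_⟩
      · rw [Real.sqrt_lt' one_pos]; linarith
      · rw [Real.sq_sqrt (by linarith)]; field_simp; ring
    refine hFG _ _ ⟨?_, ?_, ?_, ?_⟩
    · rw [pc_T_ne _ _ _ hj0.symm]; exact h1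
    · rw [pc_T_ne _ _ _ hj0.symm]; exact h2
    · intro k hk
      have hkj : k ≠ j := fun h => hj (h ▸ hk)
      rw [pc_T_ne _ _ _ hkj, pc_T_ne _ _ _ hkj]
      exact h3 k (Finset.mem_insert_of_mem hk)
    · intro k hk hk0
      by_cases hkj : k = j
      · subst hkj
        rw [pc_T_self _ _ (key x hx.1).1, pc_T_self _ _ (key x' hx.2).1, (key x hx.1).2,
          (key x' hx.2).2, ht]
      · rw [pc_T_ne _ _ _ hkj, pc_T_ne _ _ _ hkj]
        exact h4 k (by simp [hkj, hk]) hk0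

lemma pc_claim {m : ℕ} {E : ℝ} (hm : 1 ≤ m) (hE : 0 < E) (i0 : Fin m) (S : Finset (Fin m)) :
    i0 ∉ S → ∃ N : ℕ, 1 ≤ N ∧ ∀ ε > 0, ∃ η > 0, ∀ x x' : Delta m E, pcRel i0 S ε x x' →
      ∀ F G : Delta m E → ENNReal, Measurable F → Measurable G → (∀ z, 1 ≤ F z + G z) →
      ENNReal.ofReal η ≤ ∫⁻ z, F z ∂(ustepIter m E N x) + ∫⁻ z, G z ∂(ustepIter m E N x') := by
  have hL := pc_Lam_pos hm hE
  induction S using Finset.induction_on with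
  | empty =>
    intro _
    refine ⟨1, le_rfl, fun ε hε => ⟨(Lam m E)⁻¹ * Real.sqrt ε * (2 * E)⁻¹ * (ε / 2 * 1),
      by positivity, fun x x' h F G hF hG hFG => ?_⟩⟩
    have r1 := pc_lintegral_iter_succ m E 0 x F hF
    have r2 := pc_lintegral_iter_succ m E 0 x' G hG
    rw [zero_add] at r1 r2
    rw [r1, r2]
    refine pc_couple1 hm hE i0 ∅ (by simp) ε hε x x' h _ _ (pc_measurable_lint m E 0 F hF)
      (pc_measurable_lint m E 0 G hG) 1 fun z z' hz ht => ?_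
    have hzz : z = z' := by
      obtain ⟨_, _, _, h4⟩ := hz
      apply Subtype.ext
      have hne : ∀ j, j ≠ i0 → z.1 j = z'.1 j := fun j hj => h4 j (by simp) hj
      funext j
      by_cases hj : j = i0
      · subst hj
        unfold tank at ht
        rw [← Finset.add_sum_erase _ z.1 (Finset.mem_univ j),
          ← Finset.add_sum_erase _ z'.1 (Finset.mem_univ j),
          Finset.sum_congr rfl fun k hk => hne k (Finset.ne_of_mem_erase hk)] at ht
        linarith
      · exact hne j hj
    subst hzz
    change _ ≤ ∫⁻ w, F w ∂(Measure.dirac z) + ∫⁻ w, G w ∂(Measure.dirac z)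
    rw [lintegral_dirac' _ hF, lintegral_dirac' _ hG, ENNReal.ofReal_one]
    exact hFG z
  | insert j S hj ih =>
    intro hi0
    have hi0S : i0 ∉ S := fun h => hi0 (Finset.mem_insert_of_mem h)
    have hj0 : j ≠ i0 := fun h => hi0 (h ▸ Finset.mem_insert_self _ _)
    obtain ⟨N, hN, ih⟩ := ih hi0S
    refine ⟨N + 1 + 1, by omega, fun ε hε => ?_⟩
    obtain ⟨η, hη, ih⟩ := ih (ε / 2) (by linarith)
    refine ⟨(Lam m E)⁻¹ * Real.sqrt ε * (2 * E)⁻¹ * (ε / 2 *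
      ((Lam m E)⁻¹ * Real.sqrt (ε / 2) * (2 * E)⁻¹ * (ε / 2 * η))), by positivity,
      fun x x' h F G hF hG hFG => ?_⟩
    · rw [pc_lintegral_iter_succ m E _ x F hF, pc_lintegral_iter_succ m E _ x' G hG]
      refine pc_couple1 hm hE i0 (insert j S) hi0 ε hε x x' h _ _ (pc_measurable_lint m E _ F hF)
        (pc_measurable_lint m E _ G hG) _ fun z z' hz ht => ?_
      rw [pc_lintegral_iter_succ m E _ z F hF, pc_lintegral_iter_succ m E _ z' G hG]
      exact pc_couple2 hm hE i0 S j hj hj0 (ε/2) (by linarith) z z' hz ht _ _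
        (pc_measurable_lint m E _ F hF) (pc_measurable_lint m E _ G hG) η
        fun w w' hw => ih w w' hw F G hF hG hFG

lemma pc_overlap {m : ℕ} {E : ℝ} (hm : 1 ≤ m) (hE : 0 < E) : 
    ∃ N : ℕ, 1 ≤ N ∧ ∀ ε > 0, ∃ η > 0, ∀ x x' : Delta m E, (∀ j, ε ≤ x.1 j) → (∀ j, ε ≤ x'.1 j) →
      ∀ f : Delta m E → ℝ, Measurable f → (∀ z, f z ∈ Icc (0:ℝ) 1) →
      ∫ z, f z ∂(ustepIter m E N x) - ∫ z, f z ∂(ustepIter m E N x') ≤ 1 - η := by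
  set i0 : Fin m := ⟨0, hm⟩
  obtain ⟨N, hN, h⟩ := pc_claim hm hE i0 (Finset.univ.erase i0) (by simp)
  refine ⟨N, hN, fun ε hε => ?_⟩
  obtain ⟨η, hη, h⟩ := h ε hε
  refine ⟨η, hη, fun x x' hx hx' f hf hf1 => ?_⟩
  have h := h x x' ⟨hx _, hx' _, fun j _ => ⟨hx j, hx' j⟩, fun j hj hj0 => by simp [hj0] at hj⟩
    (fun z => ENNReal.ofReal (1 - f z)) (fun z => ENNReal.ofReal (f z)) (by fun_prop) (by fun_prop)
    (fun z => by
      rw [← ENNReal.ofReal_add (by linarith [(hf1 z).2]) (hf1 z).1]; simp)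
  have p1 := pc_prob_iter hm hE N x
  have p2 := pc_prob_iter hm hE N x'
  have hi : ∀ μ : Measure (Delta m E), IsProbabilityMeasure μ → Integrable f μ := fun μ _ =>
    Integrable.of_bound hf.aestronglyMeasurable 1 (ae_of_all _ fun z => by
      rw [Real.norm_eq_abs, abs_of_nonneg (hf1 z).1]; exact (hf1 z).2)
  have n1 : ∀ z, 0 ≤ 1 - f z := fun z => by linarith [(hf1 z).2]
  rw [← ofReal_integral_eq_lintegral_ofReal (f := fun z => 1 - f z) ((integrable_const _).sub (hi _ p1)) (ae_of_all _ n1),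
    ← ofReal_integral_eq_lintegral_ofReal (hi _ p2) (ae_of_all _ fun z => (hf1 z).1),
    ← ENNReal.ofReal_add (integral_nonneg n1) (integral_nonneg fun z => (hf1 z).1),
    ENNReal.ofReal_le_ofReal_iff (add_nonneg (integral_nonneg n1)
      (integral_nonneg fun z => (hf1 z).1)), integral_sub (integrable_const _) (hi _ p1)] at h
  simp at h
  linarith

/-- the Lyapunov function -/
noncomputable def pcV (m : ℕ) (E a B : ℝ) (x : Delta m E) : ℝ :=
  1 + ∑ k, (x.1 k) ^ (-a) + B * (tank m E x) ^ (-(a / 2))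

lemma pc_measurable_V (m : ℕ) (E a B : ℝ) : Measurable (pcV m E a B) := by
  unfold pcV
  refine (measurable_const.add (Finset.measurable_sum _ fun i _ => ?_)).add
    (measurable_const.mul ?_)
  · exact (pc_mc m E i).pow_const _
  · exact (pc_measurable_tank m E).pow_const _

lemma pc_V_one {m : ℕ} {E a B : ℝ} (hB : 0 ≤ B) (x : Delta m E) : 1 ≤ pcV m E a B x := by
  unfold pcV
  have h1 : 0 ≤ ∑ k, (x.1 k) ^ (-a) := Finset.sum_nonneg fun k _ => Real.rpow_nonneg (x.2.1 k).le _
  have h2 : 0 ≤ (tank m E x) ^ (-(a / 2)) := Real.rpow_nonneg (pc_tank_pos x).le _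
  have := mul_nonneg hB h2
  linarith

lemma pc_int1 (a : ℝ) (ha : a < 1) :
    ∫⁻ u, ENNReal.ofReal (u ^ (-a)) ∂unif01 = ENNReal.ofReal (1 / (1 - a)) := by
  have hi : IntervalIntegrable (fun u : ℝ => u ^ (-a)) volume 0 1 :=
    intervalIntegral.intervalIntegrable_rpow' (by linarith)
  have hi2 : IntegrableOn (fun u : ℝ => u ^ (-a)) (Ioo 0 1) :=
    ((intervalIntegrable_iff_integrableOn_Ioo_of_le zero_le_one).1 hi)
  have hpos : 0 ≤ᵐ[unif01] fun u : ℝ => u ^ (-a) :=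
    (ae_restrict_iff' measurableSet_Ioo).2 (ae_of_all _ fun u hu => Real.rpow_nonneg hu.1.le _)
  unfold unif01 at hpos ⊢
  rw [← ofReal_integral_eq_lintegral_ofReal hi2 hpos]
  congr 1
  have h := integral_rpow (a := 0) (b := 1) (r := -a) (Or.inl (by linarith))
  rw [intervalIntegral.integral_of_le zero_le_one, integral_Ioc_eq_integral_Ioo] at h
  rw [h, Real.one_rpow, Real.zero_rpow (by linarith)]
  ring

lemma pc_int2 :
    ∫⁻ u, ENNReal.ofReal ((1 - u) ^ (-(1/2) : ℝ)) ∂unif01 = ENNReal.ofReal 2 := by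
  have h := pc_int1 (1/2) (by norm_num)
  have h2 : ENNReal.ofReal (1 / (1 - 1/2)) = ENNReal.ofReal 2 := by norm_num
  rw [h2] at h
  rw [← h]
  unfold unif01
  rw [← lintegral_indicator measurableSet_Ioo, ← lintegral_indicator measurableSet_Ioo,
    ← lintegral_sub_left_eq_self _ (1:ℝ)]
  congr 1
  funext u
  simp only [indicator, mem_Ioo, sub_pos, sub_lt_self_iff]
  by_cases h1 : 0 < u ∧ u < 1
  · rw [if_pos h1, if_pos ⟨h1.2, h1.1⟩]; congr 2; ring
  · rw [if_neg h1, if_neg (fun h => h1 ⟨h.2, h.1⟩)]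

lemma pc_pt1 (a x y u : ℝ) (ha : 1/2 ≤ a) (hx : 0 < x) (hy : 0 < y) (hu : u ∈ Ioo (0:ℝ) 1) :
    (y + (1 - u ^ 2) * x) ^ (-a) ≤
      y ^ (-(a - 1/2)) * x ^ (-(1/2) : ℝ) * (1 - u) ^ (-(1/2) : ℝ) := by
  have h1u : 0 < 1 - u := by linarith [hu.2]
  have hw1 : y ≤ y + (1 - u ^ 2) * x := by
    have : 0 ≤ (1 - u ^ 2) * x := mul_nonneg (by nlinarith [hu.1, hu.2]) hx.le
    linarith
  have hw2 : x * (1 - u) ≤ y + (1 - u ^ 2) * x := by nlinarith [hu.1, hu.2, mul_pos hx (mul_pos hu.1 h1u)]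
  have e : (y + (1 - u ^ 2) * x) ^ (-a) =
      (y + (1 - u ^ 2) * x) ^ (-(a - 1/2)) * (y + (1 - u ^ 2) * x) ^ (-(1/2) : ℝ) := by
    rw [← Real.rpow_add (by linarith)]; congr 1; ring
  rw [e, mul_assoc, ← Real.mul_rpow hx.le h1u.le]
  have hp : 0 < x * (1 - u) := by positivity
  apply mul_le_mul
  · exact Real.rpow_le_rpow_of_nonpos hy hw1 (by linarith)
  · exact Real.rpow_le_rpow_of_nonpos hp hw2 (by norm_num)
  · exact Real.rpow_nonneg (by linarith) _
  · positivity

lemma pc_pt2 (a x u : ℝ) (hx : 0 < x) (hu : 0 < u) :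
    (u ^ 2 * x) ^ (-(a / 2)) = x ^ (-(a / 2)) * u ^ (-a) := by
  rw [Real.mul_rpow (by positivity) hx.le, ← Real.rpow_natCast u 2, ← Real.rpow_mul hu.le, mul_comm]
  congr 2
  push_cast; ring

lemma pc_V_T {m : ℕ} {E a B : ℝ} (x : Delta m E) (i : Fin m) {u : ℝ} (hu : u ∈ Ioo (0:ℝ) 1) :
    pcV m E a B (Texch m E i u x) = pcV m E a B x - (x.1 i) ^ (-a) - B * (tank m E x) ^ (-(a / 2))
      + (tank m E x + (1 - u ^ 2) * x.1 i) ^ (-a) + B * (u ^ 2 * x.1 i) ^ (-(a / 2)) := by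
  unfold pcV
  rw [pc_T_tank x i hu, ← Finset.add_sum_erase _ _ (Finset.mem_univ i),
    ← Finset.add_sum_erase _ (fun k => (x.1 k) ^ (-a)) (Finset.mem_univ i), pc_T_self x i hu,
    Finset.sum_congr rfl fun j hj => by rw [pc_T_ne x i j (Finset.ne_of_mem_erase hj) u]]
  ring

lemma pc_V_sub {m : ℕ} {E a B : ℝ} (x : Delta m E) (i : Fin m) :
    0 ≤ pcV m E a B x - (x.1 i) ^ (-a) - B * (tank m E x) ^ (-(a / 2)) := by
  unfold pcV
  have h1 : (x.1 i) ^ (-a) ≤ ∑ k, (x.1 k) ^ (-a) :=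
    Finset.single_le_sum (f := fun k => (x.1 k) ^ (-a))
      (fun k _ => Real.rpow_nonneg (x.2.1 k).le _) (Finset.mem_univ i)
  linarith

lemma pc_ring_V {m : ℕ} {E a B : ℝ} (ha : 1/2 ≤ a) (ha1 : a < 1) (hB : 0 ≤ B) (x : Delta m E)
    (i : Fin m) :
    ∫⁻ u, ENNReal.ofReal (pcV m E a B (Texch m E i u x)) ∂unif01 ≤
      ENNReal.ofReal (pcV m E a B x - (x.1 i) ^ (-a) - B * (tank m E x) ^ (-(a / 2))
        + 2 * ((tank m E x) ^ (-(a - 1/2)) * (x.1 i) ^ (-(1/2) : ℝ))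
        + B * (x.1 i) ^ (-(a / 2)) * (1 / (1 - a))) := by
  have hx := x.2.1 i
  have hy := pc_tank_pos x
  have hD := pc_V_sub (a := a) (B := B) x i
  set D := pcV m E a B x - (x.1 i) ^ (-a) - B * (tank m E x) ^ (-(a / 2)) with hDd
  set c1 := (tank m E x) ^ (-(a - 1/2)) * (x.1 i) ^ (-(1/2) : ℝ) with hc1
  set c2 := B * (x.1 i) ^ (-(a / 2)) with hc2
  have hc10 : 0 ≤ c1 := by positivity
  have hc20 : 0 ≤ c2 := by positivity
  calc ∫⁻ u, ENNReal.ofReal (pcV m E a B (Texch m E i u x)) ∂unif01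
      ≤ ∫⁻ u, (ENNReal.ofReal D + ENNReal.ofReal c1 * ENNReal.ofReal ((1 - u) ^ (-(1/2) : ℝ)) +
          ENNReal.ofReal c2 * ENNReal.ofReal (u ^ (-a))) ∂unif01 := by
        refine setLIntegral_mono' measurableSet_Ioo fun u hu => ?_
        have h1u : 0 < 1 - u := by linarith [hu.2]
        have hu0 := hu.1
        rw [← ENNReal.ofReal_mul hc10, ← ENNReal.ofReal_mul hc20,
          ← ENNReal.ofReal_add hD (by positivity), ← ENNReal.ofReal_add (by positivity) (by positivity)]
        apply ENNReal.ofReal_le_ofReal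
        rw [pc_V_T x i hu, pc_pt2 a _ u hx hu0, ← hDd]
        have := pc_pt1 a (x.1 i) (tank m E x) u ha hx hy hu
        rw [← hc1] at this
        have e : B * ((x.1 i) ^ (-(a / 2)) * u ^ (-a)) = c2 * u ^ (-a) := by rw [hc2]; ring
        rw [e]
        linarith
    _ = ENNReal.ofReal D + ENNReal.ofReal c1 * ENNReal.ofReal 2 +
          ENNReal.ofReal c2 * ENNReal.ofReal (1 / (1 - a)) := by
        rw [lintegral_add_right _ (by fun_prop), lintegral_add_right _ (by fun_prop),
          lintegral_const_mul _ (by fun_prop), lintegral_const_mul _ (by fun_prop), pc_int2,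
          pc_int1 a ha1, lintegral_const, measure_univ, mul_one]
    _ = _ := by
        have h1a : 0 < 1 - a := by linarith
        rw [← ENNReal.ofReal_mul hc10, ← ENNReal.ofReal_mul hc20,
          ← ENNReal.ofReal_add hD (by positivity), ← ENNReal.ofReal_add (by positivity) (by positivity)]
        congr 1; ring

lemma pc_sqrt_le_rate {m : ℕ} {E : ℝ} (x : Delta m E) :
    Real.sqrt (∑ i, x.1 i) ≤ jumpRate m E x := by
  have hr : 0 ≤ jumpRate m E x := Finset.sum_nonneg fun i _ => Real.sqrt_nonneg _
  rw [Real.sqrt_le_left hr, sq]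
  calc ∑ i, x.1 i = ∑ i, Real.sqrt (x.1 i) * Real.sqrt (x.1 i) :=
        Finset.sum_congr rfl fun i _ => (Real.mul_self_sqrt (x.2.1 i).le).symm
    _ ≤ ∑ i, jumpRate m E x * Real.sqrt (x.1 i) := by
        gcongr with i
        exact Finset.single_le_sum (f := fun i => Real.sqrt (x.1 i))
          (fun i _ => Real.sqrt_nonneg _) (Finset.mem_univ i)
    _ = _ := by rw [← Finset.mul_sum]; rfl

lemma pc_V_alpha {m : ℕ} {E a B : ℝ} (ha : 1/2 < a) (hB : 1 ≤ B) (x : Delta m E) :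
    pcV m E a B x ^ (1 - 1 / (2 * a)) ≤
      (1 + B) * (1 + ∑ i, (x.1 i) ^ (1/2 - a) + (tank m E x) ^ (-(a / 2))) := by
  set α := 1 - 1 / (2 * a) with hα
  have h1 : 1 / (2 * a) < 1 := by rw [div_lt_one (by linarith)]; linarith
  have h2 : 0 < 1 / (2 * a) := by positivity
  have hα0 : 0 < α := by rw [hα]; linarith
  have hα1 : α ≤ 1 := by rw [hα]; linarith
  have hy := pc_tank_pos x
  have hsum : ∀ s : Finset (Fin m), (∑ k ∈ s, (x.1 k) ^ (-a)) ^ α ≤ ∑ k ∈ s, (x.1 k) ^ (1/2 - a) := by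
    intro s
    induction s using Finset.induction_on with
    | empty => simp [Real.zero_rpow hα0.ne']
    | insert j s hj ih =>
      rw [Finset.sum_insert hj, Finset.sum_insert hj]
      have hxj := x.2.1 j
      refine (Real.rpow_add_le_add_rpow (Real.rpow_nonneg hxj.le _)
        (Finset.sum_nonneg fun k _ => Real.rpow_nonneg (x.2.1 k).le _) hα0.le hα1).trans ?_
      have e : ((x.1 j) ^ (-a)) ^ α = (x.1 j) ^ (1/2 - a) := by
        rw [← Real.rpow_mul hxj.le]; congr 1; rw [hα]; field_simp; ring
      rw [e]
      linarith
  have hX : 0 ≤ ∑ k, (x.1 k) ^ (-a) := Finset.sum_nonneg fun k _ => Real.rpow_nonneg (x.2.1 k).le _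
  have hX2 : 0 ≤ ∑ k, (x.1 k) ^ (1/2 - a) :=
    Finset.sum_nonneg fun k _ => Real.rpow_nonneg (x.2.1 k).le _
  have hY : 0 < (tank m E x) ^ (-(a / 2)) := by positivity
  set Y := (tank m E x) ^ (-(a / 2)) with hYd
  have hle : ∀ t : ℝ, 0 ≤ t → t ^ α ≤ 1 + t := by
    intro t ht
    by_cases h : t ≤ 1
    · have := Real.rpow_le_one ht h hα0.le
      linarith
    · push Not at h
      have := Real.rpow_le_rpow_of_exponent_le h.le hα1
      rw [Real.rpow_one] at this
      linarith
  have hBY : (B * Y) ^ α ≤ B * (1 + Y) := by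
    rw [Real.mul_rpow (by linarith) hY.le]
    apply mul_le_mul _ (hle Y hY.le) (by positivity) (by linarith)
    have := Real.rpow_le_rpow_of_exponent_le hB hα1
    rwa [Real.rpow_one] at this
  have s1 : pcV m E a B x ^ α ≤ (1 + ∑ k, (x.1 k) ^ (-a)) ^ α + (B * Y) ^ α :=
    Real.rpow_add_le_add_rpow (by linarith) (by positivity) hα0.le hα1
  have s2 : (1 + ∑ k, (x.1 k) ^ (-a)) ^ α ≤ 1 ^ α + (∑ k, (x.1 k) ^ (-a)) ^ α :=
    Real.rpow_add_le_add_rpow (by linarith) hX hα0.le hα1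
  rw [Real.one_rpow] at s2
  have s3 := hsum Finset.univ
  nlinarith

lemma pc_drift {m : ℕ} {E a : ℝ} (hm : 1 ≤ m) (hE : 0 < E) (ha : 1/2 < a) (ha1 : a < 1) :
    ∃ B c b : ℝ, 1 ≤ B ∧ 0 < c ∧ c ≤ 1 ∧ 0 ≤ b ∧ ∀ x : Delta m E,
      ∫⁻ z, ENNReal.ofReal (pcV m E a B z) ∂(ustep m E x) ≤
        ENNReal.ofReal (pcV m E a B x - c * pcV m E a B x ^ (1 - 1 / (2 * a)) + b) := by
  have hL := pc_Lam_pos hm hE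
  have h1a : 0 < 1 - a := by linarith
  set E1 := E ^ ((1 - a) / 2) with hE1
  set s := Real.sqrt (E / 2) with hs
  have hs0 : 0 < s := by positivity
  have hE10 : 0 < E1 := by positivity
  set B := max 1 ((1 + 2 * m * E1) / s) with hB
  have hB1 : 1 ≤ B := le_max_left _ _
  have hBs : 1 + 2 * m * E1 ≤ B * s := by
    have : (1 + 2 * m * E1) / s ≤ B := le_max_right _ _
    rwa [div_le_iff₀ hs0] at this
  set Y0 := (E / 2) ^ (-(a / 2)) with hY0
  set b' := B * s * Y0 + m * (B * E1 / (1 - a)) with hb'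
  have hb'0 : 0 ≤ b' := by positivity
  refine ⟨B, min 1 ((Lam m E)⁻¹ / (1 + B)), (Lam m E)⁻¹ * (b' + 1), hB1, by positivity,
    min_le_left _ _, by positivity, fun x => ?_⟩
  have hV1 := pc_V_one (a := a) (by linarith : 0 ≤ B) x
  have hVα := pc_V_alpha ha hB1 x
  have hy := pc_tank_pos x
  set V := pcV m E a B x with hV
  set y := tank m E x with hyd
  set Y := y ^ (-(a / 2)) with hY
  have hYpos : 0 < Y := by positivity
  set r := jumpRate m E x with hr
  have hr0 : 0 ≤ r := Finset.sum_nonneg fun i _ => Real.sqrt_nonneg _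
  have hrL : r / Lam m E ≤ 1 := by rw [div_le_one hL]; exact pc_rate_le x
  set X := ∑ i, (x.1 i) ^ (1/2 - a) with hX
  have hyE : y ≤ E := by
    have : 0 ≤ ∑ i, x.1 i := Finset.sum_nonneg fun i _ => (x.2.1 i).le
    rw [hyd]; unfold tank; linarith
  have hring := fun i => pc_ring_V ha.le ha1 (by linarith : 0 ≤ B) x i
  have hD := fun i => pc_V_sub (a := a) (B := B) x i
  set e : Fin m → ℝ := fun i => V - (x.1 i) ^ (-a) - B * Y
    + 2 * (y ^ (-(a - 1/2)) * (x.1 i) ^ (-(1/2) : ℝ)) + B * (x.1 i) ^ (-(a / 2)) * (1 / (1 - a)) with he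
  have he0 : ∀ i, 0 ≤ e i := fun i => by
    have hx := x.2.1 i
    have := hD i
    simp only [he]
    have : 0 ≤ 2 * (y ^ (-(a - 1/2)) * (x.1 i) ^ (-(1/2) : ℝ)) := by positivity
    have : 0 ≤ B * (x.1 i) ^ (-(a / 2)) * (1 / (1 - a)) := by positivity
    linarith
  have hup : ∫⁻ z, ENNReal.ofReal (pcV m E a B z) ∂(ustep m E x) ≤
      ENNReal.ofReal ((1 - r / Lam m E) * V + (Lam m E)⁻¹ * ∑ i, Real.sqrt (x.1 i) * e i) := by
    rw [pc_lintegral_ustep m E x _ (pc_measurable_V m E a B).ennreal_ofReal]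
    have hnn : 0 ≤ ∑ i, Real.sqrt (x.1 i) * e i :=
      Finset.sum_nonneg fun i _ => mul_nonneg (Real.sqrt_nonneg _) (he0 i)
    rw [ENNReal.ofReal_add (mul_nonneg (by linarith) (by linarith)) (by positivity),
      ENNReal.ofReal_mul (by linarith), ENNReal.ofReal_mul (by positivity),
      ENNReal.ofReal_inv_of_pos hL,
      ENNReal.ofReal_sum_of_nonneg fun i _ => mul_nonneg (Real.sqrt_nonneg _) (he0 i)]
    gcongr with i
    rw [ENNReal.ofReal_mul (Real.sqrt_nonneg _)]
    gcongr
    exact hring i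
  refine hup.trans (ENNReal.ofReal_le_ofReal ?_)
  have hei : ∀ i, Real.sqrt (x.1 i) * e i ≤ Real.sqrt (x.1 i) * V - (x.1 i) ^ (1/2 - a)
      - B * Y * Real.sqrt (x.1 i) + 2 * E1 * Y + B * E1 / (1 - a) := by
    intro i
    have hx := x.2.1 i
    have q1 : Real.sqrt (x.1 i) * (x.1 i) ^ (-a) = (x.1 i) ^ (1/2 - a) := by
      rw [Real.sqrt_eq_rpow, ← Real.rpow_add hx]; congr 1
    have q2 : Real.sqrt (x.1 i) * (x.1 i) ^ (-(1/2) : ℝ) = 1 := by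
      rw [Real.sqrt_eq_rpow, ← Real.rpow_add hx]; norm_num
    have q3 : Real.sqrt (x.1 i) * (x.1 i) ^ (-(a / 2)) ≤ E1 := by
      rw [Real.sqrt_eq_rpow, ← Real.rpow_add hx, hE1]
      rw [show (1:ℝ) / 2 + -(a / 2) = (1 - a) / 2 by ring]
      exact Real.rpow_le_rpow hx.le (pc_coord_lt x i).le (by linarith)
    have q4 : y ^ (-(a - 1/2)) ≤ E1 * Y := by
      rw [show -(a - 1/2) = (1 - a) / 2 + -(a / 2) by ring, Real.rpow_add hy]
      gcongr
      exact Real.rpow_le_rpow hy.le hyE (by linarith)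
    have q5 : B * (Real.sqrt (x.1 i) * (x.1 i) ^ (-(a / 2))) * (1 / (1 - a)) ≤
        B * E1 * (1 / (1 - a)) := by gcongr
    calc Real.sqrt (x.1 i) * e i = Real.sqrt (x.1 i) * V - Real.sqrt (x.1 i) * (x.1 i) ^ (-a)
          - B * Y * Real.sqrt (x.1 i)
          + 2 * y ^ (-(a - 1/2)) * (Real.sqrt (x.1 i) * (x.1 i) ^ (-(1/2) : ℝ))
          + B * (Real.sqrt (x.1 i) * (x.1 i) ^ (-(a / 2))) * (1 / (1 - a)) := by
            simp only [he]; ring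
      _ ≤ _ := by
            rw [q1, q2]
            have : B * E1 / (1 - a) = B * E1 * (1 / (1 - a)) := by ring
            rw [this]
            linarith
  have hsum : ∑ i, Real.sqrt (x.1 i) * e i ≤ r * V - X - B * Y * r
      + m * (2 * E1 * Y) + m * (B * E1 / (1 - a)) := by
    refine (Finset.sum_le_sum fun i _ => hei i).trans (le_of_eq ?_)
    rw [Finset.sum_add_distrib, Finset.sum_add_distrib, Finset.sum_sub_distrib,
      Finset.sum_sub_distrib, ← Finset.sum_mul, ← Finset.mul_sum]
    simp only [Finset.sum_const, Finset.card_univ, Fintype.card_fin, nsmul_eq_mul]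
    rfl
  have hBY : B * s * Y - B * s * Y0 ≤ B * Y * r := by
    by_cases hc : E / 2 ≤ y
    · have hYY : Y ≤ Y0 := Real.rpow_le_rpow_of_nonpos (by linarith) hc (by linarith)
      have h1 : 0 ≤ B * Y * r := by positivity
      have h2 : B * s * Y ≤ B * s * Y0 := by gcongr
      linarith
    · push Not at hc
      have hsr : s ≤ r := by
        refine le_trans ?_ (pc_sqrt_le_rate x)
        apply Real.sqrt_le_sqrt
        have : y = E - ∑ i, x.1 i := rfl
        linarith
      have h1 : B * Y * s ≤ B * Y * r := by gcongr
      have h2 : 0 ≤ B * s * Y0 := by positivity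
      linarith
  have hfin : ∑ i, Real.sqrt (x.1 i) * e i ≤ r * V - X - Y + b' := by
    have : (1 + 2 * m * E1) * Y ≤ B * s * Y := by gcongr
    rw [hb']
    linarith
  have hVV : V ^ (1 - 1 / (2 * a)) / (1 + B) ≤ 1 + X + Y := by
    rw [div_le_iff₀ (by linarith)]; linarith
  have hVnn : 0 ≤ V ^ (1 - 1 / (2 * a)) := by positivity
  have hcm : min 1 ((Lam m E)⁻¹ / (1 + B)) * V ^ (1 - 1 / (2 * a)) ≤
      (Lam m E)⁻¹ * (V ^ (1 - 1 / (2 * a)) / (1 + B)) := by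
    calc _ ≤ ((Lam m E)⁻¹ / (1 + B)) * V ^ (1 - 1 / (2 * a)) := by
          gcongr
          exact min_le_right _ _
      _ = _ := by ring
  calc (1 - r / Lam m E) * V + (Lam m E)⁻¹ * ∑ i, Real.sqrt (x.1 i) * e i
      ≤ (1 - r / Lam m E) * V + (Lam m E)⁻¹ * (r * V - X - Y + b') := by gcongr
    _ = V + (Lam m E)⁻¹ * (b' + 1) - (Lam m E)⁻¹ * (1 + X + Y) := by
        field_simp; ring
    _ ≤ V + (Lam m E)⁻¹ * (b' + 1) - (Lam m E)⁻¹ * (V ^ (1 - 1 / (2 * a)) / (1 + B)) := by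
        gcongr
    _ ≤ _ := by linarith

lemma pc_disc {m : ℕ} {E : ℝ} (hm : 1 ≤ m) (hE : 0 < E) {a : ℝ} (ha : 1/2 < a) (ha1 : a < 1) :
    ∃ B C : ℝ, 1 ≤ B ∧ 0 ≤ C ∧ ∀ A : Set (Delta m E), MeasurableSet A → ∀ (k : ℕ) x x',
      (ustepIter m E k x A).toReal - (ustepIter m E k x' A).toReal ≤
        C * ((k:ℝ)+1) ^ (-(2*a)) * (pcV m E a B x + pcV m E a B x') := by
  obtain ⟨B, c, b, hB, hc, hc1, hb, hd⟩ := pc_drift hm hE ha ha1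
  obtain ⟨N, hN, hov⟩ := pc_overlap hm hE
  set V := pcV m E a B with hVdef
  have hVm : Measurable V := pc_measurable_V m E a B
  have hWm : Measurable fun z => ENNReal.ofReal (V z) := hVm.ennreal_ofReal
  have hV1 : ∀ x, 1 ≤ V x := fun x => pc_V_one (by linarith) x
  have hal0 : 0 < 1 - 1 / (2*a) := by
    rw [sub_pos, div_lt_one (by linarith)]; linarith
  have hal1 : 1 - 1 / (2*a) < 1 := by
    have : 0 < 1 / (2*a) := by positivity
    linarith
  set α := 1 - 1 / (2*a) with hα
  have hVa : ∀ x, c * V x ^ α ≤ V x := by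
    intro x
    have h1 : V x ^ α ≤ V x ^ (1:ℝ) := Real.rpow_le_rpow_of_exponent_le (hV1 x) hal1.le
    rw [Real.rpow_one] at h1
    have h2 : 0 ≤ V x ^ α := Real.rpow_nonneg (by linarith [hV1 x]) _
    nlinarith
  have hVa0 : ∀ x, 0 ≤ c * V x ^ α := fun x =>
    mul_nonneg hc.le (Real.rpow_nonneg (by linarith [hV1 x]) _)
  have hL1 : ∀ x, ∫⁻ z, ENNReal.ofReal (V z) ∂ustep m E x ≤
      ENNReal.ofReal (V x) + ENNReal.ofReal b := by
    intro x
    refine (hd x).trans ?_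
    rw [← ENNReal.ofReal_add (by linarith [hV1 x]) hb]
    exact ENNReal.ofReal_le_ofReal (by linarith [hVa0 x])
  have hLn : ∀ (n : ℕ) x, ∫⁻ z, ENNReal.ofReal (V z) ∂ustepIter m E n x ≤
      ENNReal.ofReal (V x) + n * ENNReal.ofReal b := by
    intro n
    induction n with
    | zero =>
      intro x
      change ∫⁻ z, ENNReal.ofReal (V z) ∂(Measure.dirac x) ≤ _
      rw [lintegral_dirac' _ hWm]; simp
    | succ n ih =>
      intro x
      have := pc_prob_ustep hm hE x
      rw [pc_lintegral_iter_succ m E n x _ hWm]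
      calc _ ≤ ∫⁻ w, (ENNReal.ofReal (V w) + n * ENNReal.ofReal b) ∂ustep m E x :=
            lintegral_mono fun w => ih w
        _ = ∫⁻ w, ENNReal.ofReal (V w) ∂ustep m E x + n * ENNReal.ofReal b := by
            rw [lintegral_add_right _ measurable_const, lintegral_const, measure_univ, mul_one]
        _ ≤ ENNReal.ofReal (V x) + ENNReal.ofReal b + n * ENNReal.ofReal b := by
            gcongr; exact hL1 x
        _ = _ := by push_cast; ring
  have hLN : ∀ x, ∫⁻ z, ENNReal.ofReal (V z) ∂ustepIter m E N x ≤
      ENNReal.ofReal (V x - c * V x ^ α + N * b) := by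
    intro x
    obtain ⟨n, rfl⟩ : ∃ n, N = n + 1 := ⟨N - 1, by omega⟩
    have := pc_prob_ustep hm hE x
    rw [pc_lintegral_iter_succ m E n x _ hWm]
    calc _ ≤ ∫⁻ w, (ENNReal.ofReal (V w) + n * ENNReal.ofReal b) ∂ustep m E x :=
          lintegral_mono fun w => hLn n w
      _ = ∫⁻ w, ENNReal.ofReal (V w) ∂ustep m E x + n * ENNReal.ofReal b := by
          rw [lintegral_add_right _ measurable_const, lintegral_const, measure_univ, mul_one]
      _ ≤ ENNReal.ofReal (V x - c * V x ^ α + b) + n * ENNReal.ofReal b := by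
          gcongr; exact hd x
      _ = _ := by
          rw [← ENNReal.ofReal_natCast n, ← ENNReal.ofReal_mul (by positivity),
            ← ENNReal.ofReal_add (by linarith [hVa x]) (by positivity)]
          congr 1; push_cast; ring
  have hint : ∀ x, Integrable V (ustepIter m E N x) := by
    intro x
    rw [← lintegral_ofReal_ne_top_iff_integrable hVm.aestronglyMeasurable
      (ae_of_all _ fun z => by change (0:ℝ) ≤ V z; linarith [hV1 z])]
    exact ne_top_of_le_ne_top ENNReal.ofReal_ne_top (hLN x)
  have hdrift : ∀ x, ∫ z, V z ∂ustepIter m E N x ≤ V x - c * V x ^ α + N * b := by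
    intro x
    rw [integral_eq_lintegral_of_nonneg_ae
      (ae_of_all _ fun z => by change (0:ℝ) ≤ V z; linarith [hV1 z]) hVm.aestronglyMeasurable]
    refine ENNReal.toReal_le_of_le_ofReal ?_ (hLN x)
    have := hVa x
    have h3 : 0 ≤ (N:ℝ) * b := by positivity
    linarith
  have hov2 : ∀ R : ℝ, ∃ η > 0, ∀ x x', V x ≤ R → V x' ≤ R → ∀ f : Delta m E → ℝ, Measurable f →
      (∀ z, f z ∈ Icc (0:ℝ) 1) →
      ∫ z, f z ∂ustepIter m E N x - ∫ z, f z ∂ustepIter m E N x' ≤ 1 - η := by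
    intro R
    have hR : (0:ℝ) < max R 1 := by positivity
    obtain ⟨η, hη, h⟩ := hov ((max R 1) ^ (-(1/a))) (Real.rpow_pos_of_pos hR _)
    have key : ∀ x, V x ≤ R → ∀ j, (max R 1) ^ (-(1/a)) ≤ x.1 j := by
      intro x hx j
      have hxj := x.2.1 j
      have h1 : (x.1 j) ^ (-a) ≤ max R 1 := by
        refine le_trans ?_ (hx.trans (le_max_left _ _))
        have h2 : 0 ≤ B * (tank m E x) ^ (-(a / 2)) :=
          mul_nonneg (by linarith) (Real.rpow_nonneg (pc_tank_pos x).le _)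
        have h3 := Finset.single_le_sum (f := fun k => (x.1 k) ^ (-a))
          (fun k _ => Real.rpow_nonneg (x.2.1 k).le _) (Finset.mem_univ j)
        rw [hVdef]; unfold pcV
        linarith
      have h4 := Real.rpow_le_rpow_of_nonpos (Real.rpow_pos_of_pos hxj _) h1
        (z := -(1/a)) (by rw [neg_nonpos]; positivity)
      rw [← Real.rpow_mul hxj.le] at h4
      have e : -a * -(1/a) = 1 := by field_simp
      rwa [e, Real.rpow_one] at h4
    exact ⟨η, hη, fun x x' hx hx' f hf hf1 => h x x' (key x hx) (key x' hx') f hf hf1⟩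
  obtain ⟨C, hC, hcon⟩ := pc_contraction (ustepIter m E N) (pc_prob_iter hm hE N) V hV1 hint α c
    (N * b) hal0 hal1 hc (by positivity) hdrift hov2
  have hβ : 1 / (1 - α) = 2 * a := by rw [hα]; field_simp; ring
  rw [hβ] at hcon
  have hNp : (0:ℝ) < N := by exact_mod_cast hN
  refine ⟨B, C * (N:ℝ) ^ (2*a), hB, by positivity, fun A hA k x x' => ?_⟩
  have hmeas : ∀ n, Measurable fun x => ustepIter m E n x A := fun n =>
    (Measure.measurable_coe hA).comp (pc_measurable_iter m E n)
  have h := hcon (fun n x => (ustepIter m E (N * n + k % N) x A).toReal)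
    (fun n => (hmeas _).ennreal_toReal)
    (fun n x => ⟨ENNReal.toReal_nonneg, by
      have := pc_prob_iter hm hE (N * n + k % N) x
      exact ENNReal.toReal_le_of_le_ofReal zero_le_one (by simpa using prob_le_one)⟩)
    (fun n x => by
      have e := pc_lintegral_iter_add m E N (N * n + k % N) x (A.indicator 1)
        (measurable_one.indicator hA)
      simp only [lintegral_indicator_one hA] at e
      rw [show N * (n + 1) + k % N = N + (N * n + k % N) by ring, e]
      rw [integral_toReal (hmeas _).aemeasurable]
      refine ae_of_all _ fun z => ?_
      have := pc_prob_iter hm hE (N * n + k % N) z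
      exact measure_lt_top _ _)
    (k / N) x x'
  simp only [Nat.div_add_mod] at h
  refine h.trans ?_
  have hVV : 0 ≤ V x + V x' := by linarith [hV1 x, hV1 x']
  refine mul_le_mul_of_nonneg_right ?_ hVV
  rw [mul_assoc]
  refine mul_le_mul_of_nonneg_left ?_ hC
  have hk : (k:ℝ) + 1 ≤ N * (((k / N : ℕ) : ℝ) + 1) := by
    have h1 := Nat.div_add_mod k N
    have h2 := Nat.mod_lt k hN
    have : k + 1 ≤ N * (k / N + 1) := by rw [mul_add]; omega
    exact_mod_cast this
  have hk0 : (0:ℝ) < (k:ℝ) + 1 := by positivity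
  have := Real.rpow_le_rpow_of_nonpos hk0 hk (z := -(2*a)) (by linarith)
  rw [Real.mul_rpow (by positivity) (by positivity)] at this
  have h3 : (N:ℝ) ^ (2*a) * (N:ℝ) ^ (-(2*a)) = 1 := by
    rw [← Real.rpow_add hNp]; simp
  calc _ = (N:ℝ) ^ (2*a) * ((N:ℝ) ^ (-(2*a)) * (((k / N : ℕ) : ℝ) + 1) ^ (-(2*a))) := by
        rw [← mul_assoc, h3, one_mul]
    _ ≤ _ := by gcongr

lemma pc_pois_sum (l : ℝ) :
    HasSum (fun k : ℕ => Real.exp (-l) * l ^ k / k.factorial) 1 := by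
  have h := (NormedSpace.expSeries_div_hasSum_exp (𝔸 := ℝ) l).mul_left (Real.exp (-l))
  rw [← Real.exp_eq_exp_ℝ, ← Real.exp_add, neg_add_cancel, Real.exp_zero] at h
  simpa only [mul_div_assoc] using h

lemma pc_pois {l β : ℝ} (hl : 0 < l) (hβ : 0 ≤ β) (hβ2 : β ≤ 2) :
    Summable (fun k : ℕ => Real.exp (-l) * l ^ k / k.factorial * ((k:ℝ)+1) ^ (-β)) ∧
    ∑' k : ℕ, Real.exp (-l) * l ^ k / k.factorial * ((k:ℝ)+1) ^ (-β) ≤ 3 * l ^ (-β) := by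
  set p : ℕ → ℝ := fun k => Real.exp (-l) * l ^ k / k.factorial with hp
  have hps : HasSum p 1 := pc_pois_sum l
  have hp0 : ∀ k, 0 ≤ p k := fun k => by rw [hp]; positivity
  have hps2 : Summable fun k => p (k + 2) := (summable_nat_add_iff 2).2 hps.summable
  have hsum2 : ∑' k, p (k + 2) ≤ 1 := by
    have := hps.summable.sum_add_tsum_nat_add 2
    rw [hps.tsum_eq] at this
    have h2 : 0 ≤ ∑ i ∈ Finset.range 2, p i := Finset.sum_nonneg fun i _ => hp0 i
    linarith
  have hlb : 0 ≤ l ^ (-β) := Real.rpow_nonneg hl.le _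
  have key : ∀ k : ℕ, p k * ((k:ℝ)+1) ^ (-β) ≤ l ^ (-β) * p k + 2 * l ^ (-β) * p (k + 2) := by
    intro k
    have hk : (0:ℝ) < (k:ℝ) + 1 := by positivity
    rcases le_or_gt l ((k:ℝ)+1) with h | h
    · have h1 := Real.rpow_le_rpow_of_nonpos hl h (z := -β) (by linarith)
      have h2 := mul_le_mul_of_nonneg_left h1 (hp0 k)
      have h3 : 0 ≤ 2 * l ^ (-β) * p (k + 2) := by have := hp0 (k+2); positivity
      linarith
    · have h1 : ((k:ℝ)+1) ^ (2 - β) ≤ l ^ (2 - β) := Real.rpow_le_rpow hk.le h.le (by linarith)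
      rw [sub_eq_add_neg, Real.rpow_add hk, Real.rpow_add hl, Real.rpow_two, Real.rpow_two] at h1
      have h4 : p (k + 2) = p k * l ^ 2 / (((k:ℝ)+1) * ((k:ℝ)+2)) := by
        simp only [hp]
        rw [Nat.factorial_succ, Nat.factorial_succ]
        push_cast
        have : ((k.factorial : ℕ) : ℝ) ≠ 0 := by positivity
        field_simp
        ring
      have h5 : ((k:ℝ)+1) ^ (-β) ≤ 2 * l ^ (-β) * (l ^ 2 / (((k:ℝ)+1) * ((k:ℝ)+2))) := by
        rw [mul_div_assoc', le_div_iff₀ (by positivity)]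
        have h6 : (0:ℝ) ≤ ((k:ℝ)+1) ^ (-β) := Real.rpow_nonneg hk.le _
        calc _ ≤ ((k:ℝ)+1) ^ (-β) * (2 * ((k:ℝ)+1) ^ 2) := by
              refine mul_le_mul_of_nonneg_left ?_ h6
              nlinarith [(Nat.cast_nonneg k : (0:ℝ) ≤ k)]
          _ ≤ _ := by nlinarith
      have h6 := mul_le_mul_of_nonneg_left h5 (hp0 k)
      have h7 : 0 ≤ l ^ (-β) * p k := mul_nonneg hlb (hp0 k)
      have h8 : p k * (2 * l ^ (-β) * (l ^ 2 / (((k:ℝ)+1) * ((k:ℝ)+2)))) =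
          2 * l ^ (-β) * p (k + 2) := by rw [h4]; ring
      linarith
  have hs : Summable fun k => l ^ (-β) * p k + 2 * l ^ (-β) * p (k + 2) :=
    (hps.summable.mul_left _).add (hps2.mul_left _)
  have hs0 : Summable fun k : ℕ => p k * ((k:ℝ)+1) ^ (-β) :=
    Summable.of_nonneg_of_le (fun k => mul_nonneg (hp0 k) (Real.rpow_nonneg (by positivity) _)) key hs
  refine ⟨hs0, (hs0.tsum_le_tsum key hs).trans ?_⟩
  rw [(hps.summable.mul_left _).tsum_add (hps2.mul_left _), tsum_mul_left, tsum_mul_left,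
    hps.tsum_eq]
  nlinarith

lemma pc_Pt_apply {m : ℕ} {E : ℝ} (t : ℝ) (x : Delta m E) {A : Set (Delta m E)}
    (hA : MeasurableSet A) : Pt m E t x A = ∑' n : ℕ,
      ENNReal.ofReal (Real.exp (-(Lam m E) * t) * ((Lam m E) * t) ^ n / n.factorial) *
        ustepIter m E n x A := by
  unfold Pt
  rw [Measure.sum_apply _ hA]
  simp

lemma pc_measurable_Pt (m : ℕ) (E t : ℝ) : Measurable (Pt m E t) := by
  refine Measure.measurable_of_measurable_coe _ fun A hA => ?_
  simp only [pc_Pt_apply t _ hA]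
  exact Measurable.ennreal_tsum fun n =>
    ((Measure.measurable_coe hA).comp (pc_measurable_iter m E n)).const_mul _

lemma pc_Pt_hasSum {m : ℕ} {E : ℝ} (hm : 1 ≤ m) (hE : 0 < E) {t : ℝ} (ht : 0 ≤ t) (x : Delta m E)
    {A : Set (Delta m E)} (hA : MeasurableSet A) :
    HasSum (fun n : ℕ => Real.exp (-(Lam m E * t)) * ((Lam m E) * t) ^ n / n.factorial *
      (ustepIter m E n x A).toReal) (Pt m E t x A).toReal := by
  have hL := pc_Lam_pos hm hE
  have hp0 : ∀ n : ℕ, 0 ≤ Real.exp (-(Lam m E * t)) * ((Lam m E) * t) ^ n / n.factorial :=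
    fun n => by positivity
  have hle : ∀ n, (ustepIter m E n x A).toReal ≤ 1 := fun n => by
    have := pc_prob_iter hm hE n x
    exact ENNReal.toReal_le_of_le_ofReal zero_le_one (by simpa using prob_le_one)
  have hs : Summable (fun n : ℕ => Real.exp (-(Lam m E * t)) * ((Lam m E) * t) ^ n / n.factorial *
      (ustepIter m E n x A).toReal) :=
    Summable.of_nonneg_of_le (fun n => mul_nonneg (hp0 n) ENNReal.toReal_nonneg)
      (fun n => mul_le_of_le_one_right (hp0 n) (hle n)) (pc_pois_sum _).summable
  have : (Pt m E t x A).toReal = ∑' n : ℕ, Real.exp (-(Lam m E * t)) * ((Lam m E) * t) ^ n /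
      n.factorial * (ustepIter m E n x A).toReal := by
    rw [pc_Pt_apply t x hA, ENNReal.tsum_toReal_eq]
    · refine tsum_congr fun n => ?_
      rw [neg_mul, ENNReal.toReal_mul, ENNReal.toReal_ofReal (hp0 n)]
    · intro n
      have := pc_prob_iter hm hE n x
      exact ENNReal.mul_ne_top ENNReal.ofReal_ne_top (measure_ne_top _ _)
  rw [this]
  exact hs.hasSum

lemma pc_Pt_prob {m : ℕ} {E : ℝ} (hm : 1 ≤ m) (hE : 0 < E) {t : ℝ} (ht : 0 ≤ t) (x : Delta m E) :
    IsProbabilityMeasure (Pt m E t x) := by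
  constructor
  have hL := pc_Lam_pos hm hE
  rw [pc_Pt_apply t x MeasurableSet.univ]
  have hp0 : ∀ n : ℕ, 0 ≤ Real.exp (-(Lam m E * t)) * ((Lam m E) * t) ^ n / n.factorial :=
    fun n => by positivity
  have h1 : ∀ n, ustepIter m E n x univ = 1 := fun n => by
    have := pc_prob_iter hm hE n x
    exact measure_univ
  simp only [h1, mul_one, neg_mul]
  rw [← ENNReal.ofReal_tsum_of_nonneg hp0 (pc_pois_sum _).summable, (pc_pois_sum _).tsum_eq,
    ENNReal.ofReal_one]

lemma pc_cont {m : ℕ} {E : ℝ} (hm : 1 ≤ m) (hE : 0 < E) {a : ℝ} (ha : 1/2 < a) (ha1 : a < 1) :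
    ∃ B D : ℝ, 1 ≤ B ∧ 0 ≤ D ∧ ∀ A : Set (Delta m E), MeasurableSet A → ∀ t : ℝ, 0 < t → ∀ x x',
      (Pt m E t x A).toReal - (Pt m E t x' A).toReal ≤
        D * t ^ (-(2*a)) * (pcV m E a B x + pcV m E a B x') := by
  obtain ⟨B, C, hB, hC, h⟩ := pc_disc hm hE ha ha1
  have hL := pc_Lam_pos hm hE
  refine ⟨B, C * (3 * (Lam m E) ^ (-(2*a))), hB, by positivity, fun A hA t ht x x' => ?_⟩
  have hlt : 0 < Lam m E * t := by positivity
  have hVV : 0 ≤ pcV m E a B x + pcV m E a B x' := by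
    have h1 := pc_V_one (E := E) (a := a) (B := B) (by linarith) x
    have h2 := pc_V_one (E := E) (a := a) (B := B) (by linarith) x'
    linarith
  obtain ⟨hs, hle⟩ := pc_pois hlt (β := 2 * a) (by linarith) (by linarith)
  have h1 := (pc_Pt_hasSum hm hE ht.le x hA).sub (pc_Pt_hasSum hm hE ht.le x' hA)
  have h2 := hs.hasSum.mul_left (C * (pcV m E a B x + pcV m E a B x'))
  have h3 := hasSum_le (fun n => ?_) h1 h2
  · refine h3.trans ((mul_le_mul_of_nonneg_left hle (by positivity)).trans (le_of_eq ?_))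
    rw [Real.mul_rpow hL.le ht.le]
    ring
  · have hp0 : 0 ≤ Real.exp (-(Lam m E * t)) * ((Lam m E) * t) ^ n / n.factorial := by positivity
    have := mul_le_mul_of_nonneg_left (h A hA n x x') hp0
    refine le_trans (le_of_eq ?_) (this.trans (le_of_eq ?_))
    · ring
    · ring

lemma pc_tv {m : ℕ} {E : ℝ} (hm : 1 ≤ m) (hE : 0 < E) {a : ℝ} (ha : 1/2 < a) (ha1 : a < 1) :
    ∃ B D : ℝ, 1 ≤ B ∧ 0 ≤ D ∧ ∀ (μ ν : Measure (Delta m E)) [IsProbabilityMeasure μ]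
      [IsProbabilityMeasure ν] (t : ℝ), 0 < t →
      tvDist (μ.bind (Pt m E t)) (ν.bind (Pt m E t)) ≤ ∫ p : Delta m E × Delta m E,
        min 1 (D * t ^ (-(2*a)) * (pcV m E a B p.1 + pcV m E a B p.2)) ∂(μ.prod ν) := by
  obtain ⟨B, D, hB, hD, h⟩ := pc_cont hm hE ha ha1
  refine ⟨B, D, hB, hD, fun μ ν _ _ t ht => ?_⟩
  have hVm := pc_measurable_V m E a B
  have hV0 : ∀ x : Delta m E, 0 ≤ pcV m E a B x := fun x =>
    zero_le_one.trans (pc_V_one (by linarith) x)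
  have ht0 : 0 ≤ t ^ (-(2*a)) := Real.rpow_nonneg ht.le _
  have hG0 : ∀ p : Delta m E × Delta m E,
      0 ≤ min 1 (D * t ^ (-(2*a)) * (pcV m E a B p.1 + pcV m E a B p.2)) := fun p =>
    le_min zero_le_one (mul_nonneg (mul_nonneg hD ht0) (add_nonneg (hV0 _) (hV0 _)))
  have hGm : Measurable fun p : Delta m E × Delta m E =>
      min 1 (D * t ^ (-(2*a)) * (pcV m E a B p.1 + pcV m E a B p.2)) := by
    fun_prop
  have hGi : Integrable (fun p : Delta m E × Delta m E =>
      min 1 (D * t ^ (-(2*a)) * (pcV m E a B p.1 + pcV m E a B p.2))) (μ.prod ν) := by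
    refine Integrable.of_bound hGm.aestronglyMeasurable 1 (ae_of_all _ fun p => ?_)
    rw [Real.norm_of_nonneg (hG0 p)]
    exact min_le_left _ _
  unfold tvDist
  refine Real.iSup_le (fun A => ?_) (integral_nonneg hG0)
  obtain ⟨A, hA⟩ := A
  change |((μ.bind (Pt m E t)) A).toReal - ((ν.bind (Pt m E t)) A).toReal| ≤ _
  have hPm := pc_measurable_Pt m E t
  have hm1 : Measurable fun x => Pt m E t x A := (Measure.measurable_coe hA).comp hPm
  have hle : ∀ x, Pt m E t x A ≤ 1 := fun x => by
    have := pc_Pt_prob hm hE ht.le x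
    exact prob_le_one
  have hleR : ∀ x, (Pt m E t x A).toReal ≤ 1 := fun x =>
    ENNReal.toReal_le_of_le_ofReal zero_le_one (by simpa using hle x)
  have e : ∀ (ρ : Measure (Delta m E)), ((ρ.bind (Pt m E t)) A).toReal =
      ∫ x, (Pt m E t x A).toReal ∂ρ := by
    intro ρ
    rw [Measure.bind_apply hA hPm.aemeasurable, integral_toReal hm1.aemeasurable]
    exact ae_of_all _ fun x => (hle x).trans_lt ENNReal.one_lt_top
  have hi : ∀ (ρ : Measure (Delta m E)) [IsProbabilityMeasure ρ],
      Integrable (fun x => (Pt m E t x A).toReal) ρ := by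
    intro ρ _
    refine Integrable.of_bound hm1.ennreal_toReal.aestronglyMeasurable 1 (ae_of_all _ fun p => ?_)
    rw [Real.norm_of_nonneg ENNReal.toReal_nonneg]
    exact hleR p
  have e1 : ∫ x, (Pt m E t x A).toReal ∂μ = ∫ p, (Pt m E t p.1 A).toReal ∂(μ.prod ν) := by
    rw [integral_fun_fst (μ := μ) (ν := ν) (fun x => (Pt m E t x A).toReal)]; simp
  have e2 : ∫ x, (Pt m E t x A).toReal ∂ν = ∫ p, (Pt m E t p.2 A).toReal ∂(μ.prod ν) := by
    rw [integral_fun_snd (μ := μ) (ν := ν) (fun x => (Pt m E t x A).toReal)]; simp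
  rw [e, e, e1, e2, ← integral_sub ((hi μ).comp_fst ν) ((hi ν).comp_snd μ)]
  refine (abs_integral_le_integral_abs).trans ?_
  refine integral_mono (((hi μ).comp_fst ν).sub ((hi ν).comp_snd μ)).abs hGi fun p => ?_
  refine le_min ?_ ?_
  · have h1 := hleR p.1
    have h2 := hleR p.2
    have h3 : 0 ≤ (Pt m E t p.1 A).toReal := ENNReal.toReal_nonneg
    have h4 : 0 ≤ (Pt m E t p.2 A).toReal := ENNReal.toReal_nonneg
    exact abs_le.2 ⟨by linarith, by linarith⟩
  · have h1 := h A hA t ht p.1 p.2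
    have h2 := h A hA t ht p.2 p.1
    rw [add_comm (pcV m E a B p.2)] at h2
    exact abs_le.2 ⟨by linarith, by linarith⟩

lemma pc_V_int {m : ℕ} {E : ℝ} {γ B : ℝ} (hB : 1 ≤ B) (μ : Measure (Delta m E))
    (hμ : memM m E (γ/8) μ) : Integrable (pcV m E (1 - γ/4) B) μ := by
  obtain ⟨hp, hf⟩ := hμ
  have hQ0 : ∀ x : Delta m E, 0 ≤ ∑ k, (x.1 k) ^ (2*(γ/8) - 1) + (tank m E x) ^ (γ/8 - 1/2) :=
    fun x => add_nonneg (Finset.sum_nonneg fun k _ => Real.rpow_nonneg (x.2.1 k).le _)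
      (Real.rpow_nonneg (pc_tank_pos x).le _)
  have hQm : Measurable fun x : Delta m E =>
      ∑ k, (x.1 k) ^ (2*(γ/8) - 1) + (tank m E x) ^ (γ/8 - 1/2) :=
    (Finset.measurable_sum _ fun i _ => (pc_mc m E i).pow_const _).add
      ((pc_measurable_tank m E).pow_const _)
  have hQi : Integrable (fun x : Delta m E =>
      ∑ k, (x.1 k) ^ (2*(γ/8) - 1) + (tank m E x) ^ (γ/8 - 1/2)) μ :=
    (lintegral_ofReal_ne_top_iff_integrable hQm.aestronglyMeasurable (ae_of_all _ hQ0)).1 hf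
  refine Integrable.mono' ((integrable_const 1).add (hQi.const_mul B))
    (pc_measurable_V m E _ B).aestronglyMeasurable (ae_of_all _ fun x => ?_)
  rw [Real.norm_of_nonneg (zero_le_one.trans (pc_V_one (by linarith) x))]
  simp only [Pi.add_apply]
  unfold pcV
  rw [show -(1 - γ/4) = 2*(γ/8) - 1 by ring, show -((1 - γ/4)/2) = γ/8 - 1/2 by ring]
  have h1 : 0 ≤ ∑ k, (x.1 k) ^ (2*(γ/8) - 1) :=
    Finset.sum_nonneg fun k _ => Real.rpow_nonneg (x.2.1 k).le _
  nlinarith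

/-- Theorem 3, polynomial contraction of the Markov operator.
For any `γ > 0` and `μ, ν ∈ M_{γ/8}`, `t^{2-γ} ‖μP^t - νP^t‖_TV → 0` as `t → ∞`. -/
theorem polynomial_contraction (m : ℕ) (hm : 1 ≤ m) (E : ℝ) (hE : 0 < E)
    (γ : ℝ) (hγ : 0 < γ) (μ ν : Measure (Delta m E))
    (hμ : memM m E (γ/8) μ) (hν : memM m E (γ/8) ν) :
    Tendsto (fun t : ℝ => t ^ (2 - γ) * tvDist (μ.bind (Pt m E t)) (ν.bind (Pt m E t)))
      atTop (nhds 0) := by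
  have := hμ.1
  have := hν.1
  have htv : ∀ t, 0 ≤ tvDist (μ.bind (Pt m E t)) (ν.bind (Pt m E t)) := fun t =>
    Real.iSup_nonneg fun _ => abs_nonneg _
  rcases lt_or_ge γ 2 with h2 | h2
  · obtain ⟨B, D, hB, hD, h⟩ := pc_tv hm hE (a := 1 - γ/4) (by linarith) (by linarith)
    have hi : Integrable (fun p : Delta m E × Delta m E =>
        pcV m E (1 - γ/4) B p.1 + pcV m E (1 - γ/4) B p.2) (μ.prod ν) :=
      ((pc_V_int hB μ hμ).comp_fst ν).add ((pc_V_int hB ν hν).comp_snd μ)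
    have hlim : Tendsto (fun t : ℝ => t ^ (-(γ/2)) * (D * ∫ p : Delta m E × Delta m E,
        (pcV m E (1 - γ/4) B p.1 + pcV m E (1 - γ/4) B p.2) ∂(μ.prod ν))) atTop (nhds 0) := by
      simpa using (tendsto_rpow_neg_atTop (y := γ/2) (by linarith)).mul_const
        (D * ∫ p : Delta m E × Delta m E,
        (pcV m E (1 - γ/4) B p.1 + pcV m E (1 - γ/4) B p.2) ∂(μ.prod ν))
    refine tendsto_of_tendsto_of_tendsto_of_le_of_le' tendsto_const_nhds hlim ?_ ?_
    · filter_upwards [eventually_gt_atTop 0] with t ht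
      exact mul_nonneg (Real.rpow_nonneg ht.le _) (htv t)
    · filter_upwards [eventually_gt_atTop 0] with t ht
      have ht0 : 0 ≤ t ^ (-(2*(1 - γ/4))) := Real.rpow_nonneg ht.le _
      have hV0 : ∀ x : Delta m E, 0 ≤ pcV m E (1 - γ/4) B x := fun x =>
        zero_le_one.trans (pc_V_one (by linarith) x)
      have h4 : ∫ p : Delta m E × Delta m E, min 1 (D * t ^ (-(2*(1 - γ/4))) *
          (pcV m E (1 - γ/4) B p.1 + pcV m E (1 - γ/4) B p.2)) ∂(μ.prod ν) ≤
          ∫ p : Delta m E × Delta m E, D * t ^ (-(2*(1 - γ/4))) *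
          (pcV m E (1 - γ/4) B p.1 + pcV m E (1 - γ/4) B p.2) ∂(μ.prod ν) := by
        refine integral_mono_of_nonneg (ae_of_all _ fun p => ?_)
          (hi.const_mul _) (ae_of_all _ fun p => ?_)
        · have h5 : 0 ≤ D * t ^ (-(2*(1 - γ/4))) *
            (pcV m E (1 - γ/4) B p.1 + pcV m E (1 - γ/4) B p.2) :=
            mul_nonneg (mul_nonneg hD ht0) (add_nonneg (hV0 _) (hV0 _))
          exact le_min zero_le_one h5
        · exact min_le_right _ _
      have h3 := (h μ ν t ht).trans h4
      rw [integral_const_mul] at h3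
      refine (mul_le_mul_of_nonneg_left h3 (Real.rpow_nonneg ht.le (2 - γ))).trans (le_of_eq ?_)
      have e : t ^ (-(γ/2)) = t ^ (2 - γ) * t ^ (-(2*(1 - γ/4))) := by
        rw [← Real.rpow_add ht]; congr 1; ring
      rw [e]; ring
  · obtain ⟨B, D, hB, hD, h⟩ := pc_tv hm hE (a := 3/4) (by norm_num) (by norm_num)
    have hVm := pc_measurable_V m E (3/4) B
    have hV0 : ∀ x : Delta m E, 0 ≤ pcV m E (3/4) B x := fun x =>
      zero_le_one.trans (pc_V_one (by linarith) x)
    have hlim : Tendsto (fun t : ℝ => ∫ p : Delta m E × Delta m E,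
        min 1 (D * t ^ (-(2*(3/4 : ℝ))) * (pcV m E (3/4) B p.1 + pcV m E (3/4) B p.2)) ∂(μ.prod ν))
        atTop (nhds (∫ p : Delta m E × Delta m E, (0:ℝ) ∂(μ.prod ν))) := by
      refine tendsto_integral_filter_of_dominated_convergence (fun _ => 1) ?_ ?_
        (integrable_const 1) ?_
      · refine Eventually.of_forall fun t => Measurable.aestronglyMeasurable ?_
        fun_prop
      · filter_upwards [eventually_gt_atTop 0] with t ht
        refine ae_of_all _ fun p => ?_
        have ht0 : 0 ≤ t ^ (-(2*(3/4 : ℝ))) := Real.rpow_nonneg ht.le _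
        rw [Real.norm_of_nonneg (le_min zero_le_one
          (mul_nonneg (mul_nonneg hD ht0) (add_nonneg (hV0 _) (hV0 _))))]
        exact min_le_left _ _
      · refine ae_of_all _ fun p => ?_
        have h1 := (((tendsto_rpow_neg_atTop (y := 2*(3/4 : ℝ)) (by norm_num)).const_mul D).mul_const
          (pcV m E (3/4) B p.1 + pcV m E (3/4) B p.2))
        have h3 := (tendsto_const_nhds (x := (1:ℝ))).min h1
        simpa using h3
    rw [integral_zero] at hlim
    refine tendsto_of_tendsto_of_tendsto_of_le_of_le' tendsto_const_nhds hlim ?_ ?_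
    · filter_upwards [eventually_gt_atTop 0] with t ht
      exact mul_nonneg (Real.rpow_nonneg ht.le _) (htv t)
    · filter_upwards [eventually_ge_atTop 1] with t ht
      have h1 : t ^ (2 - γ) ≤ 1 := Real.rpow_le_one_of_one_le_of_nonpos ht (by linarith)
      exact (mul_le_of_le_one_left (htv t) h1).trans (h μ ν t (by linarith))
end

section
/- The rate t^{−2} is optimal in the following sense: fix i ∈ {1,…,m}, constants 0 < c < 1 < c', and for ε > 0 let B_ε = {x ∈ Δ : x^i < ε}. If μ and ν are Borel probability measures on Δ such that for all sufficiently small ε > 0 one has μ|_{B_ε} ≤ c·π|_{B_ε} and ν|_{B_ε} ≥ c'·π|_{B_ε}, then there exist κ > 0 and t₀ > 0 such that ‖μP^t − νP^t‖_TV ≥ κ·t^{−2} for all t ≥ t₀. -/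
open MeasureTheory Set Filter

section Helpers

lemma lint_ftc {a b : ℝ} (hab : a ≤ b) (G g : ℝ → ℝ) (hc : ContinuousOn G (Icc a b))
    (hd : ∀ u ∈ Ioo a b, HasDerivAt G (g u) u) (h0 : ∀ u ∈ Ioo a b, 0 ≤ g u) :
    ∫⁻ u in Ioo a b, ENNReal.ofReal (g u) = ENNReal.ofReal (G b - G a) := by
  have hi : IntegrableOn g (Ioc a b) :=
    intervalIntegral.integrableOn_deriv_of_nonneg hc hd h0
  have hi' : IntervalIntegrable g volume a b := by
    rwa [intervalIntegrable_iff_integrableOn_Ioc_of_le hab]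
  have h1 := intervalIntegral.integral_eq_sub_of_hasDerivAt_of_le hab hc hd hi'
  rw [← h1, intervalIntegral.integral_of_le hab,
    integral_Ioc_eq_integral_Ioo, ofReal_integral_eq_lintegral_ofReal]
  · exact hi.mono_set Ioo_subset_Ioc_self
  · exact (ae_restrict_iff' measurableSet_Ioo).2 (Eventually.of_forall h0)

lemma lint_sq {p q : ℝ} (hp : 0 < p) (hq : 0 ≤ q) :
    ∫⁻ u, ENNReal.ofReal (1 / (p + q * u) ^ 2) ∂unif01 = ENNReal.ofReal (1 / (p * (p + q))) := by
  have hpos : ∀ u : ℝ, 0 ≤ u → 0 < p + q * u := fun u hu => by positivity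
  rw [unif01, lint_ftc zero_le_one (fun u => u / (p * (p + q * u)))]
  · simp
  · apply ContinuousOn.div (by fun_prop) (by fun_prop)
    intro u hu
    exact (mul_pos hp (hpos u hu.1)).ne'
  · intro u hu
    have h := hpos u hu.1.le
    have h2 : HasDerivAt (fun u : ℝ => p * (p + q * u)) (p * q) u := by
      simpa using (((hasDerivAt_id u).const_mul q).const_add p).const_mul p
    refine ((hasDerivAt_id' u).fun_div h2 (by positivity)).congr_deriv ?_
    field_simp
    ring
  · intro u hu
    positivity

lemma lint_sq' {p q : ℝ} (hp : 0 < p) (hq : 0 ≤ q) :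
    ∫⁻ u, ENNReal.ofReal (1 / (p + q * (1 - u)) ^ 2) ∂unif01
      = ENNReal.ofReal (1 / (p * (p + q))) := by
  have hpos : ∀ u : ℝ, u ≤ 1 → 0 < p + q * (1 - u) := fun u hu => by
    have := mul_nonneg hq (sub_nonneg.2 hu); linarith
  rw [unif01, lint_ftc zero_le_one (fun u => -((1 - u) / (p * (p + q * (1 - u)))))]
  · simp
  · apply ContinuousOn.neg
    apply ContinuousOn.div (by fun_prop) (by fun_prop)
    intro u hu
    exact (mul_pos hp (hpos u hu.2)).ne'
  · intro u hu
    have h := hpos u hu.2.le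
    have h1 : HasDerivAt (fun u : ℝ => 1 - u) (-1) u := by
      simpa using (hasDerivAt_id u).const_sub 1
    have h2 : HasDerivAt (fun u : ℝ => p * (p + q * (1 - u))) (p * (q * (-1))) u := by
      simpa using ((h1.const_mul q).const_add p).const_mul p
    refine (h1.fun_div h2 (by positivity)).fun_neg.congr_deriv ?_
    field_simp
    ring
  · intro u hu
    positivity

lemma hasDerivAt_sqrt' {u : ℝ} (hu : 0 < u) : HasDerivAt (fun u => 2 * √u) (1 / √u) u := by
  refine ((Real.hasDerivAt_sqrt hu.ne').const_mul 2).congr_deriv ?_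
  field_simp

lemma lint_rsqrt (s : ℝ) (hs : 0 ≤ s) :
    ∫⁻ u in Ioo 0 s, ENNReal.ofReal (1 / √u) = ENNReal.ofReal (2 * √s) := by
  rw [lint_ftc hs (fun u => 2 * √u)]
  · simp
  · fun_prop
  · intro u hu
    exact hasDerivAt_sqrt' hu.1
  · intro u hu
    positivity

lemma lint_rsqrt' (s : ℝ) (hs : 0 ≤ s) :
    ∫⁻ u in Ioo 0 s, ENNReal.ofReal (1 / √(s - u)) = ENNReal.ofReal (2 * √s) := by
  rw [lint_ftc hs (fun u => - (2 * √(s - u)))]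
  · simp
  · fun_prop
  · intro u hu
    have h1 : HasDerivAt (fun u : ℝ => s - u) (-1) u := by
      simpa using (hasDerivAt_id u).const_sub s
    have := ((hasDerivAt_sqrt' (sub_pos.2 hu.2)).comp u h1).fun_neg
    refine HasDerivAt.congr_deriv this ?_
    ring
  · intro u hu
    positivity

lemma lint_r34 :
    ∫⁻ u, ENNReal.ofReal (1 / (√(1 - u) * √√(1 - u))) ∂unif01 = ENNReal.ofReal 4 := by
  rw [unif01, lint_ftc zero_le_one (fun u => - (4 * √√(1 - u)))]
  · simp
  · fun_prop
  · intro u hu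
    have h1 : HasDerivAt (fun u : ℝ => 1 - u) (-1) u := by
      simpa using (hasDerivAt_id u).const_sub 1
    have hp : 0 < 1 - u := sub_pos.2 hu.2
    have h2 := h1.sqrt hp.ne'
    have h3 := h2.sqrt (Real.sqrt_pos.2 hp).ne'
    refine ((h3.const_mul 4).fun_neg).congr_deriv ?_
    have := Real.sqrt_pos.2 hp
    have := Real.sqrt_pos.2 this
    field_simp
    norm_num
  · intro u hu
    positivity

variable {m : ℕ} {E : ℝ}

lemma tank_pos (x : Delta m E) : 0 < tank m E x := sub_pos.2 x.2.2

lemma sum_T0 (j : Fin m) (u : ℝ) (x : Fin m → ℝ) :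
    E - ∑ k, T0 m E j u x k = u ^ 2 * x j := by
  have h1 : ∑ k, T0 m E j u x k
        = ((E - ∑ k, x k) + (1 - u ^ 2) * x j) + ∑ k ∈ Finset.univ \ {j}, x k := by
    simp only [T0]
    rw [Finset.sum_update_of_mem (Finset.mem_univ j)]
  have h2 : ∑ k ∈ Finset.univ \ {j}, x k = (∑ k, x k) - x j := by
    rw [← Finset.erase_eq]
    exact Finset.sum_erase_eq_sub (Finset.mem_univ j)
  rw [h1, h2]
  ring

lemma tank_Texch (j : Fin m) {u : ℝ} (hu : u ∈ Ioo (0:ℝ) 1) (x : Delta m E) :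
    tank m E (Texch m E j u x) = u ^ 2 * x.1 j := by
  rw [Texch, dif_pos hu, tank]
  exact sum_T0 j u x.1

lemma Texch_same (j : Fin m) {u : ℝ} (hu : u ∈ Ioo (0:ℝ) 1) (x : Delta m E) :
    (Texch m E j u x).1 j = tank m E x + (1 - u ^ 2) * x.1 j := by
  rw [Texch, dif_pos hu]
  simp [T0, tank]

lemma Texch_ne {i j : Fin m} (hij : j ≠ i) {u : ℝ} (x : Delta m E) :
    (Texch m E j u x).1 i = x.1 i := by
  rw [Texch]
  split_ifs
  · simp [T0, Function.update_of_ne hij.symm]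
  · rfl

lemma measurable_T0 (j : Fin m) :
    Measurable (fun p : ℝ × (Fin m → ℝ) => T0 m E j p.1 p.2) := by
  rw [measurable_pi_iff]
  intro k
  by_cases hk : k = j
  · subst hk
    simp only [T0, Function.update_self]
    fun_prop
  · simp only [T0, Function.update_of_ne hk]
    fun_prop

lemma measurable_Texch2 (j : Fin m) :
    Measurable (fun p : ℝ × Delta m E => Texch m E j p.1 p.2) := by
  refine Measurable.subtype_mk (f := fun p : ℝ × Delta m E => (Texch m E j p.1 p.2).1)
    (h := fun p => (Texch m E j p.1 p.2).2) ?_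
  have : (fun p : ℝ × Delta m E => (Texch m E j p.1 p.2).1)
      = fun p => if p.1 ∈ Ioo (0:ℝ) 1 then T0 m E j p.1 p.2.1 else p.2.1 := by
    funext p
    rw [Texch]
    split_ifs <;> rfl
  rw [this]
  refine Measurable.ite (measurable_fst measurableSet_Ioo) ?_ (by fun_prop)
  exact (measurable_T0 j).comp (f := fun p : ℝ × Delta m E => (p.1, p.2.1)) (by fun_prop)

lemma measurable_Texch (j : Fin m) (x : Delta m E) :
    Measurable (fun u => Texch m E j u x) :=
  (measurable_Texch2 j).comp (f := fun u : ℝ => (u, x)) (by fun_prop)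

instance : IsProbabilityMeasure unif01 := ⟨by simp [unif01]⟩

lemma meas_coord (j : Fin m) : Measurable fun x : Delta m E => x.1 j :=
  (measurable_pi_apply j).comp measurable_subtype_coe

lemma meas_tank : Measurable (tank m E) :=
  measurable_const.sub (Finset.measurable_sum _ fun j _ => meas_coord j)

lemma measurable_jumpRate : Measurable (jumpRate m E) := by
  unfold jumpRate
  exact Finset.measurable_sum _ fun j _ => (meas_coord j).sqrt

lemma lint_ustep (x : Delta m E) {f : Delta m E → ENNReal} (hf : Measurable f) :
    ∫⁻ z, f z ∂(ustep m E x) = ENNReal.ofReal (1 - jumpRate m E x / Lam m E) * f x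
      + (ENNReal.ofReal (Lam m E))⁻¹ * ∑ j : Fin m, ENNReal.ofReal (√(x.1 j)) *
        ∫⁻ u, f (Texch m E j u x) ∂unif01 := by
  rw [ustep, lintegral_add_measure, lintegral_smul_measure, lintegral_smul_measure,
    lintegral_dirac' _ hf, lintegral_sum_measure, tsum_fintype]
  simp only [lintegral_smul_measure, smul_eq_mul]
  congr 2
  refine Finset.sum_congr rfl fun j _ => ?_
  rw [lintegral_map hf (measurable_Texch j x)]

lemma measurable_ustep : Measurable (ustep m E) := by
  refine Measure.measurable_of_measurable_coe _ fun s hs => ?_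
  have h : (fun x => ustep m E x s) = fun x =>
      ENNReal.ofReal (1 - jumpRate m E x / Lam m E) * s.indicator 1 x
      + (ENNReal.ofReal (Lam m E))⁻¹ * ∑ j : Fin m, ENNReal.ofReal (√(x.1 j)) *
        ∫⁻ u, s.indicator 1 (Texch m E j u x) ∂unif01 := by
    funext x
    rw [← lint_ustep x (measurable_one.indicator hs), lintegral_indicator_one hs]
  rw [h]
  have h1 : ∀ j : Fin m, Measurable fun x : Delta m E =>
      ∫⁻ u, s.indicator (1 : Delta m E → ENNReal) (Texch m E j u x) ∂unif01 := by
    intro j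
    have : Measurable fun p : ℝ × Delta m E =>
        s.indicator (1 : Delta m E → ENNReal) (Texch m E j p.1 p.2) :=
      (measurable_one.indicator hs).comp (measurable_Texch2 j)
    exact this.lintegral_prod_left'
  have h2 := measurable_jumpRate (m := m) (E := E)
  have h3 : Measurable (s.indicator (1 : Delta m E → ENNReal)) := measurable_one.indicator hs
  refine Measurable.add (by fun_prop) (Measurable.const_mul ?_ _)
  exact Finset.measurable_sum _ fun j _ => Measurable.mul (meas_coord j).sqrt.ennreal_ofReal (h1 j)

lemma measurable_ustepIter (n : ℕ) : Measurable (ustepIter m E n) := by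
  induction n with
  | zero => exact Measure.measurable_dirac
  | succ n ih => exact (Measure.measurable_bind' ih).comp measurable_ustep

lemma lint_ustepIter_succ (n : ℕ) (x : Delta m E) {f : Delta m E → ENNReal} (hf : Measurable f) :
    ∫⁻ z, f z ∂(ustepIter m E (n+1) x)
      = ∫⁻ z, (∫⁻ w, f w ∂(ustepIter m E n z)) ∂(ustep m E x) :=
  Measure.lintegral_bind (measurable_ustepIter n).aemeasurable hf.aemeasurable

lemma lint_Pt (t : ℝ) (x : Delta m E) (f : Delta m E → ENNReal) :
    ∫⁻ z, f z ∂(Pt m E t x) = ∑' n : ℕ,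
      ENNReal.ofReal (Real.exp (-(Lam m E) * t) * ((Lam m E) * t) ^ n / n.factorial) *
        ∫⁻ z, f z ∂(ustepIter m E n x) := by
  rw [Pt, lintegral_sum_measure]
  simp only [lintegral_smul_measure, smul_eq_mul]

lemma measurable_Pt (t : ℝ) : Measurable (Pt m E t) := by
  refine Measure.measurable_of_measurable_coe _ fun s hs => ?_
  have h : (fun x => Pt m E t x s) = fun x => ∑' n : ℕ,
      ENNReal.ofReal (Real.exp (-(Lam m E) * t) * ((Lam m E) * t) ^ n / n.factorial) *
        ustepIter m E n x s := by
    funext x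
    rw [Pt, Measure.sum_apply _ hs]
    rfl
  rw [h]
  refine Measurable.tsum fun n => ?_
  exact ((Measure.measurable_coe hs).comp (measurable_ustepIter n)).const_mul _

lemma Lam_pos (hm : 1 ≤ m) (hE : 0 < E) : 0 < Lam m E := by
  have : (0:ℝ) < m := by exact_mod_cast hm
  exact Real.sqrt_pos.2 (by positivity)

lemma jumpRate_le (x : Delta m E) : jumpRate m E x ≤ Lam m E := by
  apply Real.le_sqrt_of_sq_le
  have h := sq_sum_le_card_mul_sum_sq (s := (Finset.univ : Finset (Fin m)))
    (f := fun j => √(x.1 j))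
  simp only [Finset.card_univ, Fintype.card_fin] at h
  have h2 : ∑ j, √(x.1 j) ^ 2 = ∑ j, x.1 j :=
    Finset.sum_congr rfl fun j _ => Real.sq_sqrt (x.2.1 j).le
  rw [h2] at h
  refine h.trans ?_
  gcongr
  exact x.2.2.le

lemma jumpRate_nonneg (x : Delta m E) : 0 ≤ jumpRate m E x :=
  Finset.sum_nonneg fun _ _ => Real.sqrt_nonneg _

lemma le_jumpRate (x : Delta m E) : √(E - tank m E x) ≤ jumpRate m E x := by
  apply Real.sqrt_le_iff.2 ⟨jumpRate_nonneg x, ?_⟩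
  have h : ∑ j, x.1 j = ∑ j, √(x.1 j) ^ 2 :=
    Finset.sum_congr rfl fun j _ => (Real.sq_sqrt (x.2.1 j).le).symm
  rw [tank, sub_sub_cancel, h]
  exact Finset.sum_sq_le_sq_sum_of_nonneg fun j _ => Real.sqrt_nonneg _

lemma x_lt (x : Delta m E) (j : Fin m) : x.1 j < E :=
  lt_of_le_of_lt (Finset.single_le_sum (fun k _ => (x.2.1 k).le) (Finset.mem_univ j)) x.2.2

/-- gain bound -/
def GainLe (j : Fin m) (x : Delta m E) (f : Delta m E → ℝ) (g : ℝ) : Prop :=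
  ENNReal.ofReal (√(x.1 j)) * ∫⁻ u, ENNReal.ofReal (f (Texch m E j u x)) ∂unif01
    ≤ ENNReal.ofReal g

lemma GainLe.of_bound {j : Fin m} {x : Delta m E} {f : Delta m E → ℝ} {h : ℝ → ℝ} {H : ℝ} {g : ℝ}
    (h1 : ∀ u ∈ Ioo (0:ℝ) 1, f (Texch m E j u x) ≤ h u)
    (h2 : ∫⁻ u, ENNReal.ofReal (h u) ∂unif01 ≤ ENNReal.ofReal H)
    (h3 : √(x.1 j) * H ≤ g) : GainLe j x f g := by
  refine le_trans ?_ (ENNReal.ofReal_le_ofReal h3)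
  rw [ENNReal.ofReal_mul (Real.sqrt_nonneg _)]
  gcongr
  refine le_trans ?_ h2
  apply lintegral_mono_ae
  rw [unif01]
  refine (ae_restrict_iff' measurableSet_Ioo).2 (Eventually.of_forall fun u hu => ?_)
  exact ENNReal.ofReal_le_ofReal (h1 u hu)

lemma GainLe.add {j : Fin m} {x : Delta m E} {f f' : Delta m E → ℝ} {g g' : ℝ}
    (h : GainLe j x f g) (h' : GainLe j x f' g') (hf : Measurable f)
    (hg : 0 ≤ g) (hg' : 0 ≤ g') :
    GainLe j x (fun z => f z + f' z) (g + g') := by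
  unfold GainLe at *
  rw [ENNReal.ofReal_add hg hg']
  refine le_trans ?_ (add_le_add h h')
  rw [← mul_add, ← lintegral_add_left]
  · gcongr
    exact ENNReal.ofReal_add_le
  · exact (hf.comp (measurable_Texch j x)).ennreal_ofReal

lemma GainLe.const_mul {j : Fin m} {x : Delta m E} {f : Delta m E → ℝ} {g : ℝ}
    (h : GainLe j x f g) {C : ℝ} (hC : 0 ≤ C) (hf : Measurable f) :
    GainLe j x (fun z => C * f z) (C * g) := by
  unfold GainLe at *
  simp only [ENNReal.ofReal_mul hC]
  have hm : Measurable fun u => ENNReal.ofReal (f (Texch m E j u x)) :=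
    (hf.comp (measurable_Texch j x)).ennreal_ofReal
  rw [lintegral_const_mul _ hm, mul_left_comm]
  gcongr

lemma ustep_le (hm : 1 ≤ m) (hE : 0 < E) {f : Delta m E → ℝ} (hf : Measurable f)
    (hf0 : ∀ z, 0 ≤ f z) (x : Delta m E) (g : Fin m → ℝ) (hg0 : ∀ j, 0 ≤ g j)
    (hg : ∀ j, GainLe j x f (g j)) :
    ∫⁻ z, ENNReal.ofReal (f z) ∂(ustep m E x)
      ≤ ENNReal.ofReal (f x + (∑ j, g j - jumpRate m E x * f x) / Lam m E) := by
  have hL := Lam_pos hm hE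
  rw [lint_ustep x hf.ennreal_ofReal]
  have h1 : 0 ≤ 1 - jumpRate m E x / Lam m E := by
    rw [sub_nonneg, div_le_one hL]; exact jumpRate_le x
  have h2 : f x + (∑ j, g j - jumpRate m E x * f x) / Lam m E
      = (1 - jumpRate m E x / Lam m E) * f x + (Lam m E)⁻¹ * ∑ j, g j := by
    field_simp
    ring
  have h3 : 0 ≤ ∑ j, g j := Finset.sum_nonneg fun j _ => hg0 j
  rw [h2, ENNReal.ofReal_add (mul_nonneg h1 (hf0 x)) (by positivity), ENNReal.ofReal_mul h1,
    ENNReal.ofReal_mul (by positivity), ENNReal.ofReal_inv_of_pos hL,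
    ENNReal.ofReal_sum_of_nonneg fun j _ => hg0 j]
  gcongr with j
  exact hg j


noncomputable def q1 (i : Fin m) (s : ℝ) (x : Delta m E) : ℝ := if x.1 i < s ^ 2 then 1 else 0
noncomputable def q2 (i : Fin m) (s : ℝ) (x : Delta m E) : ℝ :=
  s ^ 4 * √(x.1 i) / ((x.1 i + s ^ 2) * (tank m E x + s ^ 2))
noncomputable def q3 (i : Fin m) (s : ℝ) (x : Delta m E) : ℝ := s ^ 3 / (x.1 i + s ^ 2)
noncomputable def q4 (i : Fin m) (s : ℝ) (x : Delta m E) : ℝ :=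
  s ^ 3 * √(x.1 i) / (√(x.1 i + s ^ 2) * √√(x.1 i + s ^ 2) * √√(tank m E x + s ^ 2))
noncomputable def pp (i : Fin m) (s : ℝ) (x : Delta m E) : ℝ := s ^ 3 * √(x.1 i) / (x.1 i + s ^ 2)
noncomputable def ww (i : Fin m) (s : ℝ) (x : Delta m E) : ℝ :=
  s ^ 3 * √(x.1 i) / (√(x.1 i + s ^ 2) * √√(x.1 i + s ^ 2))

lemma meas_q1 (i : Fin m) (s : ℝ) : Measurable (q1 (E := E) i s) :=
  Measurable.ite (measurableSet_lt (meas_coord i) measurable_const) measurable_const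
    measurable_const
lemma meas_q2 (i : Fin m) (s : ℝ) : Measurable (q2 (E := E) i s) := by
  have h1 := meas_coord (E := E) i
  have h2 := meas_tank (m := m) (E := E)
  exact (h1.sqrt.const_mul _).div ((h1.add_const _).mul (h2.add_const _))
lemma meas_q3 (i : Fin m) (s : ℝ) : Measurable (q3 (E := E) i s) := by
  have h1 := meas_coord (E := E) i
  exact measurable_const.div (h1.add_const _)
lemma meas_q4 (i : Fin m) (s : ℝ) : Measurable (q4 (E := E) i s) := by
  have h1 := meas_coord (E := E) i
  have h2 := meas_tank (m := m) (E := E)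
  exact (h1.sqrt.const_mul _).div
    (((h1.add_const _).sqrt.mul (h1.add_const _).sqrt.sqrt).mul (h2.add_const _).sqrt.sqrt)

lemma lint_cm {h : ℝ → ℝ} {H C : ℝ} (hC : 0 ≤ C)
    (h2 : ∫⁻ u, ENNReal.ofReal (h u) ∂unif01 ≤ ENNReal.ofReal H) :
    ∫⁻ u, ENNReal.ofReal (C * h u) ∂unif01 ≤ ENNReal.ofReal (C * H) := by
  simp only [ENNReal.ofReal_mul hC]
  rw [lintegral_const_mul' _ _ ENNReal.ofReal_ne_top]
  gcongr

lemma lint_ad {h h' : ℝ → ℝ} {H H' : ℝ} (hm : Measurable h) (hH : 0 ≤ H) (hH' : 0 ≤ H')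
    (h1 : ∫⁻ u, ENNReal.ofReal (h u) ∂unif01 ≤ ENNReal.ofReal H)
    (h2 : ∫⁻ u, ENNReal.ofReal (h' u) ∂unif01 ≤ ENNReal.ofReal H') :
    ∫⁻ u, ENNReal.ofReal (h u + h' u) ∂unif01 ≤ ENNReal.ofReal (H + H') := by
  rw [ENNReal.ofReal_add hH hH']
  refine le_trans ?_ (add_le_add h1 h2)
  rw [← lintegral_add_left hm.ennreal_ofReal]
  gcongr
  exact ENNReal.ofReal_add_le

lemma lint_c (C : ℝ) : ∫⁻ _u, ENNReal.ofReal C ∂unif01 ≤ ENNReal.ofReal C := by simp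

lemma gain1 (i j : Fin m) {s : ℝ} (hs : 0 < s) (x : Delta m E) :
    GainLe j x (q1 i s) (√(x.1 j) * q1 i s x + if j = i then 4 * q2 i s x else 0) := by
  split_ifs with h
  · subst h
    have ha := x.2.1 j
    have hy := tank_pos x
    have hY : 0 < tank m E x + s ^ 2 := by positivity
    refine GainLe.of_bound (h := fun u => (4 * s ^ 4) *
      (1 / ((tank m E x + s ^ 2) + x.1 j * (1 - u)) ^ 2)) ?_
      (lint_cm (by positivity) (lint_sq' hY ha.le).le) ?_
    · intro u hu
      rw [q1, Texch_same j hu]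
      have h1 : 0 < 1 - u := sub_pos.2 hu.2
      split_ifs with h
      · rw [mul_one_div, le_div_iff₀ (by positivity)]
        have h2 : (tank m E x + s ^ 2) + x.1 j * (1 - u) ≤ 2 * s ^ 2 := by
          nlinarith [mul_pos ha (mul_pos hu.1 h1)]
        calc 1 * ((tank m E x + s ^ 2) + x.1 j * (1 - u)) ^ 2 ≤ (2 * s ^ 2) ^ 2 := by
              rw [one_mul]; gcongr
          _ = _ := by ring
      · positivity
    · have h1 : 0 ≤ √(x.1 j) * q1 j s x := by
        rw [q1]; split_ifs <;> positivity
      refine le_trans ?_ (le_add_of_nonneg_left h1)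
      rw [q2]
      have : √(x.1 j) * (4 * s ^ 4 * (1 / ((tank m E x + s ^ 2) * (tank m E x + s ^ 2 + x.1 j))))
        = 4 * (s ^ 4 * √(x.1 j) / ((tank m E x + s ^ 2 + x.1 j) * (tank m E x + s ^ 2))) := by
        field_simp
      rw [this]
      gcongr 4 * (_ / (?_ * _))
      linarith
  · refine GainLe.of_bound (h := fun u => q1 i s x) ?_ (lint_c _) (by simp)
    intro u hu
    rw [q1, Texch_ne h, q1]

lemma aux_sq {x s u : ℝ} (hx : 0 ≤ x) (hs : 0 < s) (hu : 0 < u) :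
    1 / (u ^ 2 * x + s ^ 2) ≤ 2 * (1 / (s + √x * u) ^ 2) := by
  have h1 := Real.sqrt_nonneg x
  rw [mul_one_div, div_le_div_iff₀ (by positivity) (by positivity)]
  nlinarith [sq_nonneg (s - √x * u), Real.sq_sqrt hx]

lemma gain2_aux {a A' Y' s u : ℝ} (ha : 0 < a) (hs : 0 < s) (hu : 0 < u)
    (hA' : s ^ 2 ≤ A') (hY' : u ^ 2 * a + s ^ 2 ≤ Y') (hS : a + s ^ 2 ≤ A' + Y') :
    1 / (√A' * Y') ≤ (3 / √(a + s ^ 2)) * (1 / (s + √a * u) ^ 2) + 2 / ((a + s ^ 2) * s) := by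
  have hA'0 : 0 < A' := lt_of_lt_of_le (by positivity) hA'
  have hY'0 : 0 < Y' := lt_of_lt_of_le (by positivity) hY'
  have hA : 0 < a + s ^ 2 := by positivity
  have hra := Real.sqrt_nonneg a
  have hsA : 0 < √A' := Real.sqrt_pos.2 hA'0
  rcases le_total ((a + s ^ 2) / 2) A' with h | h
  · have h1 : √(a + s ^ 2) ≤ 3 / 2 * √A' := by
      rw [Real.sqrt_le_left (by positivity), mul_pow, Real.sq_sqrt hA'0.le]
      linarith
    have h2 : 1 / √A' ≤ (3 / 2) / √(a + s ^ 2) := by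
      rw [div_le_div_iff₀ hsA (by positivity)]
      linarith
    have h3 : 1 / Y' ≤ 2 * (1 / (s + √a * u) ^ 2) :=
      (one_div_le_one_div_of_le (by positivity) hY').trans (aux_sq ha.le hs hu)
    calc 1 / (√A' * Y') = (1 / √A') * (1 / Y') := by field_simp
      _ ≤ ((3 / 2) / √(a + s ^ 2)) * (2 * (1 / (s + √a * u) ^ 2)) := by gcongr
      _ = (3 / √(a + s ^ 2)) * (1 / (s + √a * u) ^ 2) := by ring
      _ ≤ _ := le_add_of_nonneg_right (by positivity)
  · have h1 : (a + s ^ 2) / 2 ≤ Y' := by linarith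
    have h2 : s ≤ √A' := Real.le_sqrt_of_sq_le hA'
    calc 1 / (√A' * Y') ≤ 1 / (s * ((a + s ^ 2) / 2)) := by gcongr
      _ = 2 / ((a + s ^ 2) * s) := by field_simp
      _ ≤ _ := le_add_of_nonneg_left (by positivity)

lemma gain2 (i j : Fin m) {s : ℝ} (hs : 0 < s) (x : Delta m E) :
    GainLe j x (q2 i s) (5 * pp i s x) := by
  have ha := x.2.1 i
  have hj := x.2.1 j
  have hy := tank_pos x
  have hrj := Real.sqrt_pos.2 hj
  have hri := Real.sqrt_pos.2 ha
  by_cases h : j = i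
  · subst h
    have hA : 0 < x.1 j + s ^ 2 := by positivity
    have hrA := Real.sqrt_pos.2 hA
    refine GainLe.of_bound (h := fun u => s ^ 4 * ((3 / √(x.1 j + s ^ 2)) *
      (1 / (s + √(x.1 j) * u) ^ 2) + 2 / ((x.1 j + s ^ 2) * s))) ?_
      (lint_cm (by positivity) (lint_ad (by fun_prop) (by positivity) (by positivity)
        (lint_cm (by positivity) (lint_sq hs hrj.le).le) (lint_c _))) ?_
    · intro u hu
      rw [q2, tank_Texch j hu, Texch_same j hu]
      have h1 : 0 < 1 - u ^ 2 := by nlinarith [hu.1, hu.2]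
      set a' := tank m E x + (1 - u ^ 2) * x.1 j with ha'
      have ha'0 : 0 < a' := by positivity
      have hu0 := hu.1
      have key := gain2_aux (A' := a' + s ^ 2) (Y' := u ^ 2 * x.1 j + s ^ 2) hj hs hu.1
        (by linarith) le_rfl (by rw [ha']; nlinarith)
      refine le_trans ?_ (mul_le_mul_of_nonneg_left key (by positivity))
      have h2 : √a' ≤ √(a' + s ^ 2) := Real.sqrt_le_sqrt (by nlinarith)
      have h3 : √(a' + s ^ 2) * √(a' + s ^ 2) = a' + s ^ 2 := Real.mul_self_sqrt (by positivity)
      rw [mul_one_div, div_le_div_iff₀ (by positivity) (by positivity)]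
      calc s ^ 4 * √a' * (√(a' + s ^ 2) * (u ^ 2 * x.1 j + s ^ 2))
          ≤ s ^ 4 * √(a' + s ^ 2) * (√(a' + s ^ 2) * (u ^ 2 * x.1 j + s ^ 2)) := by gcongr
        _ = s ^ 4 * ((√(a' + s ^ 2) * √(a' + s ^ 2)) * (u ^ 2 * x.1 j + s ^ 2)) := by ring
        _ = _ := by rw [h3]
    · have h2 : √(x.1 j + s ^ 2) ≤ s + √(x.1 j) := by
        rw [Real.sqrt_le_left (by positivity), add_sq, Real.sq_sqrt hj.le]
        nlinarith
      have h3 : √(x.1 j + s ^ 2) * √(x.1 j + s ^ 2) = x.1 j + s ^ 2 :=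
        Real.mul_self_sqrt (by positivity)
      have h4 : 3 / √(x.1 j + s ^ 2) * (1 / (s * (s + √(x.1 j))))
          ≤ 3 / ((x.1 j + s ^ 2) * s) := by
        rw [div_mul_div_comm]
        nth_rewrite 2 [← h3]
        rw [mul_one, mul_assoc, mul_comm _ s]
        gcongr
      calc _ ≤ √(x.1 j) * (s ^ 4 * (3 / ((x.1 j + s ^ 2) * s) + 2 / ((x.1 j + s ^ 2) * s))) := by
            gcongr
        _ = _ := by
          rw [pp]; field_simp; ring
  · refine GainLe.of_bound (h := fun u => (2 * s ^ 4 * √(x.1 i) / (x.1 i + s ^ 2)) *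
      (1 / (s + √(x.1 j) * u) ^ 2)) ?_
      (lint_cm (by positivity) (lint_sq hs hrj.le).le) ?_
    · intro u hu
      rw [q2, tank_Texch j hu, Texch_ne h]
      have hu0 := hu.1
      calc _ = (s ^ 4 * √(x.1 i) / (x.1 i + s ^ 2)) * (1 / (u ^ 2 * x.1 j + s ^ 2)) := by
            field_simp
        _ ≤ (s ^ 4 * √(x.1 i) / (x.1 i + s ^ 2)) * (2 * (1 / (s + √(x.1 j) * u) ^ 2)) := by
            gcongr
            exact aux_sq hj.le hs hu.1
        _ = _ := by ring
    · have h2 : √(x.1 j) / (s + √(x.1 j)) ≤ 1 := by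
        rw [div_le_one (by positivity)]; linarith
      calc _ = 2 * pp i s x * (√(x.1 j) / (s + √(x.1 j))) := by
            rw [pp]; field_simp
        _ ≤ 2 * pp i s x * 1 := by
            have : 0 ≤ pp i s x := by unfold pp; positivity
            gcongr
        _ ≤ _ := by
            have : 0 ≤ pp i s x := by unfold pp; positivity
            linarith

lemma gain3 (i j : Fin m) {s : ℝ} (hs : 0 < s) (x : Delta m E) :
    GainLe j x (q3 i s) (√(x.1 j) * q3 i s x
      + if j = i then 4 * q4 i s x - √(x.1 j) * q3 i s x else 0) := by
  split_ifs with h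
  · subst h
    rw [add_sub_cancel]
    have ha := x.2.1 j
    have hy := tank_pos x
    have hra := Real.sqrt_pos.2 ha
    have hY : 0 < tank m E x + s ^ 2 := by positivity
    have hA : 0 < x.1 j + s ^ 2 := by positivity
    have hrA := Real.sqrt_pos.2 hA
    have hrrA := Real.sqrt_pos.2 hrA
    have hrY := Real.sqrt_pos.2 hY
    have hrrY := Real.sqrt_pos.2 hrY
    refine GainLe.of_bound (h := fun u => (s ^ 3 / (√(x.1 j + s ^ 2) * √√(x.1 j + s ^ 2)
        * √√(tank m E x + s ^ 2))) * (1 / (√(1 - u) * √√(1 - u)))) ?_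
      (lint_cm (by positivity) lint_r34.le) ?_
    · intro u hu
      rw [q3, Texch_same j hu]
      have h1 : 0 < 1 - u := sub_pos.2 hu.2
      have hw := Real.sqrt_pos.2 h1
      have hww := Real.sqrt_pos.2 hw
      rw [div_mul_div_comm, mul_one]
      set b := tank m E x + (1 - u ^ 2) * x.1 j + s ^ 2 with hb
      have hu2 : 0 < 1 - u ^ 2 := by nlinarith [hu.1, hu.2]
      have hb1 : tank m E x + s ^ 2 ≤ b := by nlinarith
      have hb2 : (x.1 j + s ^ 2) * (1 - u) ≤ b := by
        nlinarith [mul_pos ha (mul_pos hu.1 h1), mul_pos (pow_pos hs 2) hu.1]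
      have hb0 : 0 < b := by linarith
      have e1 : b = √b * √√b * √√b := by
        rw [mul_assoc, Real.mul_self_sqrt (Real.sqrt_nonneg _), Real.mul_self_sqrt hb0.le]
      gcongr
      rw [e1]
      calc _ = √((x.1 j + s ^ 2) * (1 - u)) * √√((x.1 j + s ^ 2) * (1 - u))
                * √√(tank m E x + s ^ 2) := by
            rw [Real.sqrt_mul hA.le, Real.sqrt_mul hrA.le]; ring
        _ ≤ _ := by gcongr
    · rw [q4]
      apply le_of_eq
      ring
  · refine GainLe.of_bound (h := fun u => q3 i s x) ?_ (lint_c _) (by simp)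
    intro u hu
    rw [q3, Texch_ne h, q3]

lemma lint_r12 : ∫⁻ u, ENNReal.ofReal (1 / √u) ∂unif01 ≤ ENNReal.ofReal 2 := by
  rw [unif01, lint_rsqrt 1 zero_le_one]; simp

lemma rr_sq {a : ℝ} (_ : 0 ≤ a) : √√a * √√a = √a := Real.mul_self_sqrt (Real.sqrt_nonneg _)

lemma sqrt_sq_mul {u x : ℝ} (hu : 0 ≤ u) : √√(u ^ 2 * x) = √u * √√x := by
  rw [Real.sqrt_mul (by positivity), Real.sqrt_sq hu, Real.sqrt_mul hu]

lemma gain4 (i j : Fin m) {s : ℝ} (hs : 0 < s) (x : Delta m E) :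
    GainLe j x (q4 i s) (2 * √√E * ww i s x + 12 * s ^ 3) := by
  have ha := x.2.1 i
  have hj := x.2.1 j
  have hy := tank_pos x
  have hrj := Real.sqrt_pos.2 hj
  have hrrj := Real.sqrt_pos.2 hrj
  have hri := Real.sqrt_pos.2 ha
  have hA : 0 < x.1 i + s ^ 2 := by positivity
  have hrA := Real.sqrt_pos.2 hA
  have hrrA := Real.sqrt_pos.2 hrA
  have hw0 : 0 ≤ ww i s x := by unfold ww; positivity
  by_cases h : j = i
  · subst h
    refine GainLe.of_bound (h := fun u => (2 * s ^ 3 / √(x.1 j)) *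
      (1 / √u + 1 / (√(1 - u) * √√(1 - u)))) (H := (2 * s ^ 3 / √(x.1 j)) * (2 + 4)) ?_
      (lint_cm (by positivity) (lint_ad (by fun_prop) (by norm_num) (by norm_num)
        lint_r12 lint_r34.le)) ?_
    · intro u hu
      rw [q4, tank_Texch j hu, Texch_same j hu]
      have hu0 := hu.1
      have hu1 : u < 1 := hu.2
      have h0 : 0 < 1 - u := sub_pos.2 hu.2
      have hw := Real.sqrt_pos.2 h0
      have hww := Real.sqrt_pos.2 hw
      have hru := Real.sqrt_pos.2 hu0
      have h1 : 0 < 1 - u ^ 2 := by nlinarith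
      set a' := tank m E x + (1 - u ^ 2) * x.1 j with ha'
      have ha'0 : 0 < a' := by positivity
      have ha'1 : x.1 j * (1 - u) ≤ a' + s ^ 2 := by
        nlinarith [mul_pos hj (mul_pos hu0 h0)]
      have h2 : √a' ≤ √(a' + s ^ 2) := Real.sqrt_le_sqrt (by nlinarith)
      have h3 : √√(x.1 j) * √√(1 - u) ≤ √√(a' + s ^ 2) := by
        rw [← Real.sqrt_mul hrj.le, ← Real.sqrt_mul hj.le]
        exact Real.sqrt_le_sqrt (Real.sqrt_le_sqrt ha'1)
      have h4 : √u * √√(x.1 j) ≤ √√(u ^ 2 * x.1 j + s ^ 2) := by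
        rw [← sqrt_sq_mul hu0.le]
        exact Real.sqrt_le_sqrt (Real.sqrt_le_sqrt (by nlinarith))
      have hAp : 0 < √(a' + s ^ 2) := Real.sqrt_pos.2 (by positivity)
      calc s ^ 3 * √a' / (√(a' + s ^ 2) * √√(a' + s ^ 2) * √√(u ^ 2 * x.1 j + s ^ 2))
          ≤ s ^ 3 * √(a' + s ^ 2) / (√(a' + s ^ 2) * (√√(x.1 j) * √√(1 - u))
              * (√u * √√(x.1 j))) := by gcongr
        _ = s ^ 3 / ((√√(x.1 j) * √√(x.1 j)) * (√√(1 - u) * √u)) := by field_simp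
        _ = s ^ 3 / √(x.1 j) * (1 / (√√(1 - u) * √u)) := by
            rw [rr_sq hj.le]; field_simp
        _ ≤ s ^ 3 / √(x.1 j) * (2 * (1 / √u + 1 / (√(1 - u) * √√(1 - u)))) := by
            gcongr
            rcases le_total u (1 / 2) with hh | hh
            · have h5 : 1 / 2 ≤ √√(1 - u) := by
                apply Real.le_sqrt_of_sq_le
                apply Real.le_sqrt_of_sq_le
                norm_num
                linarith
              have h6 : 1 / (√√(1 - u) * √u) ≤ 2 * (1 / √u) := by
                rw [mul_one_div, div_le_div_iff₀ (by positivity) hru]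
                nlinarith
              have : 0 ≤ 1 / (√(1 - u) * √√(1 - u)) := by positivity
              linarith
            · have h5 : 1 / 2 ≤ √u := by
                apply Real.le_sqrt_of_sq_le
                norm_num
                linarith
              have h7 : √(1 - u) ≤ 1 := Real.sqrt_le_one.2 (by linarith)
              have h6 : 1 / (√√(1 - u) * √u) ≤ 2 * (1 / (√(1 - u) * √√(1 - u))) := by
                rw [mul_one_div, div_le_div_iff₀ (by positivity) (by positivity)]
                nlinarith
              have : 0 ≤ 1 / √u := by positivity
              linarith
        _ = _ := by ring
    · have : √(x.1 j) * (2 * s ^ 3 / √(x.1 j) * (2 + 4)) = 12 * s ^ 3 := by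
        field_simp; norm_num
      rw [this]
      exact le_add_of_nonneg_left (by positivity)
  · refine GainLe.of_bound (h := fun u => (ww i s x / √√(x.1 j)) * (1 / √u)) ?_
      (lint_cm (by positivity) lint_r12) ?_
    · intro u hu
      have hu0 := hu.1
      have hru := Real.sqrt_pos.2 hu0
      have h4 : √u * √√(x.1 j) ≤ √√(u ^ 2 * x.1 j + s ^ 2) := by
        rw [← sqrt_sq_mul hu0.le]
        exact Real.sqrt_le_sqrt (Real.sqrt_le_sqrt (by nlinarith))
      rw [q4, tank_Texch j hu, Texch_ne h, ww]
      calc _ ≤ s ^ 3 * √(x.1 i) / (√(x.1 i + s ^ 2) * √√(x.1 i + s ^ 2) * (√u * √√(x.1 j))) := by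
            gcongr
        _ = _ := by field_simp
    · have h5 : √(x.1 j) * (ww i s x / √√(x.1 j) * 2) = 2 * √√(x.1 j) * ww i s x := by
        nth_rewrite 1 [← rr_sq hj.le]
        field_simp
      rw [h5]
      have h6 : √√(x.1 j) ≤ √√E := Real.sqrt_le_sqrt (Real.sqrt_le_sqrt (x_lt x j).le)
      have : 2 * √√(x.1 j) * ww i s x ≤ 2 * √√E * ww i s x := by gcongr
      have : 0 ≤ 12 * s ^ 3 := by positivity
      linarith


lemma loss2 (hE : 0 < E) (i : Fin m) {s : ℝ} (hs : 0 < s) (hs1 : s ≤ 1) (x : Delta m E) :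
    √(E / 2) * q2 i s x ≤ jumpRate m E x * q2 i s x + √(E / 2) * (2 / E) * pp i s x := by
  have ha := x.2.1 i
  have hy := tank_pos x
  have hA : 0 < x.1 i + s ^ 2 := by positivity
  have hY : 0 < tank m E x + s ^ 2 := by positivity
  have hq : 0 ≤ q2 i s x := by unfold q2; positivity
  have hp : 0 ≤ pp i s x := by unfold pp; positivity
  rcases le_total (tank m E x) (E / 2) with h | h
  · have h1 : √(E / 2) ≤ jumpRate m E x :=
      (Real.sqrt_le_sqrt (by linarith)).trans (le_jumpRate x)
    have h2 : 0 ≤ √(E / 2) * (2 / E) * pp i s x := by positivity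
    have := mul_le_mul_of_nonneg_right h1 hq
    linarith
  · have h1 : q2 i s x ≤ 2 / E * pp i s x := by
      have e : q2 i s x = s / (tank m E x + s ^ 2) * pp i s x := by
        unfold q2 pp; field_simp
      rw [e]
      gcongr ?_ * _
      rw [div_le_div_iff₀ hY hE]
      nlinarith [sq_nonneg s]
    have h2 := mul_nonneg (jumpRate_nonneg x) hq
    have := mul_le_mul_of_nonneg_left h1 (Real.sqrt_nonneg (E / 2))
    linarith

lemma loss4 (hE : 0 < E) (i : Fin m) {s : ℝ} (hs : 0 < s) (x : Delta m E) :
    √(E / 2) * q4 i s x ≤ jumpRate m E x * q4 i s x + √(E / 2) / √√(E / 2) * ww i s x := by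
  have ha := x.2.1 i
  have hy := tank_pos x
  have hA : 0 < x.1 i + s ^ 2 := by positivity
  have hY : 0 < tank m E x + s ^ 2 := by positivity
  have hq : 0 ≤ q4 i s x := by unfold q4; positivity
  have hp : 0 ≤ ww i s x := by unfold ww; positivity
  rcases le_total (tank m E x) (E / 2) with h | h
  · have h1 : √(E / 2) ≤ jumpRate m E x :=
      (Real.sqrt_le_sqrt (by linarith)).trans (le_jumpRate x)
    have h2 : 0 ≤ √(E / 2) / √√(E / 2) * ww i s x := by positivity
    have := mul_le_mul_of_nonneg_right h1 hq
    linarith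
  · have h1 : q4 i s x ≤ 1 / √√(E / 2) * ww i s x := by
      have e : q4 i s x = 1 / √√(tank m E x + s ^ 2) * ww i s x := by
        unfold q4 ww; field_simp
      rw [e]
      have : √√(E / 2) ≤ √√(tank m E x + s ^ 2) :=
        Real.sqrt_le_sqrt (Real.sqrt_le_sqrt (by nlinarith))
      have h0 : 0 < √√(E / 2) := by positivity
      gcongr
    have h2 := mul_nonneg (jumpRate_nonneg x) hq
    have := mul_le_mul_of_nonneg_left h1 (Real.sqrt_nonneg (E / 2))
    have e : √(E / 2) / √√(E / 2) * ww i s x = √(E / 2) * (1 / √√(E / 2) * ww i s x) := by ring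
    linarith

lemma young (i : Fin m) {s : ℝ} (hs : 0 < s) (x : Delta m E) {β θ : ℝ}
    (hβ : 0 < β) (hθ : 0 < θ) :
    β * ww i s x ≤ θ * pp i s x + β * (β / θ) ^ 3 * √E * s ^ 3 := by
  have ha := x.2.1 i
  have hA : 0 < x.1 i + s ^ 2 := by positivity
  have hrA := Real.sqrt_pos.2 hA
  have hrrA := Real.sqrt_pos.2 hrA
  set r := √√(x.1 i + s ^ 2) with hr
  have e1 : √(x.1 i + s ^ 2) = r ^ 2 := by rw [hr, Real.sq_sqrt hrA.le]
  have e2 : x.1 i + s ^ 2 = r ^ 4 := by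
    rw [show r ^ 4 = (r ^ 2) ^ 2 by ring, ← e1, Real.sq_sqrt hA.le]
  set z := 1 / r with hz
  have hz0 : 0 < z := by positivity
  have hw : ww i s x = s ^ 3 * √(x.1 i) * z ^ 3 := by
    rw [ww, ← hr, e1, hz]; field_simp
  have hp : pp i s x = s ^ 3 * √(x.1 i) * z ^ 4 := by
    rw [pp, e2, hz]; field_simp
  have key : β * z ^ 3 ≤ θ * z ^ 4 + β * (β / θ) ^ 3 := by
    rcases le_total z (β / θ) with h | h
    · have : β * z ^ 3 ≤ β * (β / θ) ^ 3 := by gcongr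
      have : 0 ≤ θ * z ^ 4 := by positivity
      linarith
    · have h1 : β ≤ θ * z := by rwa [div_le_iff₀' hθ] at h
      have : β * z ^ 3 ≤ (θ * z) * z ^ 3 := by gcongr
      have h2 : 0 ≤ β * (β / θ) ^ 3 := by positivity
      nlinarith
  have hsq : √(x.1 i) ≤ √E := Real.sqrt_le_sqrt (x_lt x i).le
  rw [hw, hp]
  calc β * (s ^ 3 * √(x.1 i) * z ^ 3) = s ^ 3 * √(x.1 i) * (β * z ^ 3) := by ring
    _ ≤ s ^ 3 * √(x.1 i) * (θ * z ^ 4 + β * (β / θ) ^ 3) := by gcongr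
    _ = θ * (s ^ 3 * √(x.1 i) * z ^ 4) + β * (β / θ) ^ 3 * √(x.1 i) * s ^ 3 := by ring
    _ ≤ _ := by gcongr

noncomputable def FF (C2 C3 C4 : ℝ) (i : Fin m) (s : ℝ) (x : Delta m E) : ℝ :=
  q1 i s x + (C2 * q2 i s x + (C3 * q3 i s x + C4 * q4 i s x))

lemma q1_nonneg (i : Fin m) (s : ℝ) (x : Delta m E) : 0 ≤ q1 i s x := by
  unfold q1; split_ifs <;> norm_num
lemma q2_nonneg (i : Fin m) {s : ℝ} (hs : 0 < s) (x : Delta m E) : 0 ≤ q2 i s x := by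
  have := x.2.1 i
  have hy := tank_pos x
  unfold q2; positivity
lemma q3_nonneg (i : Fin m) {s : ℝ} (hs : 0 < s) (x : Delta m E) : 0 ≤ q3 i s x := by
  have := x.2.1 i
  unfold q3; positivity
lemma q4_nonneg (i : Fin m) {s : ℝ} (hs : 0 < s) (x : Delta m E) : 0 ≤ q4 i s x := by
  unfold q4; positivity

lemma meas_FF (C2 C3 C4 : ℝ) (i : Fin m) (s : ℝ) : Measurable (FF (E := E) C2 C3 C4 i s) :=
  (meas_q1 i s).add (((meas_q2 i s).const_mul _).add
    (((meas_q3 i s).const_mul _).add ((meas_q4 i s).const_mul _)))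

lemma drift (hm : 1 ≤ m) (hE : 0 < E) (i : Fin m) :
    ∃ C2 C3 C4 C : ℝ, 0 < C2 ∧ 0 < C3 ∧ 0 < C4 ∧ 0 < C ∧ ∀ s : ℝ, 0 < s → s ≤ 1 →
      ∀ x : Delta m E, ∫⁻ z, ENNReal.ofReal (FF C2 C3 C4 i s z) ∂(ustep m E x)
        ≤ ENNReal.ofReal (FF C2 C3 C4 i s x + C * s ^ 3 / Lam m E) := by
  have hL := Lam_pos hm hE
  have hm0 : (0:ℝ) < m := by exact_mod_cast hm
  obtain ⟨r0, hr0⟩ : ∃ r0, r0 = √(E / 2) := ⟨_, rfl⟩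
  have hr : 0 < r0 := by rw [hr0]; positivity
  obtain ⟨α, hα⟩ : ∃ α, α = 5 * m + r0 * (2 / E) := ⟨_, rfl⟩
  have hα0 : 0 < α := by rw [hα]; positivity
  obtain ⟨β, hβ⟩ : ∃ β, β = 2 * m * √√E + r0 / √r0 := ⟨_, rfl⟩
  have hβ0 : 0 < β := by rw [hβ]; positivity
  obtain ⟨K, hK⟩ : ∃ K, K = β * (β / (r0 / 8)) ^ 3 * √E := ⟨_, rfl⟩
  have hK0 : 0 < K := by rw [hK]; positivity
  obtain ⟨C2, hC2⟩ : ∃ C2, C2 = 4 / r0 := ⟨_, rfl⟩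
  obtain ⟨C3, hC3⟩ : ∃ C3, C3 = 2 * C2 * α := ⟨_, rfl⟩
  obtain ⟨C4, hC4⟩ : ∃ C4, C4 = 4 * C3 / r0 := ⟨_, rfl⟩
  have h2 : 0 < C2 := by rw [hC2]; positivity
  have h3 : 0 < C3 := by rw [hC3]; positivity
  have h4 : 0 < C4 := by rw [hC4]; positivity
  refine ⟨C2, C3, C4, C4 * (K + 12 * m), h2, h3, h4, by positivity, fun s hs hs1 x => ?_⟩
  have n1 := q1_nonneg (E := E) i s x
  have n2 := q2_nonneg (E := E) i hs x
  have n3 := q3_nonneg (E := E) i hs x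
  have n4 := q4_nonneg (E := E) i hs x
  have hai := x.2.1 i
  have np : 0 ≤ pp i s x := by unfold pp; positivity
  have nw : 0 ≤ ww i s x := by unfold ww; positivity
  have g3n : ∀ j : Fin m, 0 ≤ √(x.1 j) * q3 i s x
      + if j = i then 4 * q4 i s x - √(x.1 j) * q3 i s x else 0 := by
    intro j
    split_ifs
    · rw [add_sub_cancel]; positivity
    · positivity
  have g1n : ∀ j : Fin m, 0 ≤ √(x.1 j) * q1 i s x + if j = i then 4 * q2 i s x else 0 := by
    intro j
    split_ifs <;> positivity
  have main := ustep_le hm hE (meas_FF C2 C3 C4 i s)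
    (fun z => by
      have n1 := q1_nonneg (E := E) i s z
      have n2 := q2_nonneg (E := E) i hs z
      have n3 := q3_nonneg (E := E) i hs z
      have n4 := q4_nonneg (E := E) i hs z
      unfold FF; positivity) x
    (fun j => (√(x.1 j) * q1 i s x + if j = i then 4 * q2 i s x else 0)
      + (C2 * (5 * pp i s x) + (C3 * (√(x.1 j) * q3 i s x
      + if j = i then 4 * q4 i s x - √(x.1 j) * q3 i s x else 0)
      + C4 * (2 * √√E * ww i s x + 12 * s ^ 3))))
    (fun j => add_nonneg (g1n j) (add_nonneg (by positivity)
      (add_nonneg (mul_nonneg h3.le (g3n j)) (by positivity))))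
    (fun j => (gain1 i j hs x).add
      (((gain2 i j hs x).const_mul h2.le (meas_q2 i s)).add
        (((gain3 i j hs x).const_mul h3.le (meas_q3 i s)).add
          ((gain4 i j hs x).const_mul h4.le (meas_q4 i s)) ((meas_q3 i s).const_mul _)
            (mul_nonneg h3.le (g3n j)) (by positivity))
        ((meas_q2 i s).const_mul _) (by positivity)
          (add_nonneg (mul_nonneg h3.le (g3n j)) (by positivity)))
      (meas_q1 i s) (g1n j) (add_nonneg (by positivity)
      (add_nonneg (mul_nonneg h3.le (g3n j)) (by positivity))))
  refine main.trans (ENNReal.ofReal_le_ofReal ?_)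
  gcongr
  have hpq : √(x.1 i) * q3 i s x = pp i s x := by unfold q3 pp; ring
  have hsum : ∑ j, ((√(x.1 j) * q1 i s x + if j = i then 4 * q2 i s x else 0)
      + (C2 * (5 * pp i s x) + (C3 * (√(x.1 j) * q3 i s x
      + if j = i then 4 * q4 i s x - √(x.1 j) * q3 i s x else 0)
      + C4 * (2 * √√E * ww i s x + 12 * s ^ 3))))
      = jumpRate m E x * q1 i s x + 4 * q2 i s x + m * (C2 * (5 * pp i s x))
        + C3 * (jumpRate m E x * q3 i s x + (4 * q4 i s x - pp i s x))
        + m * (C4 * (2 * √√E * ww i s x + 12 * s ^ 3)) := by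
    simp only [Finset.sum_add_distrib, ← Finset.mul_sum, ← Finset.sum_mul, Finset.sum_const,
      Finset.card_univ, Fintype.card_fin, nsmul_eq_mul, Finset.sum_ite_eq', Finset.mem_univ,
      if_true, hpq, jumpRate]
    ring
  rw [hsum, FF]
  have l2 := loss2 hE i hs hs1 x
  have l4 := loss4 hE i hs x
  have ly := young i hs x hβ0 (θ := r0 / 8) (by positivity)
  rw [← hK] at ly
  rw [← hr0] at l2 l4
  have e2 : C2 * r0 = 4 := by rw [hC2]; field_simp
  have e4 : C4 * r0 = 4 * C3 := by rw [hC4]; field_simp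
  have m2 := mul_le_mul_of_nonneg_left l2 h2.le
  have m4 := mul_le_mul_of_nonneg_left l4 h4.le
  have my := mul_le_mul_of_nonneg_left ly h4.le
  have k2 : C2 * (r0 * q2 i s x) = 4 * q2 i s x := by rw [← mul_assoc, e2]
  have k4 : C4 * (r0 * q4 i s x) = 4 * C3 * q4 i s x := by rw [← mul_assoc, e4]
  have kp : C4 * (r0 / 8 * pp i s x) = C3 / 2 * pp i s x := by
    linear_combination (pp i s x / 8) * e4
  have ka : C2 * (r0 * (2 / E) * pp i s x) = C3 / 2 * pp i s x - 5 * m * C2 * pp i s x := by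
    rw [hC3, hα]; ring
  have kb : C4 * (r0 / √r0 * ww i s x) = C4 * (β * ww i s x) - C4 * (2 * m * √√E * ww i s x) := by
    rw [hβ]; ring
  rw [mul_add, k2, ka] at m2
  rw [mul_add, k4, kb] at m4
  rw [mul_add, kp] at my
  linarith


lemma ustep_univ_le (hm : 1 ≤ m) (hE : 0 < E) (x : Delta m E) : ustep m E x univ ≤ 1 := by
  have h := ustep_le hm hE (f := fun _ => 1) measurable_const (fun _ => zero_le_one) x
    (fun j => √(x.1 j)) (fun j => Real.sqrt_nonneg _) (fun j => by simp [GainLe])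
  simpa [jumpRate] using h

lemma iter_le (hm : 1 ≤ m) (hE : 0 < E) {F : Delta m E → ENNReal} (hF : Measurable F)
    (c : ENNReal) (h : ∀ x, ∫⁻ z, F z ∂(ustep m E x) ≤ F x + c) (n : ℕ) :
    ∀ x, ∫⁻ z, F z ∂(ustepIter m E n x) ≤ F x + n * c := by
  induction n with
  | zero => intro x; simp [ustepIter, lintegral_dirac' _ hF]
  | succ n ih =>
    intro x
    rw [lint_ustepIter_succ n x hF]
    calc _ ≤ ∫⁻ z, (F z + n * c) ∂(ustep m E x) := lintegral_mono ih
      _ = ∫⁻ z, F z ∂(ustep m E x) + n * c * ustep m E x univ := by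
          rw [lintegral_add_left hF, lintegral_const]
      _ ≤ (F x + c) + n * c * 1 := by
          gcongr
          · exact h x
          · exact ustep_univ_le hm hE x
      _ = _ := by push_cast; ring

lemma poisson_sum {l : ℝ} (hl : 0 ≤ l) :
    ∑' n : ℕ, ENNReal.ofReal (Real.exp (-l) * l ^ n / n.factorial) = 1 := by
  have h : HasSum (fun n : ℕ => Real.exp (-l) * l ^ n / n.factorial) 1 := by
    have := (NormedSpace.expSeries_div_hasSum_exp l).mul_left (Real.exp (-l))
    rw [← Real.exp_eq_exp_ℝ, ← Real.exp_add, neg_add_cancel, Real.exp_zero] at this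
    simpa [mul_div_assoc] using this
  rw [← ENNReal.ofReal_tsum_of_nonneg (fun n => by positivity) h.summable, h.tsum_eq]
  simp

lemma poisson_mean {l : ℝ} (hl : 0 ≤ l) :
    ∑' n : ℕ, ENNReal.ofReal (Real.exp (-l) * l ^ n / n.factorial) * n = ENNReal.ofReal l := by
  rw [tsum_eq_zero_add' ENNReal.summable]
  have : ∀ n : ℕ, ENNReal.ofReal (Real.exp (-l) * l ^ (n+1) / (n+1).factorial) * ((n + 1 : ℕ) : ENNReal)
      = ENNReal.ofReal l * ENNReal.ofReal (Real.exp (-l) * l ^ n / n.factorial) := by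
    intro n
    rw [← ENNReal.ofReal_natCast, ← ENNReal.ofReal_mul (by positivity), ← ENNReal.ofReal_mul hl]
    congr 1
    rw [Nat.factorial_succ]
    push_cast
    field_simp
    ring
  simp only [this, ENNReal.tsum_mul_left, poisson_sum hl]
  simp

lemma poisson_pgf {l r : ℝ} (hl : 0 ≤ l) (hr : 0 ≤ r) :
    ∑' n : ℕ, ENNReal.ofReal (Real.exp (-l) * l ^ n / n.factorial) * ENNReal.ofReal (r ^ n)
      = ENNReal.ofReal (Real.exp (l * r - l)) := by
  have h : HasSum (fun n : ℕ => Real.exp (-l) * l ^ n / n.factorial * r ^ n)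
      (Real.exp (l * r - l)) := by
    have := (NormedSpace.expSeries_div_hasSum_exp (l * r)).mul_left (Real.exp (-l))
    rw [← Real.exp_eq_exp_ℝ, ← Real.exp_add, neg_add_eq_sub] at this
    have e : (fun n : ℕ => Real.exp (-l) * l ^ n / n.factorial * r ^ n)
        = fun n : ℕ => Real.exp (-l) * ((l * r) ^ n / n.factorial) := by
      funext n
      rw [mul_pow]; ring
    rw [e]
    exact this
  rw [← h.tsum_eq, ENNReal.ofReal_tsum_of_nonneg (fun n => by positivity) h.summable]
  congr 1
  funext n
  rw [ENNReal.ofReal_mul (by positivity)]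

lemma Pt_le (hm : 1 ≤ m) (hE : 0 < E) {F : Delta m E → ENNReal} (hF : Measurable F)
    (c : ENNReal) (h : ∀ x, ∫⁻ z, F z ∂(ustep m E x) ≤ F x + c) {t : ℝ} (ht : 0 ≤ t)
    (x : Delta m E) :
    ∫⁻ z, F z ∂(Pt m E t x) ≤ F x + ENNReal.ofReal (Lam m E * t) * c := by
  have hl : 0 ≤ Lam m E * t := mul_nonneg (Lam_pos hm hE).le ht
  rw [lint_Pt]
  simp only [neg_mul]
  calc _ ≤ ∑' n : ℕ, ENNReal.ofReal
        (Real.exp (-(Lam m E * t)) * (Lam m E * t) ^ n / n.factorial) * (F x + n * c) := by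
        gcongr with n
        exact iter_le hm hE hF c h n x
    _ = _ := by
      simp only [mul_add, ← mul_assoc]
      rw [ENNReal.tsum_add, ENNReal.tsum_mul_right, ENNReal.tsum_mul_right, poisson_sum hl,
        poisson_mean hl, one_mul]

lemma Pt_univ_le (hm : 1 ≤ m) (hE : 0 < E) {t : ℝ} (ht : 0 ≤ t) (x : Delta m E) :
    Pt m E t x univ ≤ 1 := by
  have := Pt_le hm hE (F := fun _ => 1) measurable_const 0
    (fun x => by simpa using ustep_univ_le hm hE x) ht x
  simpa using this

lemma measB (i : Fin m) (s : ℝ) : MeasurableSet {x : Delta m E | x.1 i < s} :=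
  measurableSet_lt (meas_coord i) measurable_const

lemma ustep_ge (hm : 1 ≤ m) (hE : 0 < E) (i : Fin m) {s : ℝ} (hs : 0 < s)
    (x : Delta m E) (hx : x.1 i < s ^ 2) :
    ENNReal.ofReal (1 - s / Lam m E) ≤ ustep m E x {x : Delta m E | x.1 i < s ^ 2} := by
  have hL := Lam_pos hm hE
  set B := {x : Delta m E | x.1 i < s ^ 2} with hB
  have hBm : MeasurableSet B := measB i _
  rw [← lintegral_indicator_one hBm, lint_ustep x (measurable_one.indicator hBm)]
  have hxB : B.indicator (1 : Delta m E → ENNReal) x = 1 :=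
    indicator_of_mem (show x ∈ B from hx) _
  have h1 : 0 ≤ 1 - jumpRate m E x / Lam m E := by
    rw [sub_nonneg, div_le_one hL]; exact jumpRate_le x
  have hai : √(x.1 i) ≤ s := (Real.sqrt_le_left hs.le).2 hx.le
  have hsum : ∑ j, (if j = i then 0 else √(x.1 j)) = jumpRate m E x - √(x.1 i) := by
    rw [jumpRate, eq_sub_iff_add_eq, ← Finset.sum_erase_add _ _ (Finset.mem_univ i),
      ← Finset.sum_erase_add (a := i) (f := fun j => √(x.1 j)) _ (Finset.mem_univ i)]
    simp only [if_true, add_zero]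
    congr 1
    exact Finset.sum_congr rfl fun j hj => if_neg (Finset.ne_of_mem_erase hj)
  calc ENNReal.ofReal (1 - s / Lam m E)
      ≤ ENNReal.ofReal ((1 - jumpRate m E x / Lam m E)
        + (Lam m E)⁻¹ * ∑ j, (if j = i then 0 else √(x.1 j))) := by
        apply ENNReal.ofReal_le_ofReal
        rw [hsum]
        have : (1 - jumpRate m E x / Lam m E) + (Lam m E)⁻¹ * (jumpRate m E x - √(x.1 i))
          = 1 - √(x.1 i) / Lam m E := by field_simp; ring
        rw [this]
        gcongr
    _ = ENNReal.ofReal (1 - jumpRate m E x / Lam m E) * 1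
      + (ENNReal.ofReal (Lam m E))⁻¹ * ∑ j, ENNReal.ofReal (if j = i then 0 else √(x.1 j)) := by
        have h0 : ∀ j ∈ Finset.univ, 0 ≤ (if j = i then 0 else √(x.1 j)) := by
          intro j _; split_ifs <;> positivity
        rw [ENNReal.ofReal_add h1 (mul_nonneg (by positivity) (Finset.sum_nonneg h0)),
          ENNReal.ofReal_mul (by positivity),
          ENNReal.ofReal_inv_of_pos hL, ENNReal.ofReal_sum_of_nonneg h0, mul_one]
    _ ≤ _ := by
        rw [hxB]
        gcongr with j
        split_ifs with h
        · simp
        · have : ∀ u, B.indicator (1 : Delta m E → ENNReal) (Texch m E j u x) = 1 := by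
            intro u
            apply indicator_of_mem
            change (Texch m E j u x).1 i < s ^ 2
            rw [Texch_ne h]
            exact hx
          simp [this]

lemma iter_ge (hm : 1 ≤ m) (hE : 0 < E) (i : Fin m) {s : ℝ} (hs : 0 < s) (hsL : s ≤ Lam m E)
    (n : ℕ) : ∀ x : Delta m E, x.1 i < s ^ 2 →
    ENNReal.ofReal ((1 - s / Lam m E) ^ n) ≤ ustepIter m E n x {x : Delta m E | x.1 i < s ^ 2} := by
  have hL := Lam_pos hm hE
  have hr : 0 ≤ 1 - s / Lam m E := by
    rw [sub_nonneg, div_le_one hL]; exact hsL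
  have hBm : MeasurableSet {x : Delta m E | x.1 i < s ^ 2} := measB i _
  induction n with
  | zero =>
    intro x hx
    rw [ustepIter, Measure.dirac_apply' _ hBm]
    simp [hx]
  | succ n ih =>
    intro x hx
    rw [← lintegral_indicator_one hBm, lint_ustepIter_succ n x (measurable_one.indicator hBm)]
    simp only [lintegral_indicator_one hBm]
    calc ENNReal.ofReal ((1 - s / Lam m E) ^ (n+1))
        = ENNReal.ofReal ((1 - s / Lam m E) ^ n) * ENNReal.ofReal (1 - s / Lam m E) := by
          rw [pow_succ, ENNReal.ofReal_mul (by positivity)]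
      _ ≤ ENNReal.ofReal ((1 - s / Lam m E) ^ n) * ustep m E x {x : Delta m E | x.1 i < s ^ 2} := by
          gcongr
          exact ustep_ge hm hE i hs x hx
      _ = ∫⁻ z in {x : Delta m E | x.1 i < s ^ 2}, ENNReal.ofReal ((1 - s / Lam m E) ^ n)
            ∂(ustep m E x) := by rw [setLIntegral_const]
      _ ≤ ∫⁻ z in {x : Delta m E | x.1 i < s ^ 2},
            ustepIter m E n z {x : Delta m E | x.1 i < s ^ 2} ∂(ustep m E x) :=
          setLIntegral_mono' hBm ih
      _ ≤ _ := setLIntegral_le_lintegral _ _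

lemma Pt_ge (hm : 1 ≤ m) (hE : 0 < E) (i : Fin m) {s : ℝ} (hs : 0 < s) (hsL : s ≤ Lam m E)
    {t : ℝ} (ht : 0 ≤ t) (x : Delta m E) (hx : x.1 i < s ^ 2) :
    ENNReal.ofReal (Real.exp (-(s * t))) ≤ Pt m E t x {x : Delta m E | x.1 i < s ^ 2} := by
  have hL := Lam_pos hm hE
  have hl : 0 ≤ Lam m E * t := mul_nonneg hL.le ht
  have hr : 0 ≤ 1 - s / Lam m E := by
    rw [sub_nonneg, div_le_one hL]; exact hsL
  have hBm : MeasurableSet {x : Delta m E | x.1 i < s ^ 2} := measB i _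
  have e : -(s * t) = Lam m E * t * (1 - s / Lam m E) - Lam m E * t := by field_simp; ring
  rw [e, ← poisson_pgf hl hr, ← lintegral_indicator_one hBm, lint_Pt]
  simp only [neg_mul, lintegral_indicator_one hBm]
  gcongr with n
  exact iter_ge hm hE i hs hsL n x hx


lemma meas_simU : MeasurableSet (simU m E) := by
  have : simU m E = (⋂ j, {x | 0 < x j}) ∩ {x | ∑ j, x j < E} := by
    ext x; simp [simU]
  rw [this]
  refine (MeasurableSet.iInter fun j => measurableSet_lt measurable_const (by fun_prop)).inter
    (measurableSet_lt (by fun_prop) measurable_const)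

lemma beta_le (s : ℝ) :
    ∫⁻ a in Ioo 0 s, ENNReal.ofReal (1 / √a * (1 / √(s - a))) ≤ ENNReal.ofReal 8 := by
  rcases le_or_gt s 0 with h | hs
  · simp [Ioo_eq_empty (not_lt.2 h)]
  have hrs := Real.sqrt_pos.2 hs
  calc _ ≤ ∫⁻ a in Ioo 0 s, (ENNReal.ofReal (2 / √s) * (ENNReal.ofReal (1 / √a)
          + ENNReal.ofReal (1 / √(s - a)))) := by
        refine setLIntegral_mono' measurableSet_Ioo fun a ha => ?_
        have h1 : 0 < a := ha.1
        have h2 : 0 < s - a := sub_pos.2 ha.2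
        have r1 := Real.sqrt_pos.2 h1
        have r2 := Real.sqrt_pos.2 h2
        rw [← ENNReal.ofReal_add (by positivity) (by positivity),
          ← ENNReal.ofReal_mul (by positivity)]
        apply ENNReal.ofReal_le_ofReal
        have h3 : √s ≤ √a + √(s - a) := by
          rw [Real.sqrt_le_left (by positivity), add_sq, Real.sq_sqrt h1.le, Real.sq_sqrt h2.le]
          nlinarith
        have e : 2 / √s * (1 / √a + 1 / √(s - a))
            = 2 * (√a + √(s - a)) / √s * (1 / √a * (1 / √(s - a))) := by field_simp; ring
        rw [e]
        apply le_mul_of_one_le_left (by positivity)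
        rw [one_le_div hrs]
        linarith
    _ = ENNReal.ofReal (2 / √s) * (ENNReal.ofReal (2 * √s) + ENNReal.ofReal (2 * √s)) := by
        rw [lintegral_const_mul' _ _ ENNReal.ofReal_ne_top, lintegral_add_left (by fun_prop),
          lint_rsqrt s hs.le, lint_rsqrt' s hs.le]
    _ = _ := by
        rw [← ENNReal.ofReal_add (by positivity) (by positivity),
          ← ENNReal.ofReal_mul (by positivity)]
        congr 1
        field_simp
        norm_num

lemma int_simU (i : Fin m) :
    ∫⁻ x in simU m E, ENNReal.ofReal (1 / √(x i) * (1 / √(E - ∑ j, x j))) < ⊤ := by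
  obtain _ | n := m
  · exact i.elim0
  let S : Set (Fin n → ℝ) := Set.pi univ fun _ => Ioo 0 E
  have hS : MeasurableSet S := MeasurableSet.univ_pi fun _ => measurableSet_Ioo
  let G : ℝ × (Fin n → ℝ) → ENNReal := fun p =>
    S.indicator 1 p.2 * (if 0 < p.1 ∧ p.1 < E - ∑ j, p.2 j then
      ENNReal.ofReal (1 / √p.1 * (1 / √((E - ∑ j, p.2 j) - p.1))) else 0)
  have hG : Measurable G := by
    refine Measurable.mul ((measurable_one.indicator hS).comp measurable_snd) ?_
    refine Measurable.ite ?_ (by fun_prop) measurable_const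
    exact (measurableSet_lt measurable_const measurable_fst).inter
      (measurableSet_lt measurable_fst (by fun_prop))
  have hp := volume_preserving_piFinSuccAbove (fun _ : Fin (n+1) => ℝ) i
  calc _ ≤ ∫⁻ x : Fin (n+1) → ℝ, G (MeasurableEquiv.piFinSuccAbove (fun _ => ℝ) i x) := by
        rw [← lintegral_indicator meas_simU]
        refine lintegral_mono fun x => ?_
        by_cases hx : x ∈ simU (n+1) E
        swap
        · rw [indicator_of_notMem hx]
          exact bot_le
        rw [indicator_of_mem hx]
        have hsum : ∑ j, x j = x i + ∑ j, x (i.succAbove j) := Fin.sum_univ_succAbove _ i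
        have hz : (fun j => x (i.succAbove j)) ∈ S := by
          intro j _
          refine ⟨hx.1 _, ?_⟩
          exact x_lt (⟨x, hx⟩ : Delta (n+1) E) _
        have h2 : 0 < x i ∧ x i < E - ∑ j, x (i.succAbove j) := by
          refine ⟨hx.1 i, ?_⟩
          have := hx.2
          rw [hsum] at this
          linarith
        have e : MeasurableEquiv.piFinSuccAbove (fun _ => ℝ) i x
          = (x i, fun j => x (i.succAbove j)) := rfl
        rw [e]
        simp only [G]
        rw [indicator_of_mem hz, if_pos h2, Pi.one_apply, one_mul, hsum, sub_add_eq_sub_sub_swap]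
    _ = ∫⁻ p, G p ∂((volume : Measure ℝ).prod (volume : Measure (Fin n → ℝ))) :=
        hp.lintegral_comp hG
    _ = ∫⁻ z, ∫⁻ a, G (a, z) := lintegral_prod_symm' _ hG
    _ ≤ ∫⁻ z : Fin n → ℝ, S.indicator (fun _ => ENNReal.ofReal 8) z := by
        refine lintegral_mono fun z => ?_
        by_cases hz : z ∈ S
        · rw [indicator_of_mem hz]
          refine le_trans ?_ (beta_le (E - ∑ j, z j))
          rw [← lintegral_indicator measurableSet_Ioo]
          refine lintegral_mono fun a => ?_
          simp only [G]
          rw [indicator_of_mem hz, Pi.one_apply, one_mul]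
          by_cases ha : a ∈ Ioo 0 (E - ∑ j, z j)
          · rw [indicator_of_mem ha, if_pos ⟨ha.1, ha.2⟩]
          · rw [if_neg (fun h => ha ⟨h.1, h.2⟩)]
            exact bot_le
        · simp [G, hz]
    _ < ⊤ := by
        rw [lintegral_indicator hS, setLIntegral_const]
        refine ENNReal.mul_lt_top ENNReal.ofReal_lt_top ?_
        simp only [S]
        rw [Real.volume_pi_Ioo]
        exact ENNReal.prod_lt_top fun _ _ => ENNReal.ofReal_lt_top

lemma rpow_tank (x : Delta m E) : (tank m E x) ^ (-(1/2) : ℝ) = 1 / √(tank m E x) := by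
  rw [Real.rpow_neg (tank_pos x).le, ← Real.sqrt_eq_rpow, one_div]

lemma piPre_int (i : Fin m) :
    ∫⁻ x, ENNReal.ofReal (1 / √(x.1 i)) ∂(piPre m E) < ⊤ := by
  have h1 := meas_coord (E := E) i
  have h2 := meas_tank (m := m) (E := E)
  have h3 : Measurable fun x : Delta m E => ENNReal.ofReal (1 / √(x.1 i)) :=
    (measurable_const.div h1.sqrt).ennreal_ofReal
  rw [piPre, lintegral_withDensity_eq_lintegral_mul _ (h2.pow_const _).ennreal_ofReal h3]
  simp only [Pi.mul_apply, rpow_tank]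
  have e : ∀ x : Delta m E, ENNReal.ofReal (1 / √(tank m E x)) * ENNReal.ofReal (1 / √(x.1 i))
      = (fun x : Fin m → ℝ => ENNReal.ofReal (1 / √(x i) * (1 / √(E - ∑ j, x j)))) x.1 := by
    intro x
    rw [← ENNReal.ofReal_mul (by positivity), mul_comm]
    rfl
  simp only [e]
  rw [lebU, lintegral_subtype_comap meas_simU
    (fun x : Fin m → ℝ => ENNReal.ofReal (1 / √(x i) * (1 / √(E - ∑ j, x j))))]
  exact int_simU i

lemma piPre_lower (hm : 1 ≤ m) (hE : 0 < E) (i : Fin m) :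
    ∃ k > 0, ∃ e0 > 0, ∀ e : ℝ, 0 < e → e ≤ e0 →
      ENNReal.ofReal (k * e) ≤ piPre m E {x : Delta m E | x.1 i < e} := by
  have hm0 : (0:ℝ) < m := by exact_mod_cast hm
  set b := E / (2 * m) with hb
  have hb0 : 0 < b := by positivity
  refine ⟨1 / √E * b ^ (Finset.univ \ {i} : Finset (Fin m)).card, by positivity, b, hb0,
    fun e he heb => ?_⟩
  have hBm : MeasurableSet {x : Delta m E | x.1 i < e} := measB i _
  rw [piPre, withDensity_apply _ hBm]
  have h1 : volume (Set.pi univ fun j : Fin m => Ioo (0:ℝ) (Function.update (fun _ => b) i e j))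
      ≤ lebU m E {x : Delta m E | x.1 i < e} := by
    rw [lebU, comap_subtype_coe_apply meas_simU]
    apply measure_mono
    intro x hx
    have hx' : ∀ j, 0 < x j ∧ x j < Function.update (fun _ => b) i e j := fun j => hx j trivial
    have hxU : x ∈ simU m E := by
      refine ⟨fun j => (hx' j).1, ?_⟩
      calc ∑ j, x j ≤ ∑ _j : Fin m, b := by
            refine Finset.sum_le_sum fun j _ => (hx' j).2.le.trans ?_
            by_cases h : j = i
            · subst h; simpa using heb
            · simp [h]
        _ = E / 2 := by simp [hb]; field_simp
        _ < E := by linarith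
    refine ⟨⟨x, hxU⟩, ?_, rfl⟩
    have := (hx' i).2
    simpa using this
  have h2 : volume (Set.pi univ fun j : Fin m => Ioo (0:ℝ) (Function.update (fun _ => b) i e j))
      = ENNReal.ofReal (b ^ (Finset.univ \ {i} : Finset (Fin m)).card * e) := by
    have := Real.volume_pi_Ioo (a := fun _ : Fin m => (0:ℝ)) (b := Function.update (fun _ => b) i e)
    rw [this]
    simp only [sub_zero]
    rw [← ENNReal.ofReal_prod_of_nonneg, Finset.prod_update_of_mem (Finset.mem_univ i)]
    · simp [mul_comm]
    · intro j _
      by_cases h : j = i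
      · subst h; simpa using he.le
      · simp [h, hb0.le]
  calc _ = ENNReal.ofReal (1 / √E) * ENNReal.ofReal (b ^ (Finset.univ \ {i} : Finset (Fin m)).card * e) := by
        rw [← ENNReal.ofReal_mul (by positivity)]; congr 1; ring
    _ ≤ ENNReal.ofReal (1 / √E) * lebU m E {x : Delta m E | x.1 i < e} := by
        rw [← h2]; gcongr
    _ = ∫⁻ _x in {x : Delta m E | x.1 i < e}, ENNReal.ofReal (1 / √E) ∂(lebU m E) := by
        rw [setLIntegral_const]
    _ ≤ _ := by
        refine lintegral_mono fun x => ENNReal.ofReal_le_ofReal ?_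
        rw [rpow_tank]
        have := tank_pos x
        have h3 : tank m E x ≤ E := by
          rw [tank]; linarith [Finset.sum_nonneg fun j (_ : j ∈ Finset.univ) => (x.2.1 j).le]
        have := Real.sqrt_pos.2 this
        gcongr

lemma pi_facts (hm : 1 ≤ m) (hE : 0 < E) (i : Fin m) :
    ∫⁻ x, ENNReal.ofReal (1 / √(x.1 i)) ∂(piMeasure m E) < ⊤ ∧
    ∃ k > 0, ∃ e0 > 0, ∀ e : ℝ, 0 < e → e ≤ e0 →
      ENNReal.ofReal (k * e) ≤ piMeasure m E {x : Delta m E | x.1 i < e} := by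
  obtain ⟨k, hk, e0, he0, h⟩ := piPre_lower hm hE i
  have hZ0 : piPre m E univ ≠ 0 := by
    intro h0
    have h1 := (h e0 he0 le_rfl).trans (measure_mono (subset_univ _))
    rw [h0, nonpos_iff_eq_zero, ENNReal.ofReal_eq_zero] at h1
    have : 0 < k * e0 := by positivity
    linarith
  have hZ : piPre m E univ ≠ ⊤ := by
    have h1 : piPre m E univ ≤ ∫⁻ x, ENNReal.ofReal (√E) * ENNReal.ofReal (1 / √(x.1 i)) ∂(piPre m E) := by
      rw [← lintegral_one]
      refine lintegral_mono fun x => ?_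
      rw [← ENNReal.ofReal_mul (by positivity), ← ENNReal.ofReal_one]
      apply ENNReal.ofReal_le_ofReal
      have := Real.sqrt_pos.2 (x.2.1 i)
      rw [mul_one_div, one_le_div this]
      exact Real.sqrt_le_sqrt (x_lt x i).le
    rw [lintegral_const_mul' _ _ ENNReal.ofReal_ne_top] at h1
    exact (lt_of_le_of_lt h1 (ENNReal.mul_lt_top ENNReal.ofReal_lt_top (piPre_int i))).ne
  constructor
  · rw [piMeasure, lintegral_smul_measure, smul_eq_mul]
    exact ENNReal.mul_lt_top (ENNReal.inv_lt_top.2 (pos_iff_ne_zero.2 hZ0)) (piPre_int i)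
  · have hzr : 0 < (piPre m E univ).toReal := ENNReal.toReal_pos hZ0 hZ
    refine ⟨(piPre m E univ).toReal⁻¹ * k, by positivity, e0, he0, fun e he hee => ?_⟩
    rw [piMeasure, Measure.smul_apply, smul_eq_mul, mul_assoc, ENNReal.ofReal_mul (by positivity),
      ENNReal.ofReal_inv_of_pos hzr, ENNReal.ofReal_toReal hZ]
    gcongr
    exact h e he hee


noncomputable def HH (C2 C3 C4 : ℝ) (i : Fin m) (s : ℝ) (x : Delta m E) : ℝ :=
  C2 * q2 i s x + (C3 * q3 i s x + C4 * q4 i s x)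

lemma HH_nonneg {C2 C3 C4 : ℝ} (h2 : 0 < C2) (h3 : 0 < C3) (h4 : 0 < C4) (i : Fin m) {s : ℝ}
    (hs : 0 < s) (x : Delta m E) : 0 ≤ HH C2 C3 C4 i s x := by
  have := q2_nonneg i hs x
  have := q3_nonneg i hs x
  have := q4_nonneg i hs x
  unfold HH; positivity

lemma meas_HH (C2 C3 C4 : ℝ) (i : Fin m) (s : ℝ) : Measurable (HH (E := E) C2 C3 C4 i s) :=
  ((meas_q2 i s).const_mul _).add
    (((meas_q3 i s).const_mul _).add ((meas_q4 i s).const_mul _))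

lemma q2_dom (i : Fin m) {s : ℝ} (hs : 0 < s) (x : Delta m E) :
    q2 i s x ≤ s ^ 2 * (1 / √(x.1 i)) := by
  have ha := x.2.1 i
  have hy := tank_pos x
  have hr := Real.sqrt_pos.2 ha
  unfold q2
  calc s ^ 4 * √(x.1 i) / ((x.1 i + s ^ 2) * (tank m E x + s ^ 2))
      ≤ s ^ 4 * √(x.1 i) / (x.1 i * s ^ 2) := by
        gcongr
        · linarith [sq_nonneg s]
        · linarith
    _ = s ^ 2 * (1 / √(x.1 i)) := by
        have h := Real.mul_self_sqrt ha.le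
        nth_rewrite 2 [← h]
        field_simp

lemma q3_dom (i : Fin m) {s : ℝ} (hs : 0 < s) (x : Delta m E) :
    q3 i s x ≤ s ^ 2 * (1 / √(x.1 i)) := by
  have ha := x.2.1 i
  have hr := Real.sqrt_pos.2 ha
  unfold q3
  rw [mul_one_div, div_le_div_iff₀ (by positivity) hr]
  have h := Real.mul_self_sqrt ha.le
  nth_rewrite 2 [← h]
  have h1 : 0 ≤ s ^ 2 * (√(x.1 i) * √(x.1 i) + s ^ 2 - s * √(x.1 i)) := by
    have : 0 ≤ √(x.1 i) * √(x.1 i) + s ^ 2 - s * √(x.1 i) := by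
      nlinarith [sq_nonneg (√(x.1 i) - s), mul_pos hs hr]
    positivity
  nlinarith

lemma q4_dom (i : Fin m) {s : ℝ} (hs : 0 < s) (x : Delta m E) :
    q4 i s x ≤ s ^ 2 * (√E * (1 / √(x.1 i))) := by
  have ha := x.2.1 i
  have hy := tank_pos x
  have hr := Real.sqrt_pos.2 ha
  have h0 : q4 i s x ≤ s ^ 2 := by
    unfold q4
    rw [div_le_iff₀ (by positivity)]
    have h1 : √(x.1 i) ≤ √(x.1 i + s ^ 2) := Real.sqrt_le_sqrt (by linarith [sq_nonneg s])
    have e : √√(s ^ 2) = √s := by rw [Real.sqrt_sq hs.le]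
    have h2 : √s ≤ √√(x.1 i + s ^ 2) := by
      rw [← e]; exact Real.sqrt_le_sqrt (Real.sqrt_le_sqrt (by linarith))
    have h3 : √s ≤ √√(tank m E x + s ^ 2) := by
      rw [← e]; exact Real.sqrt_le_sqrt (Real.sqrt_le_sqrt (by linarith))
    calc s ^ 3 * √(x.1 i) = s ^ 2 * (√(x.1 i) * √s * √s) := by
          rw [mul_assoc (√(x.1 i)), Real.mul_self_sqrt hs.le]; ring
      _ ≤ _ := by gcongr
  refine h0.trans ?_
  have : 1 ≤ √E * (1 / √(x.1 i)) := by
    rw [mul_one_div, one_le_div hr]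
    exact Real.sqrt_le_sqrt (x_lt x i).le
  nlinarith [sq_nonneg s]

lemma HH_dom {C2 C3 C4 : ℝ} (h2 : 0 < C2) (h3 : 0 < C3) (h4 : 0 < C4) (i : Fin m) {s : ℝ}
    (hs : 0 < s) (x : Delta m E) :
    HH C2 C3 C4 i s x / s ^ 2 ≤ (C2 + C3 + C4 * √E) * (1 / √(x.1 i)) := by
  rw [div_le_iff₀ (by positivity)]
  have a2 := mul_le_mul_of_nonneg_left (q2_dom i hs x) h2.le
  have a3 := mul_le_mul_of_nonneg_left (q3_dom i hs x) h3.le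
  have a4 := mul_le_mul_of_nonneg_left (q4_dom i hs x) h4.le
  unfold HH
  nlinarith

lemma HH_tendsto (C2 C3 C4 : ℝ) (i : Fin m) (x : Delta m E) :
    Tendsto (fun s => HH C2 C3 C4 i s x / s ^ 2) (nhdsWithin 0 (Ioi 0)) (nhds 0) := by
  have ha := x.2.1 i
  have hy := tank_pos x
  let g : ℝ → ℝ := fun s => C2 * (s ^ 2 * √(x.1 i) / ((x.1 i + s ^ 2) * (tank m E x + s ^ 2)))
    + (C3 * (s / (x.1 i + s ^ 2)) + C4 * (s * √(x.1 i) /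
      (√(x.1 i + s ^ 2) * √√(x.1 i + s ^ 2) * √√(tank m E x + s ^ 2))))
  have hg : Continuous g := by
    refine (continuous_const.mul (Continuous.div (by fun_prop) (by fun_prop) fun s => ?_)).add
      ((continuous_const.mul (Continuous.div (by fun_prop) (by fun_prop) fun s => ?_)).add
      (continuous_const.mul (Continuous.div (by fun_prop) (by fun_prop) fun s => ?_)))
    all_goals positivity
  have h0 : g 0 = 0 := by simp [g]
  have h1 : Tendsto g (nhdsWithin 0 (Ioi 0)) (nhds 0) := by
    have := hg.tendsto 0
    rw [h0] at this
    exact this.mono_left nhdsWithin_le_nhds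
  refine h1.congr' ?_
  filter_upwards [self_mem_nhdsWithin] with s hs
  have hs : 0 < s := hs
  simp only [g, HH, q2, q3, q4]
  have p1 : 0 < √(x.1 i + s ^ 2) := by positivity
  have p2 : 0 < √√(x.1 i + s ^ 2) := by positivity
  have p3 : 0 < √√(tank m E x + s ^ 2) := by positivity
  generalize √√(x.1 i + s ^ 2) = u2 at *
  generalize √(x.1 i + s ^ 2) = u1 at *
  generalize √√(tank m E x + s ^ 2) = u3 at *
  field_simp

lemma int_dom (hm : 1 ≤ m) (hE : 0 < E) (i : Fin m) (μ : Measure (Delta m E))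
    [IsProbabilityMeasure μ] (c e : ℝ) (he : 0 < e)
    (h : μ.restrict {x : Delta m E | x.1 i < e}
      ≤ ENNReal.ofReal c • (piMeasure m E).restrict {x : Delta m E | x.1 i < e}) :
    ∫⁻ x, ENNReal.ofReal (1 / √(x.1 i)) ∂μ < ⊤ := by
  rw [← lintegral_add_compl _ (measB i e)]
  refine ENNReal.add_lt_top.2 ⟨?_, ?_⟩
  · refine lt_of_le_of_lt (lintegral_mono' h le_rfl) ?_
    rw [lintegral_smul_measure, smul_eq_mul]
    exact ENNReal.mul_lt_top ENNReal.ofReal_lt_top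
      ((setLIntegral_le_lintegral _ _).trans_lt (pi_facts hm hE i).1)
  · calc _ ≤ ∫⁻ _x in {x : Delta m E | x.1 i < e}ᶜ, ENNReal.ofReal (1 / √e) ∂μ := by
          refine setLIntegral_mono measurable_const fun x hx => ?_
          have hx : e ≤ x.1 i := not_lt.1 hx
          apply ENNReal.ofReal_le_ofReal
          have := Real.sqrt_pos.2 he
          gcongr
      _ < ⊤ := by
          rw [setLIntegral_const]
          exact ENNReal.mul_lt_top ENNReal.ofReal_lt_top (measure_lt_top _ _)

lemma HH_small {C2 C3 C4 : ℝ} (h2 : 0 < C2) (h3 : 0 < C3) (h4 : 0 < C4) (i : Fin m)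
    (μ : Measure (Delta m E)) (h : ∫⁻ x, ENNReal.ofReal (1 / √(x.1 i)) ∂μ < ⊤)
    {η : ℝ} (hη : 0 < η) :
    ∃ s0 > 0, ∀ s, 0 < s → s < s0 →
      ∫⁻ x, ENNReal.ofReal (HH C2 C3 C4 i s x) ∂μ ≤ ENNReal.ofReal (η * s ^ 2) := by
  have key : Tendsto (fun s : ℝ => ∫⁻ x, ENNReal.ofReal (HH C2 C3 C4 i s x / s ^ 2) ∂μ)
      (nhdsWithin 0 (Ioi 0)) (nhds (∫⁻ _x : Delta m E, 0 ∂μ)) := by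
    refine tendsto_lintegral_filter_of_dominated_convergence
      (fun x => ENNReal.ofReal (C2 + C3 + C4 * √E) * ENNReal.ofReal (1 / √(x.1 i))) ?_ ?_ ?_ ?_
    · exact Eventually.of_forall fun s => ((meas_HH C2 C3 C4 i s).div_const _).ennreal_ofReal
    · filter_upwards [self_mem_nhdsWithin] with s hs
      refine Eventually.of_forall fun x => ?_
      rw [← ENNReal.ofReal_mul (by positivity)]
      exact ENNReal.ofReal_le_ofReal (HH_dom h2 h3 h4 i hs x)
    · rw [lintegral_const_mul' _ _ ENNReal.ofReal_ne_top]
      exact (ENNReal.mul_lt_top ENNReal.ofReal_lt_top h).ne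
    · refine Eventually.of_forall fun x => ?_
      have := (ENNReal.continuous_ofReal.tendsto 0).comp (HH_tendsto C2 C3 C4 i x)
      rw [ENNReal.ofReal_zero] at this
      exact this
  rw [lintegral_zero] at key
  have h1 := key.eventually (ge_mem_nhds (ENNReal.ofReal_pos.2 hη))
  obtain ⟨s0, hs0, H⟩ := mem_nhdsGT_iff_exists_Ioo_subset.1 h1
  refine ⟨s0, hs0, fun s hs hss => ?_⟩
  have h5 : ∫⁻ x, ENNReal.ofReal (HH C2 C3 C4 i s x / s ^ 2) ∂μ ≤ ENNReal.ofReal η := H ⟨hs, hss⟩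
  have e : ∀ x : Delta m E, ENNReal.ofReal (HH C2 C3 C4 i s x)
      = ENNReal.ofReal (s ^ 2) * ENNReal.ofReal (HH C2 C3 C4 i s x / s ^ 2) := by
    intro x
    rw [← ENNReal.ofReal_mul (by positivity)]
    congr 1
    field_simp
  simp only [e]
  rw [lintegral_const_mul' _ _ ENNReal.ofReal_ne_top, mul_comm η, ENNReal.ofReal_mul (by positivity)]
  gcongr

lemma upper (hm : 1 ≤ m) (hE : 0 < E) (i : Fin m) (μ : Measure (Delta m E))
    [IsProbabilityMeasure μ] {C2 C3 C4 C s t : ℝ} (h2 : 0 < C2) (h3 : 0 < C3) (h4 : 0 < C4)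
    (hC : 0 < C) (hs : 0 < s) (ht : 0 ≤ t)
    (hd : ∀ x : Delta m E, ∫⁻ z, ENNReal.ofReal (FF C2 C3 C4 i s z) ∂(ustep m E x)
        ≤ ENNReal.ofReal (FF C2 C3 C4 i s x + C * s ^ 3 / Lam m E)) :
    (μ.bind (Pt m E t)) {x : Delta m E | x.1 i < s ^ 2} ≤ μ {x : Delta m E | x.1 i < s ^ 2}
      + ∫⁻ x, ENNReal.ofReal (HH C2 C3 C4 i s x) ∂μ + ENNReal.ofReal (C * t * s ^ 3) := by
  have hL := Lam_pos hm hE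
  have hB := measB (E := E) i (s ^ 2)
  have hFF : ∀ x : Delta m E, FF C2 C3 C4 i s x = q1 i s x + HH C2 C3 C4 i s x := fun _ => rfl
  have hq : ∀ x : Delta m E, ENNReal.ofReal (q1 i s x)
      = {x : Delta m E | x.1 i < s ^ 2}.indicator 1 x := by
    intro x
    by_cases hx : x.1 i < s ^ 2
    · rw [indicator_of_mem (by exact hx)]; simp [q1, hx]
    · rw [indicator_of_notMem (by exact hx)]; simp [q1, hx]
  rw [Measure.bind_apply hB (measurable_Pt t).aemeasurable]
  calc ∫⁻ x, Pt m E t x {x : Delta m E | x.1 i < s ^ 2} ∂μ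
      ≤ ∫⁻ x, (ENNReal.ofReal (FF C2 C3 C4 i s x) + ENNReal.ofReal (C * t * s ^ 3)) ∂μ := by
        refine lintegral_mono fun x => ?_
        rw [← lintegral_indicator_one hB]
        calc _ ≤ ∫⁻ z, ENNReal.ofReal (FF C2 C3 C4 i s z) ∂(Pt m E t x) := by
              refine lintegral_mono fun z => ?_
              rw [← hq]
              apply ENNReal.ofReal_le_ofReal
              rw [hFF]
              linarith [HH_nonneg h2 h3 h4 i hs z]
          _ ≤ ENNReal.ofReal (FF C2 C3 C4 i s x)
              + ENNReal.ofReal (Lam m E * t) * ENNReal.ofReal (C * s ^ 3 / Lam m E) := by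
              refine Pt_le hm hE (meas_FF C2 C3 C4 i s).ennreal_ofReal _ (fun x => ?_) ht x
              rw [← ENNReal.ofReal_add]
              · exact hd x
              · rw [hFF]; linarith [HH_nonneg h2 h3 h4 i hs x, q1_nonneg i s x]
              · positivity
          _ = _ := by
              rw [← ENNReal.ofReal_mul (by positivity)]
              congr 2
              field_simp
    _ = _ := by
        rw [lintegral_add_right _ measurable_const]
        congr 1
        · have : ∀ x : Delta m E, ENNReal.ofReal (FF C2 C3 C4 i s x)
            = {x : Delta m E | x.1 i < s ^ 2}.indicator 1 x + ENNReal.ofReal (HH C2 C3 C4 i s x) := by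
            intro x
            rw [hFF, ENNReal.ofReal_add (q1_nonneg i s x) (HH_nonneg h2 h3 h4 i hs x), hq]
          simp only [this]
          rw [lintegral_add_right _ (meas_HH C2 C3 C4 i s).ennreal_ofReal, lintegral_indicator_one hB]
        · simp

lemma lower (hm : 1 ≤ m) (hE : 0 < E) (i : Fin m) (ν : Measure (Delta m E))
    {s t : ℝ} (hs : 0 < s) (hsL : s ≤ Lam m E) (ht : 0 ≤ t) :
    ENNReal.ofReal (Real.exp (-(s * t))) * ν {x : Delta m E | x.1 i < s ^ 2}
      ≤ (ν.bind (Pt m E t)) {x : Delta m E | x.1 i < s ^ 2} := by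
  have hB := measB (E := E) i (s ^ 2)
  rw [Measure.bind_apply hB (measurable_Pt t).aemeasurable, ← setLIntegral_const]
  refine le_trans ?_ (setLIntegral_le_lintegral {x : Delta m E | x.1 i < s ^ 2} _)
  exact setLIntegral_mono' hB fun x hx => Pt_ge hm hE i hs hsL ht x hx

lemma bind_univ_le (hm : 1 ≤ m) (hE : 0 < E) (μ : Measure (Delta m E)) [IsProbabilityMeasure μ]
    {t : ℝ} (ht : 0 ≤ t) (A : Set (Delta m E)) : (μ.bind (Pt m E t)) A ≤ 1 := by
  refine (measure_mono (subset_univ A)).trans ?_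
  rw [Measure.bind_apply MeasurableSet.univ (measurable_Pt t).aemeasurable]
  calc _ ≤ ∫⁻ _x : Delta m E, 1 ∂μ := lintegral_mono fun x => Pt_univ_le hm hE ht x
    _ = 1 := by simp

lemma tv_ge (hm : 1 ≤ m) (hE : 0 < E) (μ ν : Measure (Delta m E)) [IsProbabilityMeasure μ]
    [IsProbabilityMeasure ν] {t : ℝ} (ht : 0 ≤ t) {A : Set (Delta m E)} (hA : MeasurableSet A) :
    ((ν.bind (Pt m E t)) A).toReal - ((μ.bind (Pt m E t)) A).toReal
      ≤ tvDist (μ.bind (Pt m E t)) (ν.bind (Pt m E t)) := by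
  have hle : ∀ (μ : Measure (Delta m E)) [IsProbabilityMeasure μ] (A : Set (Delta m E)),
      ((μ.bind (Pt m E t)) A).toReal ≤ 1 := fun μ _ A =>
    ENNReal.toReal_le_of_le_ofReal zero_le_one (by simpa using bind_univ_le hm hE μ ht A)
  unfold tvDist
  refine le_trans ?_ (le_ciSup (f := fun A : {A : Set (Delta m E) // MeasurableSet A} =>
    |((μ.bind (Pt m E t)) A.1).toReal - ((ν.bind (Pt m E t)) A.1).toReal|) ?_ ⟨A, hA⟩)
  · rw [abs_sub_comm]; exact le_abs_self _
  · refine ⟨1, ?_⟩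
    rintro _ ⟨B, rfl⟩
    have a1 := hle μ B.1
    have a2 := hle ν B.1
    have a3 : 0 ≤ ((μ.bind (Pt m E t)) B.1).toReal := ENNReal.toReal_nonneg
    have a4 : 0 ≤ ((ν.bind (Pt m E t)) B.1).toReal := ENNReal.toReal_nonneg
    exact abs_le.2 ⟨by linarith, by linarith⟩

end Helpers

/-- tightness of the rate `t^{-2}`. Fix `i`, `0 < c < 1 < c'`, and
let `B_ε = {x ∈ Δ : x^i < ε}`. If `μ|_{B_ε} ≤ c·π|_{B_ε}` and `ν|_{B_ε} ≥ c'·π|_{B_ε}`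
for all sufficiently small `ε > 0`, then `‖μP^t - νP^t‖_TV ≥ κ t^{-2}` for some `κ > 0`
and all large `t`. -/
theorem tv_lower_bound (m : ℕ) (hm : 1 ≤ m) (E : ℝ) (hE : 0 < E)
    (i : Fin m) (c c' : ℝ) (hc : 0 < c) (hc1 : c < 1) (hc' : 1 < c')
    (μ ν : Measure (Delta m E)) (hμ : IsProbabilityMeasure μ) (hν : IsProbabilityMeasure ν)
    (hsmall : ∃ ε₁ > 0, ∀ ε : ℝ, 0 < ε → ε < ε₁ →
      (μ.restrict {x : Delta m E | x.1 i < ε}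
          ≤ ENNReal.ofReal c • (piMeasure m E).restrict {x : Delta m E | x.1 i < ε}) ∧
      (ENNReal.ofReal c' • (piMeasure m E).restrict {x : Delta m E | x.1 i < ε}
          ≤ ν.restrict {x : Delta m E | x.1 i < ε})) :
    ∃ κ > 0, ∃ t₀ > 0, ∀ t : ℝ, t₀ ≤ t →
      κ / t ^ 2 ≤ tvDist (μ.bind (Pt m E t)) (ν.bind (Pt m E t)) := by
  obtain ⟨ε₁, hε₁, H⟩ := hsmall
  obtain ⟨C2, C3, C4, C, h2, h3, h4, hC, hd⟩ := drift hm hE i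
  obtain ⟨-, k, hk, e0, he0, hk2⟩ := pi_facts hm hE i
  have hL := Lam_pos hm hE
  have hc10 : 0 < 1 - c := by linarith
  have hint := int_dom hm hE i μ c (ε₁ / 2) (by positivity) (H (ε₁ / 2) (by positivity)
    (by linarith)).1
  have hη : 0 < (1 - c) * k / 4 := by positivity
  obtain ⟨s0, hs0, hsm⟩ := HH_small h2 h3 h4 i μ hint hη
  have hlog : 0 < Real.log c' := Real.log_pos hc'
  obtain ⟨d, hd0, hd1, hd2⟩ : ∃ d : ℝ, 0 < d ∧ d ≤ Real.log c' ∧ C * d ≤ (1 - c) * k / 4 := by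
    refine ⟨min (Real.log c') ((1 - c) * k / 4 / C), lt_min hlog (by positivity),
      min_le_left _ _, ?_⟩
    calc C * min (Real.log c') ((1 - c) * k / 4 / C) ≤ C * ((1 - c) * k / 4 / C) := by
          gcongr; exact min_le_right _ _
      _ = _ := by field_simp
  have hexp : 1 ≤ Real.exp (-d) * c' := by
    have : Real.exp d ≤ c' := by
      rw [← Real.exp_log (show 0 < c' by linarith)]; exact Real.exp_le_exp.2 hd1
    rw [Real.exp_neg, inv_mul_eq_div, one_le_div (Real.exp_pos _)]
    exact this
  have hlim : Tendsto (fun t : ℝ => d / t) atTop (nhds 0) := tendsto_const_nhds.div_atTop tendsto_id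
  have hlim2 : Tendsto (fun t : ℝ => (d / t) ^ 2) atTop (nhds 0) := by
    have := hlim.pow 2
    simpa using this
  have hev := ((((hlim.eventually (gt_mem_nhds one_pos)).and
    (hlim.eventually (gt_mem_nhds hL))).and (hlim.eventually (gt_mem_nhds hs0))).and
    ((hlim2.eventually (gt_mem_nhds he0)).and (hlim2.eventually (gt_mem_nhds hε₁)))).and
    (eventually_gt_atTop 0)
  obtain ⟨t₁, ht₁⟩ := eventually_atTop.1 hev
  refine ⟨(1 - c) * k * d ^ 2 / 2, by positivity, max t₁ 1, by positivity, fun t ht => ?_⟩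
  obtain ⟨⟨⟨⟨a1, a2⟩, a3⟩, a4, a5⟩, a6⟩ := ht₁ t ((le_max_left _ _).trans ht)
  obtain ⟨s, hs⟩ : ∃ s, s = d / t := ⟨_, rfl⟩
  rw [← hs] at a1 a2 a3 a4 a5
  have hs0 : 0 < s := by rw [hs]; positivity
  have hst : s * t = d := by rw [hs]; field_simp
  have hB := measB (E := E) i (s ^ 2)
  have hs2 : 0 < s ^ 2 := by positivity
  have hup := upper hm hE i μ h2 h3 h4 hC hs0 a6.le (hd s hs0 a1.le)
  have hlo := lower hm hE i ν hs0 a2.le a6.le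
  have hsm := hsm s hs0 a3
  have hkB := hk2 (s ^ 2) hs2 a4.le
  obtain ⟨Hμ, Hν⟩ := H (s ^ 2) hs2 a5
  have Hμ' := Hμ {x : Delta m E | x.1 i < s ^ 2}
  have Hν' := Hν {x : Delta m E | x.1 i < s ^ 2}
  rw [Measure.smul_apply, Measure.restrict_apply_self, Measure.restrict_apply_self,
    smul_eq_mul] at Hμ' Hν'
  have htv := tv_ge hm hE μ ν a6.le hB
  have hN1 := bind_univ_le hm hE ν a6.le {x : Delta m E | x.1 i < s ^ 2}
  have hν1 : ν {x : Delta m E | x.1 i < s ^ 2} ≤ 1 := prob_le_one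
  generalize tvDist (μ.bind (Pt m E t)) (ν.bind (Pt m E t)) = tv at *
  generalize (μ.bind (Pt m E t)) {x : Delta m E | x.1 i < s ^ 2} = M at *
  generalize (ν.bind (Pt m E t)) {x : Delta m E | x.1 i < s ^ 2} = N at *
  generalize μ {x : Delta m E | x.1 i < s ^ 2} = mB at *
  generalize ν {x : Delta m E | x.1 i < s ^ 2} = nB at *
  generalize piMeasure m E {x : Delta m E | x.1 i < s ^ 2} = pB at *
  have hpT : pB ≠ ⊤ := by
    intro h
    rw [h, ENNReal.mul_top (by simpa using by linarith)] at Hν'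
    exact absurd (Hν'.trans hν1) (by simp)
  have hNT : N ≠ ⊤ := (hN1.trans_lt ENNReal.one_lt_top).ne
  obtain ⟨p, hp0, rfl⟩ : ∃ p : ℝ, 0 ≤ p ∧ pB = ENNReal.ofReal p :=
    ⟨pB.toReal, ENNReal.toReal_nonneg, (ENNReal.ofReal_toReal hpT).symm⟩
  have hpk : k * s ^ 2 ≤ p := (ENNReal.ofReal_le_ofReal_iff hp0).1 hkB
  have hM : M.toReal ≤ c * p + (1 - c) * k / 4 * s ^ 2 + C * t * s ^ 3 := by
    apply ENNReal.toReal_le_of_le_ofReal (by positivity)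
    rw [ENNReal.ofReal_add (by positivity) (by positivity),
      ENNReal.ofReal_add (by positivity) (by positivity), ENNReal.ofReal_mul hc.le]
    refine hup.trans ?_
    gcongr
  have hN : p ≤ N.toReal := by
    rw [← ENNReal.ofReal_le_iff_le_toReal hNT]
    rw [hst] at hlo
    refine le_trans ?_ ((mul_le_mul_right Hν' _).trans hlo)
    rw [← ENNReal.ofReal_mul (by linarith), ← ENNReal.ofReal_mul (Real.exp_pos _).le]
    apply ENNReal.ofReal_le_ofReal
    nlinarith
  have e1 : C * t * s ^ 3 = C * d * s ^ 2 := by rw [← hst]; ring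
  have e2 : (1 - c) * k * d ^ 2 / 2 / t ^ 2 = (1 - c) * k / 2 * s ^ 2 := by
    rw [hs]; field_simp
  rw [e2]
  rw [e1] at hM
  have i1 := mul_le_mul_of_nonneg_right hd2 hs2.le
  have i2 := mul_le_mul_of_nonneg_left hpk hc10.le
  nlinarith
end
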